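/- Every simple non-regular binary matroid of rank 7 with no AG(3,2)-minor has at most 25 elements, and if it has exactly 25 elements then it is isomorphic to the generalized parallel connection along a line of M(K_7) and F7. -/

import Mathlib

open Matroid Set

variable {α : Type*}

/-- Deletion of a set of elements from a matroid. -/
def Matroid.del (M : Matroid α) (D : Set α) : Matroid α := M ↾ (M.E \ D)

/-- Contraction of a set of elements in a matroid, defined by duality. -/
def Matroid.con (M : Matroid α) (C : Set α) : Matroid α := ((M✶).del C)✶

/-- `N` is a minor of `M` if it is obtained from `M` by a contraction followed by a deletion. -/
def Matroid.IsMinorOf (N M : Matroid α) : Prop := ∃ C D : Set α, N = (M.con C).del D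

/-- `C` is a circuit of `M`: a dependent set all of whose proper subsets are independent. -/
def Matroid.IsCircuitSet (M : Matroid α) (C : Set α) : Prop :=
  M.Dep C ∧ ∀ D ⊂ C, M.Indep D

/-- A matroid is simple if it has no circuits of size one or two, equivalently every
one- or two-element subset of the ground set is independent. -/
def Matroid.IsSimpleM (M : Matroid α) : Prop := ∀ e ∈ M.E, ∀ f ∈ M.E, M.Indep {e, f}

/-- The rank of a set `X` in a matroid `M`: the supremum of the sizes of independent
subsets of `X`. -/
noncomputable def Matroid.rks (M : Matroid α) (X : Set α) : ℕ :=
  sSup {n : ℕ | ∃ I ⊆ X, M.Indep I ∧ I.ncard = n}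

/-- The rank of a matroid. -/
noncomputable def Matroid.rkM (M : Matroid α) : ℕ := M.rks M.E

/-- `M` is represented over the field `F` by the vector assignment `φ`:
a subset of the ground set is independent iff `φ` is linearly independent on it. -/
def Matroid.IsRepBy (M : Matroid α) (F : Type*) [Field F] {W : Type*} [AddCommGroup W]
    [Module F W] (φ : α → W) : Prop :=
  ∀ I ⊆ M.E, (M.Indep I ↔ LinearIndependent F (I.restrict φ))

/-- `M` is representable over the field `F`. -/
def Matroid.IsRepOver (M : Matroid α) (F : Type) [Field F] : Prop :=
  ∃ (n : ℕ) (φ : α → (Fin n → F)), M.IsRepBy F φ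

/-- A binary matroid is one representable over the two-element field `GF(2)`. -/
def Matroid.IsBinaryM (M : Matroid α) : Prop := M.IsRepOver (ZMod 2)

/-- A regular matroid is one representable over every field. -/
def Matroid.IsRegularM (M : Matroid α) : Prop := ∀ (F : Type) [Field F], M.IsRepOver F

/-- `M` is isomorphic to the binary vector matroid on the set of vectors `V`:
there is a representation of `M` over `GF(2)` mapping the ground set bijectively to `V`. -/
def Matroid.IsBinaryIsoTo (M : Matroid α) {W : Type*} [AddCommGroup W] [Module (ZMod 2) W]
    (V : Set W) : Prop :=
  ∃ φ : α → W, M.IsRepBy (ZMod 2) φ ∧ Set.BijOn φ M.E V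

/-- The eight points of the binary affine cube `AG(3,2)`: the vectors `(1, x)` in `GF(2)⁴`. -/
def agVecs : Set (Fin 4 → ZMod 2) := {x | x 0 = 1}

/-- `M` has a minor isomorphic to `AG(3,2)`. -/
def Matroid.HasAGMinor (M : Matroid α) : Prop :=
  ∃ N : Matroid α, N.IsMinorOf M ∧ N.IsBinaryIsoTo agVecs

/-- The seven points of the Fano plane `F₇`: the nonzero vectors of `GF(2)³`. -/
def fanoVecs : Set (Fin 3 → ZMod 2) := {x | x ≠ 0}

/-- The vectors `eᵢ + eⱼ` (`i ≠ j`) representing the graphic matroid `M(K_n)`. -/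
def kVecs (n : ℕ) : Set (Fin n → ZMod 2) :=
  {x | ∃ i j : Fin n, i ≠ j ∧ x = Pi.single i 1 + Pi.single j 1}

/-- `ℓ` is a line (3-element circuit) of `M` through `x`. -/
def Matroid.IsLineThru (M : Matroid α) (x : α) (ℓ : Set α) : Prop :=
  M.IsCircuitSet ℓ ∧ ℓ.ncard = 3 ∧ x ∈ ℓ

/-- A matroid is connected if it is nonempty and every two distinct elements of the
ground set lie in a common circuit. -/
def Matroid.IsConnectedM (M : Matroid α) : Prop :=
  M.E.Nonempty ∧ ∀ e ∈ M.E, ∀ f ∈ M.E, e ≠ f →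
    ∃ C, M.IsCircuitSet C ∧ e ∈ C ∧ f ∈ C

/-- A matroid is 3-connected if it is connected and has no 2-separation, i.e. no partition
`(A, B)` of the ground set with `|A| ≥ 2`, `|B| ≥ 2` and `r(A) + r(B) - r(M) ≤ 1`. -/
def Matroid.IsThreeConnected (M : Matroid α) : Prop :=
  M.IsConnectedM ∧ ¬ ∃ A B : Set α, A ∪ B = M.E ∧ Disjoint A B ∧
    2 ≤ A.ncard ∧ 2 ≤ B.ncard ∧ M.rks A + M.rks B ≤ M.rkM + 1

/-- The vectors representing the generalized parallel connection along a line of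
`M(K_r)` and `F₇` in `GF(2)^{r+1}`: the vectors `eᵢ + eⱼ` for `1 ≤ i < j ≤ r` together with
`e₀+e₁`, `e₀+e₂`, `e₀+e₃` and `e₀+e₁+e₂+e₃`. -/
def gpcVecs (r : ℕ) : Set (Fin (r + 1) → ZMod 2) :=
  {x | ∃ i j : Fin (r + 1), i ≠ 0 ∧ j ≠ 0 ∧ i ≠ j ∧ x = Pi.single i 1 + Pi.single j 1} ∪
    {Pi.single 0 1 + Pi.single 1 1, Pi.single 0 1 + Pi.single 2 1, Pi.single 0 1 + Pi.single 3 1,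
      Pi.single 0 1 + Pi.single 1 1 + Pi.single 2 1 + Pi.single 3 1}


/-! ## A small certificate checker on bit masks -/

namespace Eng

noncomputable section

/-- Evaluate `n` before passing it on (helps kernel evaluation). -/
def frc {β : Type} (n : ℕ) (f : ℕ → β) : β :=
  Nat.rec (motive := fun _ => β) (f 0) (fun k _ => f (Nat.succ k)) n

theorem frc_eq {β : Type} (n : ℕ) (f : ℕ → β) : frc n f = f n := by
  cases n <;> rfl

/-- Branch on `n = 0`. -/
def ifz {β : Type} (n : ℕ) (a b : β) : β :=
  Nat.rec (motive := fun _ => β) a (fun _ _ => b) n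

theorem ifz_eq {β : Type} (n : ℕ) (a b : β) : ifz n a b = if n = 0 then a else b := by
  cases n <;> simp [ifz]

/-- One bit of `m`. -/
def bit (m x : ℕ) : ℕ := Nat.land (Nat.shiftRight m x) 1

/-- The mask with only bit `x`. -/
def sgl (x : ℕ) : ℕ := Nat.shiftLeft 1 x

/-- Difference of masks. -/
def dif (a b : ℕ) : ℕ := Nat.xor a (Nat.land a b)

/-- Swap the two halves of each block of length `2 * d`. -/
def sw (c i d l m : ℕ) : ℕ :=
  ifz (bit c i) m (frc m fun m =>
    Nat.lor (Nat.land (Nat.shiftRight m d) l) (Nat.shiftLeft (Nat.land m l) d))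

/-- Translate the mask `m` by `c`. -/
def tr (m c : ℕ) : ℕ :=
  frc (sw c 0 1 113427455640312821154458202477256070485 m) fun m =>
  frc (sw c 1 2 68056473384187692692674921486353642291 m) fun m =>
  frc (sw c 2 4 20016609818878733144904388672456953615 m) fun m =>
  frc (sw c 3 8 1324055902416102970674609367438786815 m) fun m =>
  frc (sw c 4 16 5192217631581220737344928932233215 m) fun m =>
  frc (sw c 5 32 79228162495817593524129366015 m) fun m =>
  sw c 6 64 18446744073709551615 m

/-- Close under translation by one code. -/
def cl1 (m c : ℕ) : ℕ := ifz c m (frc m fun m => Nat.lor m (tr m c))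

/-- Close under translation by three codes. -/
def cl (m a b c : ℕ) : ℕ := frc (cl1 m a) fun m => frc (cl1 m b) fun m => cl1 m c

/-- The mask of all codes with odd inner product with `l`. -/
def km (l : ℕ) : ℕ :=
  Nat.xor (Nat.mul (bit l 0) 226854911280625642308916404954512140970)
  (Nat.xor (Nat.mul (bit l 1) 272225893536750770770699685945414569164)
  (Nat.xor (Nat.mul (bit l 2) 320265757102059730318470218759311257840)
  (Nat.xor (Nat.mul (bit l 3) 338958311018522360492699998064329424640)
  (Nat.xor (Nat.mul (bit l 4) 340277174703306882242637262502835978240)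
  (Nat.xor (Nat.mul (bit l 5) 340282366841710300967557013907638845440)
  (Nat.mul (bit l 6) 340282366920938463444927863358058659840))))))

/-- Number of bits of `m`, up to `c`. -/
def pop (c : ℕ) : ℕ → ℕ :=
  Nat.rec (motive := fun _ => ℕ → ℕ) (fun _ => 0)
    (fun _ ih m => ifz m 0 (Nat.succ (frc (Nat.xor m (sgl (Nat.log2 m))) ih))) c

/-- Sum of the truncated bit counts of the bytes of `m`. -/
def cnt (cap m k : ℕ) : ℕ :=
  Nat.rec (motive := fun _ => ℕ) (pop 8 (Nat.land m 255))
    (fun k s => Nat.add (pop cap (Nat.land (Nat.shiftRight m (Nat.mul 8 (Nat.succ k))) 255)) s) k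

/-- Mask of a list of codes. -/
def lmask (l : List ℕ) : ℕ :=
  List.rec (motive := fun _ => ℕ) 0 (fun c _ m => Nat.lor (sgl c) m) l

/-- Mask of a list of codes and of their pairwise sums. -/
def kmask (l : List ℕ) : ℕ :=
  List.rec (motive := fun _ => ℕ) 0
    (fun c cs m => Nat.lor (Nat.lor (sgl c) (tr (lmask cs) c)) m) l

/-- Parameters of a search. -/
structure Cfg where
  r : ℕ
  n : ℕ
  T : ℕ
  cap : ℕ
  f7 : Bool
  lm : Bool

/-- A stack of pairs of masks. -/
inductive Stk where
  | nil : Stk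
  | cons : ℕ → ℕ → Stk → Stk

/-- Mask of the fibres of the lift mode. -/
def fmask : ℕ := 237688129649497029914895794172

/-- All codes. -/
def full (r : ℕ) : ℕ := Nat.sub (Nat.pow 2 (Nat.pow 2 r)) 2

/-- Argument number `j` of an operation. -/
def arg (w j : ℕ) : ℕ := Nat.land (Nat.shiftRight w (Nat.add 4 (Nat.mul 7 j))) 127

/-- The first arguments of an operation as a list. -/
def args (w r : ℕ) : List ℕ :=
  Nat.rec (motive := fun _ => List ℕ) [] (fun k l => arg w k :: l) r

/-- Continue with the next state of the stack. -/
def nxt (f : ℕ → ℕ → Stk → Bool) (s : Stk) : Bool :=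
  Stk.rec (motive := fun _ => Bool) true (fun i o s _ => f i o s) s

/-- Apply a derived pattern `m` of missing codes. -/
def opAG (cfg : Cfg) (f : ℕ → ℕ → Stk → Bool) (a b c l i o : ℕ) (s : Stk) : Bool :=
  cond (Nat.ble cfg.r 6 && !Nat.beq c 0) false <|
  cond (Nat.ble cfg.r 5 && !Nat.beq b 0) false <|
  cond (Nat.ble cfg.r 4 && !Nat.beq a 0) false <|
  cond (Nat.beq l 0 || Nat.ble (Nat.pow 2 cfg.r) l) false <|
  frc (km l) fun k =>
  ifz (Nat.lor (bit k a) (Nat.lor (bit k b) (bit k c)))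
    (cond ((Nat.beq b 0 || Nat.beq (bit i b) 1) && (Nat.beq c 0 || Nat.beq (bit i c) 1))
      (frc (dif (Nat.land k (full cfg.r)) (cl i a b c)) fun m =>
        cond (Nat.beq a 0 || Nat.beq (bit i a) 1)
          (ifz m (nxt f s)
            (ifz (dif m (cl (sgl (Nat.log2 m)) a b c)) (f i (Nat.lor o m) s) false))
          (ifz m (f i (Nat.lor o (sgl a)) s) false))
      false)
    false

/-- A plane all of whose points, up to one, are present. -/
def opF7 (cfg : Cfg) (f : ℕ → ℕ → Stk → Bool) (a b c i o : ℕ) (s : Stk) : Bool :=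
  cond (cfg.f7 && !Nat.beq a 0 && !Nat.beq b 0 && !Nat.beq a b && Nat.beq (bit (cl 1 a b 0) c) 0)
    (frc (dif (Nat.xor (cl 1 a b c) 1) i) fun m =>
      ifz m (nxt f s)
        (ifz (Nat.xor m (sgl (Nat.log2 m))) (f i (Nat.lor o m) s) false))
    false

/-- Use the capacity of a block. -/
def opCap (cfg : Cfg) (f : ℕ → ℕ → Stk → Bool) (k i o : ℕ) (s : Stk) : Bool :=
  cond (Nat.beq k 0 || Nat.ble 16 k) false <|
  frc (pop (Nat.succ cfg.cap) (Nat.land (Nat.shiftRight i (Nat.mul 8 k)) 255)) fun p =>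
  cond (Nat.ble p cfg.cap)
    (cond (Nat.beq p cfg.cap)
      (f i (Nat.lor o (dif (Nat.shiftLeft 255 (Nat.mul 8 k)) i)) s) false)
    (nxt f s)

/-- At most one fibre is empty. -/
def opFib (cfg : Cfg) (f : ℕ → ℕ → Stk → Bool) (y z i o : ℕ) (s : Stk) : Bool :=
  cond cfg.lm
    (cond (Nat.beq (bit fmask y) 1 && Nat.beq (bit fmask z) 1 && Nat.beq (bit o y) 1 &&
        Nat.beq (bit o (Nat.xor y 1)) 1 && Nat.beq (bit o z) 1 &&
        !Nat.beq (Nat.div y 2) (Nat.div z 2))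
      (cond (Nat.beq (bit o (Nat.xor z 1)) 1) (nxt f s)
        (f (Nat.lor i (sgl (Nat.xor z 1))) o s)) false)
    false

/-- Choice of the lift of a tree edge. -/
def opTree (cfg : Cfg) (f : ℕ → ℕ → Stk → Bool) (x i o : ℕ) (s : Stk) : Bool :=
  cond cfg.lm
    (cond (Nat.beq (bit 18446744078004584724 x) 1 && Nat.beq (bit o x) 1)
      (cond (Nat.beq (bit i (Nat.xor x 1)) 1) (nxt f s)
        (f i (Nat.lor o (sgl (Nat.xor x 1))) s)) false)
    false

/-- Use the state number `j` of the list `t` of states settled before. -/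
def opLem (f : ℕ → ℕ → Stk → Bool) (t : Stk) (j i o : ℕ) (s : Stk) : Bool :=
  Stk.rec (motive := fun _ => ℕ → Bool) (fun _ => false)
    (fun i' o' _ ih j => ifz j
      (ifz (dif i' i) (ifz (dif o' o) (nxt f s) false) false) (ih (Nat.pred j))) t j

/-- Run the operations encoded in `w`. -/
def exec (cfg : Cfg) (t : Stk) (k : ℕ → ℕ → Stk → Bool) (fuel : ℕ) : ℕ → ℕ → ℕ → Stk → Bool :=
  Nat.rec (motive := fun _ => ℕ → ℕ → ℕ → Stk → Bool) (fun _ _ _ _ => false)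
    (fun _ ih w i o s =>
      frc w fun w => frc i fun i => frc o fun o =>
      frc (Nat.land w 15) fun op =>
      ifz op (k i o s) <|
      cond (Nat.beq op 1)
        (opAG cfg (ih (Nat.shiftRight w 32)) (arg w 0) (arg w 1) (arg w 2) (arg w 3) i o s) <|
      cond (Nat.beq op 2)
        (ih (Nat.shiftRight w 11) (Nat.lor i (sgl (arg w 0))) o
          (Stk.cons i (Nat.lor o (sgl (arg w 0))) s)) <|
      cond (Nat.beq op 3)
        (cond (Nat.ble cfg.n (cnt cfg.cap (dif (full cfg.r) o) 15)) false
          (nxt (ih (Nat.shiftRight w 4)) s)) <|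
      cond (Nat.beq op 4)
        (cond (Nat.beq (bit i (arg w 0)) 1 &&
            !Nat.ble (Nat.mul 2 cfg.T) (frc (dif (full cfg.r) o) fun m =>
              pop (Nat.mul 2 cfg.T) (Nat.land m (tr m (arg w 0)))))
          (nxt (ih (Nat.shiftRight w 11)) s) false) <|
      cond (Nat.beq op 5)
        (opF7 cfg (ih (Nat.shiftRight w 25)) (arg w 0) (arg w 1) (arg w 2) i o s) <|
      cond (Nat.beq op 6)
        (opCap cfg (ih (Nat.shiftRight w 11)) (arg w 0) i o s) <|
      cond (Nat.beq op 7)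
        (opFib cfg (ih (Nat.shiftRight w 18)) (arg w 0) (arg w 1) i o s) <|
      cond (Nat.beq op 8)
        (cond (cfg.f7 || cfg.lm) (ifz (dif (dif (full cfg.r) o) (kmask (args w cfg.r)))
          (nxt (ih (Nat.shiftRight w (Nat.add 4 (Nat.mul 7 cfg.r)))) s) false) false) <|
      cond (Nat.beq op 9)
        (cond cfg.lm (ifz (dif (dif (full cfg.r) o) (Nat.lor (kmask (args w 6))
            (cl (sgl (arg w 6)) (arg w 0) (arg w 1) 0)))
          (nxt (ih (Nat.shiftRight w 53)) s) false) false) <|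
      cond (Nat.beq op 11)
        (opLem (ih (Nat.shiftRight w 11)) t (arg w 0) i o s) <|
      opTree cfg (ih (Nat.shiftRight w 11)) (arg w 0) i o s) fuel

/-- Run a list of encoded blocks of operations. -/
def run (cfg : Cfg) (t : Stk) (l : List ℕ) : ℕ → ℕ → Stk → Bool :=
  List.rec (motive := fun _ => ℕ → ℕ → Stk → Bool) (fun _ _ _ => false)
    (fun w _ ih i o s => exec cfg t ih 300 w i o s) l

end

end Eng

namespace Eng

theorem bit_eq (m x : ℕ) : bit m x = if m.testBit x then 1 else 0 := by
  have h : bit m x = (m >>> x) &&& 1 := rfl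
  rw [h, Nat.testBit_eq_decide_div_mod_eq, Nat.and_one_is_mod, Nat.shiftRight_eq_div_pow]
  have := Nat.mod_two_eq_zero_or_one (m / 2 ^ x)
  rcases this with h | h <;> simp [h]

theorem bit_one {m x : ℕ} : bit m x = 1 ↔ m.testBit x = true := by
  rw [bit_eq]; split_ifs with h <;> simp [h]

theorem sgl_test (x y : ℕ) : (sgl x).testBit y = decide (x = y) := by
  have h : sgl x = 1 <<< x := rfl
  rw [h, Nat.shiftLeft_eq, one_mul, Nat.testBit_two_pow]

theorem dif_test (a b x : ℕ) : (dif a b).testBit x = (a.testBit x && !b.testBit x) := by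
  have h : dif a b = a ^^^ (a &&& b) := rfl
  rw [h, Nat.testBit_xor, Nat.testBit_and]
  cases a.testBit x <;> cases b.testBit x <;> rfl

theorem lor_test (a b x : ℕ) : (Nat.lor a b).testBit x = (a.testBit x || b.testBit x) :=
  Nat.testBit_or a b x

theorem land_test (a b x : ℕ) : (Nat.land a b).testBit x = (a.testBit x && b.testBit x) :=
  Nat.testBit_and a b x

theorem sw_aux (c i m l x : ℕ) (hi : i < 7) (hx : x < 128)
    (hl : ∀ y < 128, l.testBit y = !y.testBit i) :
    (sw c i (2 ^ i) l m).testBit x =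
      m.testBit (if c.testBit i then x ^^^ 2 ^ i else x) := by
  unfold sw
  rw [ifz_eq, bit_eq, frc_eq]
  cases hc : c.testBit i
  · simp
  · have e : (Nat.lor (Nat.land (Nat.shiftRight m (2 ^ i)) l)
      (Nat.shiftLeft (Nat.land m l) (2 ^ i))) =
      ((m >>> (2 ^ i)) &&& l) ||| ((m &&& l) <<< (2 ^ i)) := rfl
    simp only [e, Nat.testBit_or, Nat.testBit_and, Nat.testBit_shiftRight,
      Nat.testBit_shiftLeft, if_true, one_ne_zero, if_false]
    have key : ∀ i < 7, ∀ x < 128, (x.testBit i = false → x ^^^ 2 ^ i = 2 ^ i + x ∧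
        (2 ^ i ≤ x → (x - 2 ^ i).testBit i = true)) ∧
        (x.testBit i = true → x ^^^ 2 ^ i = x - 2 ^ i ∧ 2 ^ i ≤ x ∧
          (x - 2 ^ i).testBit i = false) := by decide +kernel
    obtain ⟨k0, k1⟩ := key i hi x hx
    rw [hl x hx, hl (x - 2 ^ i) (lt_of_le_of_lt (Nat.sub_le _ _) hx)]
    cases hb : x.testBit i
    · obtain ⟨h1, h2⟩ := k0 hb
      rw [h1]
      by_cases h3 : 2 ^ i ≤ x
      · simp [h2 h3]
      · simp [h3]
    · obtain ⟨h1, h2, h3⟩ := k1 hb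
      rw [h1, h3]; simp [h2]

theorem tr_test (m c x : ℕ) (hc : c < 128) (hx : x < 128) :
    (tr m c).testBit x = m.testBit (x ^^^ c) := by
  have e : ∀ c < 128, ∀ x < 128,
      (let x := if c.testBit 6 then x ^^^ 2 ^ 6 else x
       let x := if c.testBit 5 then x ^^^ 2 ^ 5 else x
       let x := if c.testBit 4 then x ^^^ 2 ^ 4 else x
       let x := if c.testBit 3 then x ^^^ 2 ^ 3 else x
       let x := if c.testBit 2 then x ^^^ 2 ^ 2 else x
       let x := if c.testBit 1 then x ^^^ 2 ^ 1 else x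
       if c.testBit 0 then x ^^^ 2 ^ 0 else x) = x ^^^ c := by decide +kernel
  have b : ∀ i < 7, ∀ x < 128, (if c.testBit i then x ^^^ 2 ^ i else x) < 128 := by
    intro i hi x hx
    split_ifs
    · exact Nat.xor_lt_two_pow (n := 7) hx (Nat.pow_lt_pow_right (by norm_num) hi)
    · exact hx
  rw [← e c hc x hx]
  unfold tr
  simp only [frc_eq]
  rw [show (64 : ℕ) = 2 ^ 6 from rfl, sw_aux _ 6 _ _ _ (by norm_num) hx (by decide +kernel)]
  rw [show (32 : ℕ) = 2 ^ 5 from rfl, sw_aux _ 5 _ _ _ (by norm_num) (b 6 (by norm_num) _ hx)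
    (by decide +kernel)]
  have b6 := b 5 (by norm_num) _ (b 6 (by norm_num) _ hx)
  rw [show (16 : ℕ) = 2 ^ 4 from rfl, sw_aux _ 4 _ _ _ (by norm_num) b6 (by decide +kernel)]
  have b5 := b 4 (by norm_num) _ b6
  rw [show (8 : ℕ) = 2 ^ 3 from rfl, sw_aux _ 3 _ _ _ (by norm_num) b5 (by decide +kernel)]
  have b4 := b 3 (by norm_num) _ b5
  have s2 := fun m => sw_aux c 2 m 20016609818878733144904388672456953615 _ (by norm_num) b4
    (by decide +kernel)
  have b3 := b 2 (by norm_num) _ b4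
  have s1 := fun m => sw_aux c 1 m 68056473384187692692674921486353642291 _ (by norm_num) b3
    (by decide +kernel)
  have b2 := b 1 (by norm_num) _ b3
  have s0 := sw_aux c 0 m 113427455640312821154458202477256070485 _ (by norm_num) b2
    (by decide +kernel)
  exact (s2 _).trans ((s1 _).trans s0)

theorem xor_lt {x y : ℕ} (hx : x < 128) (hy : y < 128) : x ^^^ y < 128 :=
  Nat.xor_lt_two_pow (n := 7) hx hy

theorem cl1_test (m c x : ℕ) (hc : c < 128) (hx : x < 128) :
    (cl1 m c).testBit x = true ↔ ∃ w, (w = 0 ∨ w = c) ∧ m.testBit (x ^^^ w) = true := by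
  unfold cl1
  rw [ifz_eq, frc_eq]
  split_ifs with h
  · subst h; simp
  · rw [lor_test, tr_test _ _ _ hc hx]; simp [or_and_right, exists_or]

/-- Span of three codes. -/
def Spn (a b c w : ℕ) : Prop :=
  ∃ u, (u = 0 ∨ u = a) ∧ ∃ v, (v = 0 ∨ v = b) ∧ ∃ t, (t = 0 ∨ t = c) ∧ w = u ^^^ v ^^^ t

theorem cl_test (m a b c x : ℕ) (ha : a < 128) (hb : b < 128) (hc : c < 128) (hx : x < 128) :
    (cl m a b c).testBit x = true ↔ ∃ w, Spn a b c w ∧ m.testBit (x ^^^ w) = true := by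
  unfold cl
  simp only [frc_eq]
  rw [cl1_test _ _ _ hc hx]
  constructor
  · rintro ⟨t, ht, h⟩
    have ht' : t < 128 := by rcases ht with rfl | rfl <;> omega
    rw [cl1_test _ _ _ hb (xor_lt hx ht')] at h
    obtain ⟨v, hv, h⟩ := h
    have hv' : v < 128 := by rcases hv with rfl | rfl <;> omega
    rw [cl1_test _ _ _ ha (xor_lt (xor_lt hx ht') hv')] at h
    obtain ⟨u, hu, h⟩ := h
    refine ⟨u ^^^ v ^^^ t, ⟨u, hu, v, hv, t, ht, rfl⟩, ?_⟩
    rw [← h]; congr 1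
    ac_rfl
  · rintro ⟨w, ⟨u, hu, v, hv, t, ht, rfl⟩, h⟩
    have ht' : t < 128 := by rcases ht with rfl | rfl <;> omega
    have hv' : v < 128 := by rcases hv with rfl | rfl <;> omega
    refine ⟨t, ht, ?_⟩
    rw [cl1_test _ _ _ hb (xor_lt hx ht')]
    refine ⟨v, hv, ?_⟩
    rw [cl1_test _ _ _ ha (xor_lt (xor_lt hx ht') hv')]
    refine ⟨u, hu, ?_⟩
    rw [← h]; congr 1
    ac_rfl

theorem spn_xor {a b c v w : ℕ} (hv : Spn a b c v) (hw : Spn a b c w) :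
    Spn a b c (v ^^^ w) := by
  obtain ⟨u1, h1, v1, h2, t1, h3, rfl⟩ := hv
  obtain ⟨u2, k1, v2, k2, t2, k3, rfl⟩ := hw
  have g : ∀ a u v : ℕ, (u = 0 ∨ u = a) → (v = 0 ∨ v = a) → (u ^^^ v = 0 ∨ u ^^^ v = a) := by
    rintro a u v (rfl | rfl) (rfl | rfl) <;> simp
  refine ⟨u1 ^^^ u2, g _ _ _ h1 k1, v1 ^^^ v2, g _ _ _ h2 k2, t1 ^^^ t2, g _ _ _ h3 k3, ?_⟩
  ac_rfl

theorem spn_lt {a b c w : ℕ} (ha : a < 128) (hb : b < 128) (hc : c < 128) (h : Spn a b c w) :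
    w < 128 := by
  obtain ⟨u1, h1, v1, h2, t1, h3, rfl⟩ := h
  refine xor_lt (xor_lt ?_ ?_) ?_
  · rcases h1 with rfl | rfl <;> omega
  · rcases h2 with rfl | rfl <;> omega
  · rcases h3 with rfl | rfl <;> omega

/-- The functional with index `l`. -/
def kb (l x : ℕ) : Bool := (km l).testBit x

theorem kb_eq (l x : ℕ) (hx : x < 128) : kb l x =
    ((l.testBit 0 && x.testBit 0) ^^ ((l.testBit 1 && x.testBit 1) ^^
    ((l.testBit 2 && x.testBit 2) ^^ ((l.testBit 3 && x.testBit 3) ^^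
    ((l.testBit 4 && x.testBit 4) ^^ ((l.testBit 5 && x.testBit 5) ^^
    (l.testBit 6 && x.testBit 6))))))) := by
  have h : ∀ i h : ℕ, h.testBit x = x.testBit i →
      (Nat.mul (bit l i) h).testBit x = (l.testBit i && x.testBit i) := by
    intro i h hh
    rw [bit_eq]
    split_ifs with h1
    · have : Nat.mul 1 h = h := Nat.one_mul h
      rw [this, hh, h1]; rfl
    · have : Nat.mul 0 h = 0 := Nat.zero_mul h
      rw [this]; simp [h1]
  have hX : ∀ a b : ℕ, (Nat.xor a b).testBit x = (a.testBit x ^^ b.testBit x) :=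
    fun a b => Nat.testBit_xor a b x
  have q0 : ∀ x < 128, (226854911280625642308916404954512140970 : ℕ).testBit x = x.testBit 0 := by
    decide +kernel
  have q1 : ∀ x < 128, (272225893536750770770699685945414569164 : ℕ).testBit x = x.testBit 1 := by
    decide +kernel
  have q2 : ∀ x < 128, (320265757102059730318470218759311257840 : ℕ).testBit x = x.testBit 2 := by
    decide +kernel
  have q3 : ∀ x < 128, (338958311018522360492699998064329424640 : ℕ).testBit x = x.testBit 3 := by
    decide +kernel
  have q4 : ∀ x < 128, (340277174703306882242637262502835978240 : ℕ).testBit x = x.testBit 4 := by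
    decide +kernel
  have q5 : ∀ x < 128, (340282366841710300967557013907638845440 : ℕ).testBit x = x.testBit 5 := by
    decide +kernel
  have q6 : ∀ x < 128, (340282366920938463444927863358058659840 : ℕ).testBit x = x.testBit 6 := by
    decide +kernel
  unfold kb km
  rw [hX, hX, hX, hX, hX, hX, h 0 _ (q0 x hx), h 1 _ (q1 x hx), h 2 _ (q2 x hx), h 3 _ (q3 x hx),
    h 4 _ (q4 x hx), h 5 _ (q5 x hx), h 6 _ (q6 x hx)]

theorem kb_xor (l x y : ℕ) (hx : x < 128) (hy : y < 128) :
    kb l (x ^^^ y) = (kb l x ^^ kb l y) := by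
  have h : ∀ a b c : Bool, (a && (b ^^ c)) = ((a && b) ^^ (a && c)) := by decide
  rw [kb_eq _ _ (xor_lt hx hy), kb_eq _ _ hx, kb_eq _ _ hy]
  simp only [Nat.testBit_xor, h]
  have key : ∀ a b c d : Bool, ((a ^^ b) ^^ (c ^^ d)) = ((a ^^ c) ^^ (b ^^ d)) := by decide
  simp only [key]

theorem pop_ge (c : ℕ) : ∀ (m : ℕ) (s : Finset ℕ), (∀ x ∈ s, m.testBit x = true) →
    min c s.card ≤ pop c m := by
  induction c with
  | zero => intro m s _; simp
  | succ c ih =>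
    intro m s hs
    have e : pop (c + 1) m = ifz m 0 (Nat.succ (frc (Nat.xor m (sgl (Nat.log2 m))) (pop c))) := rfl
    rw [e, ifz_eq, frc_eq]
    split_ifs with h
    · subst h
      have : s = ∅ := by
        ext x; simp only [Finset.notMem_empty, iff_false]; intro hx; simpa using hs x hx
      simp [this]
    · have := ih (Nat.xor m (sgl (Nat.log2 m))) (s.erase (Nat.log2 m)) (by
        intro x hx
        rw [Finset.mem_erase] at hx
        have e2 : Nat.xor m (sgl (Nat.log2 m)) = m ^^^ (sgl (Nat.log2 m)) := rfl
        rw [e2, Nat.testBit_xor, hs x hx.2, sgl_test]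
        simp [Ne.symm hx.1])
      have h2 : s.card - 1 ≤ (s.erase (Nat.log2 m)).card := Finset.pred_card_le_card_erase
      omega

theorem pop_le (c : ℕ) : ∀ (m : ℕ), ∃ s : Finset ℕ, s.card = pop c m ∧
    ∀ x ∈ s, m.testBit x = true := by
  induction c with
  | zero => intro m; exact ⟨∅, rfl, by simp⟩
  | succ c ih =>
    intro m
    have e : pop (c + 1) m = ifz m 0 (Nat.succ (frc (Nat.xor m (sgl (Nat.log2 m))) (pop c))) := rfl
    rw [e, ifz_eq, frc_eq]
    split_ifs with h
    · exact ⟨∅, rfl, by simp⟩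
    · obtain ⟨s, h1, h2⟩ := ih (Nat.xor m (sgl (Nat.log2 m)))
      have e2 : Nat.xor m (sgl (Nat.log2 m)) = m ^^^ (sgl (Nat.log2 m)) := rfl
      rw [e2] at h2 h1
      have ht : m.testBit (Nat.log2 m) = true := Nat.testBit_log2 h
      have hn : Nat.log2 m ∉ s := by
        intro hx
        have := h2 _ hx
        rw [Nat.testBit_xor, ht, sgl_test] at this
        simp at this
      refine ⟨insert (Nat.log2 m) s, ?_, ?_⟩
      · rw [Finset.card_insert_of_notMem hn, h1]; rfl
      · intro x hx
        rw [Finset.mem_insert] at hx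
        rcases hx with rfl | hx
        · exact ht
        · have := h2 _ hx
          rw [Nat.testBit_xor, sgl_test] at this
          by_cases hh : Nat.log2 m = x
          · subst hh; exact ht
          · simpa [hh] using this

end Eng

namespace Eng

/-- The facts about a set `S` of codes used by the checker. -/
structure Hyp (cfg : Cfg) (S : Finset ℕ) : Prop where
  r7 : cfg.r ≤ 7
  lt : ∀ x ∈ S, x < 2 ^ cfg.r
  pos : 0 ∉ S
  ag : ∀ a b c l, (a = 0 ∨ a ∈ S) → (b = 0 ∨ b ∈ S) → (c = 0 ∨ c ∈ S) →
    (cfg.r ≤ 6 → c = 0) → (cfg.r ≤ 5 → b = 0) → (cfg.r ≤ 4 → a = 0) → l ≠ 0 → l < 2 ^ cfg.r →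
    kb l a = false → kb l b = false → kb l c = false →
    ¬ ∀ x < 2 ^ cfg.r, kb l x = true → ∃ w, Spn a b c w ∧ x ^^^ w ∈ S
  count : cfg.n ≤ S.card
  tri : ∀ e ∈ S, 2 * cfg.T ≤ (S.filter fun x => x ^^^ e ∈ S).card
  f7 : cfg.f7 = true → ∀ a b c, a ≠ 0 → b ≠ 0 → a ≠ b → ¬ Spn a b 0 c →
    ¬ ∀ w, Spn a b c w → w ≠ 0 → w ∈ S
  cap : ∀ k, k ≠ 0 → (S.filter fun x => x / 8 = k).card ≤ cfg.cap
  fib : cfg.lm = true → ∀ y z, fmask.testBit y = true → fmask.testBit z = true → y / 2 ≠ z / 2 →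
    y ∉ S → y ^^^ 1 ∉ S → z ∉ S → z ^^^ 1 ∈ S
  tree : cfg.lm = true → ∀ x, (18446744078004584724 : ℕ).testBit x = true → x ∉ S → x ^^^ 1 ∉ S

/-- `S` is contained in the set of the first `r` codes of `f` and their pairwise sums. -/
def KGoal (r : ℕ) (S : Finset ℕ) : Prop :=
  ∃ f : ℕ → ℕ, ∀ x ∈ S, (∃ i < r, x = f i) ∨ ∃ i < r, ∃ j < r, x = f i ^^^ f j

/-- The second possible structure. -/
def GGoal (S : Finset ℕ) : Prop :=
  ∃ f : ℕ → ℕ, ∀ x ∈ S, ((∃ i < 6, x = f i) ∨ ∃ i < 6, ∃ j < 6, x = f i ^^^ f j) ∨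
    ∃ w, Spn (f 0) (f 1) 0 w ∧ x = f 6 ^^^ w

/-- The masks `i` and `o` describe `S` correctly. -/
def Val (S : Finset ℕ) (i o : ℕ) : Prop :=
  (∀ x < 128, i.testBit x = true → x ∈ S) ∧ ∀ x < 128, o.testBit x = true → x ∉ S

/-- All states on the stack are fine. -/
def SGood (S : Finset ℕ) (G : Prop) : Stk → Prop
  | .nil => True
  | .cons i o s => (Val S i o → G) ∧ SGood S G s

/-- The function `f` checks correctly. -/
def Good (S : Finset ℕ) (G : Prop) (f : ℕ → ℕ → Stk → Bool) : Prop :=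
  ∀ i o s, f i o s = true → (Val S i o → G) ∧ SGood S G s

theorem nxt_good {S : Finset ℕ} {G : Prop} {f : ℕ → ℕ → Stk → Bool} (hf : Good S G f) {s : Stk}
    (h : nxt f s = true) : SGood S G s := by
  cases s with
  | nil => trivial
  | cons i o s => exact hf i o s h

theorem arg_lt (w j : ℕ) : arg w j < 128 := by
  have e : arg w j = (w >>> (4 + 7 * j)) &&& 127 := rfl
  rw [e]
  exact lt_of_le_of_lt Nat.and_le_right (by norm_num)

theorem full_test (r x : ℕ) (hr : r ≤ 7) (hx : x < 2 ^ r) (h0 : x ≠ 0) :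
    (full r).testBit x = true := by
  have : ∀ r ≤ 7, ∀ x < 128, x < 2 ^ r → x ≠ 0 → (full r).testBit x = true := by decide +kernel
  exact this r hr x (lt_of_lt_of_le hx (Nat.pow_le_pow_right (by norm_num) hr)) hx h0

variable {cfg : Cfg} {S : Finset ℕ} {G : Prop} {f : ℕ → ℕ → Stk → Bool}

theorem Hyp.lt' (H : Hyp cfg S) {x : ℕ} (hx : x ∈ S) : x < 128 :=
  lt_of_lt_of_le (H.lt x hx) (Nat.pow_le_pow_right (by norm_num) H.r7)

theorem kb_zero (l : ℕ) : kb l 0 = false := by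
  rw [kb_eq _ _ (by norm_num)]; simp

theorem kb_spn {l a b c w : ℕ} (ha : a < 128) (hb : b < 128) (hc : c < 128)
    (h1 : kb l a = false) (h2 : kb l b = false) (h3 : kb l c = false) (h : Spn a b c w) :
    kb l w = false := by
  obtain ⟨u, hu, v, hv, t, ht, rfl⟩ := h
  have lu : u < 128 := by rcases hu with rfl | rfl <;> omega
  have lv : v < 128 := by rcases hv with rfl | rfl <;> omega
  have lt : t < 128 := by rcases ht with rfl | rfl <;> omega
  have ku : kb l u = false := by rcases hu with rfl | rfl <;> simp [kb_zero, *]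
  have kv : kb l v = false := by rcases hv with rfl | rfl <;> simp [kb_zero, *]
  have kt : kb l t = false := by rcases ht with rfl | rfl <;> simp [kb_zero, *]
  rw [kb_xor _ _ _ (xor_lt lu lv) lt, kb_xor _ _ _ lu lv, ku, kv, kt]; rfl

theorem Spn.zero (a b c : ℕ) : Spn a b c 0 :=
  ⟨0, .inl rfl, 0, .inl rfl, 0, .inl rfl, rfl⟩

theorem opAG_good (H : Hyp cfg S) (hf : Good S G f) {a b c l i o : ℕ} {s : Stk}
    (ha : a < 128) (hb : b < 128) (hc : c < 128)
    (h : opAG cfg f a b c l i o s = true) : (Val S i o → G) ∧ SGood S G s := by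
  unfold opAG at h
  simp only [frc_eq, ifz_eq] at h
  simp only [Bool.cond_eq_ite] at h
  split_ifs at h with h1 h2 h3 h4 h5 h6 h7 h8 h9 h10
  all_goals
    simp only [Bool.and_eq_true, Bool.or_eq_true, Bool.not_eq_true', Nat.beq_eq, Nat.ble_eq,
      bit_one, not_and, not_or] at h1 h2 h3 h4 h6 h7
    have e5 : kb l a = false ∧ kb l b = false ∧ kb l c = false := by
      have e : ((bit (km l) a) ||| ((bit (km l) b) ||| (bit (km l) c)) : ℕ) = 0 := h5
      rw [Nat.or_eq_zero_iff, Nat.or_eq_zero_iff] at e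
      have q : ∀ x, bit (km l) x = 0 → kb l x = false := by
        intro x hx
        rw [bit_eq] at hx
        unfold kb
        by_contra hne
        simp [hne] at hx
      exact ⟨q _ e.1, q _ e.2.1, q _ e.2.2⟩
    obtain ⟨ka, kbb, kc⟩ := e5
    have c1 : cfg.r ≤ 6 → c = 0 := fun hr => by
      by_contra hne
      have := h1 hr
      simp [hne] at this
    have c2 : cfg.r ≤ 5 → b = 0 := fun hr => by
      by_contra hne
      have := h2 hr
      simp [hne] at this
    have c3 : cfg.r ≤ 4 → a = 0 := fun hr => by
      by_contra hne
      have := h3 hr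
      simp [hne] at this
    have l0 : l ≠ 0 := h4.1
    have lr : l < 2 ^ cfg.r := not_le.mp h4.2
    have main := fun hva hvb hvc => H.ag a b c l hva hvb hvc c1 c2 c3 l0 lr ka kbb kc
    set m := dif (Nat.land (km l) (full cfg.r)) (cl i a b c) with hm
    have r128 : 2 ^ cfg.r ≤ 128 := Nat.pow_le_pow_right (n := 2) (by norm_num) H.r7
    have mt : ∀ x < 2 ^ cfg.r, kb l x = true → m.testBit x = false →
        ∃ w, Spn a b c w ∧ i.testBit (x ^^^ w) = true := by
      intro x hx hk hmx
      have x0 : x ≠ 0 := by rintro rfl; simp [kb_zero] at hk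
      rw [← cl_test _ _ _ _ _ ha hb hc (by omega)]
      rw [hm, dif_test, land_test, full_test _ _ H.r7 hx x0] at hmx
      change ((kb l x && true) && _) = false at hmx
      rw [hk] at hmx
      simpa using hmx
    have mt2 : ∀ x < 2 ^ cfg.r, kb l x = true → m.testBit x = false → Val S i o →
        ∃ w, Spn a b c w ∧ x ^^^ w ∈ S := by
      intro x hx hk hmx hv
      obtain ⟨w, hw, h⟩ := mt x hx hk hmx
      exact ⟨w, hw, hv.1 _ (xor_lt (by omega) (spn_lt ha hb hc hw)) h⟩
    have hvb : Val S i o → b = 0 ∨ b ∈ S := fun hv => h6.1.imp id (hv.1 b hb)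
    have hvc : Val S i o → c = 0 ∨ c ∈ S := fun hv => h6.2.imp id (hv.1 c hc)
  · refine ⟨fun hv => absurd ?_ (main (h7.imp id (hv.1 a ha)) (hvb hv) (hvc hv)), nxt_good hf h⟩
    intro x hx hk
    exact mt2 x hx hk (by rw [h8]; simp) hv
  · obtain ⟨g1, g2⟩ := hf _ _ _ h
    refine ⟨fun hv => ?_, g2⟩
    by_contra hG
    have hcov := main (h7.imp id (hv.1 a ha)) (hvb hv) (hvc hv)
    refine hG (g1 ⟨hv.1, ?_⟩)
    intro x hx
    rw [lor_test, Bool.or_eq_true]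
    rintro (ho | hmx)
    · exact hv.2 x hx ho
    intro hxS
    apply hcov
    intro y hy hk
    cases hmy : m.testBit y
    · exact mt2 y hy hk hmy hv
    · have ht : ∀ y < 128, m.testBit y = true → ∃ w, Spn a b c w ∧ y ^^^ w = Nat.log2 m := by
        intro y hy hmy
        have : (dif m (cl (sgl (Nat.log2 m)) a b c)).testBit y = false := by rw [h9]; simp
        rw [dif_test, hmy] at this
        have h' : (cl (sgl (Nat.log2 m)) a b c).testBit y = true := by simpa using this
        rw [cl_test _ _ _ _ _ ha hb hc hy] at h'
        obtain ⟨w, hw, h'⟩ := h'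
        rw [sgl_test] at h'
        exact ⟨w, hw, (of_decide_eq_true h').symm⟩
      obtain ⟨w, hw, e1⟩ := ht y (by omega) hmy
      obtain ⟨v, hv', e2⟩ := ht x hx hmx
      refine ⟨w ^^^ v, spn_xor hw hv', ?_⟩
      rw [← Nat.xor_assoc, e1, ← e2, Nat.xor_assoc, Nat.xor_self, Nat.xor_zero]
      exact hxS
  · obtain ⟨g1, g2⟩ := hf _ _ _ h
    refine ⟨fun hv => g1 ⟨hv.1, ?_⟩, g2⟩
    intro x hx
    rw [lor_test, Bool.or_eq_true]
    rintro (ho | hmx)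
    · exact hv.2 x hx ho
    rw [sgl_test] at hmx
    have : a = x := of_decide_eq_true hmx
    subst this
    intro haS
    refine main (.inr haS) (hvb hv) (hvc hv) ?_
    intro x hx hk
    exact mt2 x hx hk (by simp [*]) hv

end Eng

namespace Eng

variable {cfg : Cfg} {S : Finset ℕ} {G : Prop} {f : ℕ → ℕ → Stk → Bool}

theorem beq_false {a b : ℕ} : Nat.beq a b = false ↔ a ≠ b := by
  rw [Ne, ← Nat.beq_eq, Bool.not_eq_true]

theorem val_out {i o m : ℕ} (hv : Val S i o) (h : ∀ x < 128, m.testBit x = true → x ∉ S) :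
    Val S i (Nat.lor o m) := by
  refine ⟨hv.1, fun x hx => ?_⟩
  rw [lor_test, Bool.or_eq_true]
  rintro (h1 | h1)
  · exact hv.2 x hx h1
  · exact h x hx h1

theorem val_in {i o m : ℕ} (hv : Val S i o) (h : ∀ x < 128, m.testBit x = true → x ∈ S) :
    Val S (Nat.lor i m) o := by
  refine ⟨fun x hx => ?_, hv.2⟩
  rw [lor_test, Bool.or_eq_true]
  rintro (h1 | h1)
  · exact hv.1 x hx h1
  · exact h x hx h1

theorem sgl_iff {x y : ℕ} : (sgl x).testBit y = true ↔ x = y := by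
  rw [sgl_test]; simp

theorem spn_flip {a b c w : ℕ} (h : ∃ v, Spn a b c v ∧ (1 : ℕ).testBit (w ^^^ v) = true) :
    Spn a b c w := by
  obtain ⟨v, hv, h⟩ := h
  have : w ^^^ v = 0 := by
    rw [show (1 : ℕ) = 2 ^ 0 from rfl, Nat.testBit_two_pow] at h
    exact (of_decide_eq_true h).symm
  rw [Nat.xor_eq_zero_iff] at this
  rwa [this]

theorem opF7_good (H : Hyp cfg S) (hf : Good S G f) {a b c i o : ℕ} {s : Stk}
    (ha : a < 128) (hb : b < 128) (hc : c < 128)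
    (h : opF7 cfg f a b c i o s = true) : (Val S i o → G) ∧ SGood S G s := by
  unfold opF7 at h
  simp only [frc_eq, ifz_eq] at h
  simp only [Bool.cond_eq_ite] at h
  split_ifs at h with h1 h2 h3
  all_goals
    simp only [Bool.and_eq_true, Bool.not_eq_true', beq_false, Nat.beq_eq] at h1
    obtain ⟨⟨⟨⟨p1, p2⟩, p3⟩, p4⟩, p5⟩ := h1
    have hsp : ¬ Spn a b 0 c := by
      intro hs
      have : (cl 1 a b 0).testBit c = true := by
        rw [cl_test _ _ _ _ _ ha hb (by norm_num) hc]
        exact ⟨c, hs, by simp⟩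
      rw [bit_eq, this] at p5
      simp at p5
    have main := H.f7 p1 a b c p2 p3 p4 hsp
    set m := dif (Nat.xor (cl 1 a b c) 1) i with hm
    have mt : ∀ w, Spn a b c w → w ≠ 0 → m.testBit w = false → Val S i o → w ∈ S := by
      intro w hw w0 hmw hv
      have wl := spn_lt ha hb hc hw
      have e : (Nat.xor (cl 1 a b c) 1).testBit w = true := by
        have e2 : Nat.xor (cl 1 a b c) 1 = (cl 1 a b c) ^^^ 1 := rfl
        rw [e2, Nat.testBit_xor]
        have : (cl 1 a b c).testBit w = true := by
          rw [cl_test _ _ _ _ _ ha hb hc wl]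
          exact ⟨w, hw, by simp⟩
        rw [this, show (1 : ℕ) = 2 ^ 0 from rfl, Nat.testBit_two_pow]
        simp [Ne.symm w0]
      rw [hm, dif_test, e] at hmw
      exact hv.1 w wl (by simpa using hmw)
  · exact ⟨fun hv => absurd (fun w hw w0 => mt w hw w0 (by rw [h2]; simp) hv) main,
      nxt_good hf h⟩
  · obtain ⟨g1, g2⟩ := hf _ _ _ h
    refine ⟨fun hv => g1 (val_out hv ?_), g2⟩
    intro x hx hmx hxS
    have uniq : ∀ y, m.testBit y = true → y = Nat.log2 m := by
      intro y hy
      have e : m = sgl (Nat.log2 m) := by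
        have e2 : m ^^^ sgl (Nat.log2 m) = 0 := h3
        exact Nat.xor_eq_zero_iff.mp e2
      rw [e, sgl_iff] at hy
      exact hy.symm
    apply main
    intro w hw w0
    cases hmw : m.testBit w
    · exact mt w hw w0 hmw hv
    · rw [uniq w hmw, ← uniq x hmx]; exact hxS

theorem byte_test (m k x : ℕ) : (Nat.land (Nat.shiftRight m (Nat.mul 8 k)) 255).testBit x =
    (m.testBit (8 * k + x) && decide (x < 8)) := by
  have e : Nat.land (Nat.shiftRight m (Nat.mul 8 k)) 255 = (m >>> (8 * k)) &&& (2 ^ 8 - 1) := rfl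
  rw [e, Nat.testBit_and, Nat.testBit_shiftRight, Nat.testBit_two_pow_sub_one]

theorem opCap_good (H : Hyp cfg S) (hf : Good S G f) {k i o : ℕ} {s : Stk}
    (h : opCap cfg f k i o s = true) : (Val S i o → G) ∧ SGood S G s := by
  unfold opCap at h
  simp only [frc_eq] at h
  simp only [Bool.cond_eq_ite] at h
  obtain ⟨t, ht, htm⟩ := pop_le (Nat.succ cfg.cap)
    (Nat.land (Nat.shiftRight i (Nat.mul 8 k)) 255)
  split_ifs at h with h1 h2 h3
  all_goals
    rw [Bool.or_eq_true, Nat.beq_eq, Nat.ble_eq, not_or] at h1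
    obtain ⟨hk, hk16⟩ := h1
    rw [not_le] at hk16
    have hcap := H.cap k hk
    have himg : ∀ x ∈ t, i.testBit (8 * k + x) = true ∧ x < 8 := by
      intro x hx
      have := htm x hx
      rw [byte_test] at this
      simpa using this
  · obtain ⟨g1, g2⟩ := hf _ _ _ h
    refine ⟨fun hv => g1 (val_out hv ?_), g2⟩
    intro x hx hxm hxS
    have e : dif (Nat.shiftLeft 255 (Nat.mul 8 k)) i = dif ((2 ^ 8 - 1) <<< (8 * k)) i := rfl
    rw [e, dif_test, Nat.testBit_shiftLeft, Nat.testBit_two_pow_sub_one] at hxm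
    simp only [ge_iff_le, Bool.and_eq_true, decide_eq_true_eq, Bool.not_eq_true'] at hxm
    have h3' : pop (Nat.succ cfg.cap) (Nat.land (Nat.shiftRight i (Nat.mul 8 k)) 255) = cfg.cap :=
      Nat.eq_of_beq_eq_true h3
    have hsub : insert x (t.image fun y => 8 * k + y) ⊆ S.filter fun x => x / 8 = k := by
      intro y hy
      rw [Finset.mem_insert, Finset.mem_image] at hy
      rw [Finset.mem_filter]
      rcases hy with rfl | ⟨z, hz, rfl⟩
      · exact ⟨hxS, by omega⟩
      · obtain ⟨q1, q2⟩ := himg z hz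
        have : 8 * k + z < 128 := by omega
        exact ⟨hv.1 _ this q1, by omega⟩
    have hcard := Finset.card_le_card hsub
    rw [Finset.card_insert_of_notMem, Finset.card_image_of_injective, ht, h3'] at hcard
    · omega
    · intro a b hab; simpa using hab
    · intro hmem
      rw [Finset.mem_image] at hmem
      obtain ⟨z, hz, rfl⟩ := hmem
      have := (himg z hz).1
      rw [this] at hxm
      simp at hxm
  · refine ⟨fun hv => ?_, nxt_good hf h⟩
    exfalso
    have hsub : (t.image fun y => 8 * k + y) ⊆ S.filter fun x => x / 8 = k := by
      intro y hy
      rw [Finset.mem_image] at hy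
      rw [Finset.mem_filter]
      obtain ⟨z, hz, rfl⟩ := hy
      obtain ⟨q1, q2⟩ := himg z hz
      exact ⟨hv.1 _ (by omega) q1, by omega⟩
    have hcard := Finset.card_le_card hsub
    rw [Finset.card_image_of_injective, ht] at hcard
    · have h2' : ¬ pop (Nat.succ cfg.cap) (Nat.land (Nat.shiftRight i (Nat.mul 8 k)) 255) ≤
          cfg.cap := fun hle => h2 (Nat.ble_eq.mpr hle)
      omega
    · intro a b hab; simpa using hab

theorem opFib_good (H : Hyp cfg S) (hf : Good S G f) {y z i o : ℕ} {s : Stk}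
    (hy : y < 128) (hz : z < 128)
    (h : opFib cfg f y z i o s = true) : (Val S i o → G) ∧ SGood S G s := by
  unfold opFib at h
  simp only [Bool.cond_eq_ite] at h
  split_ifs at h with h1 h2 h3
  all_goals
    simp only [Bool.and_eq_true, Bool.not_eq_true', beq_false, Nat.beq_eq, bit_one] at h2
    obtain ⟨⟨⟨⟨⟨p1, p2⟩, p3⟩, p4⟩, p5⟩, p6⟩ := h2
    have main : Val S i o → z ^^^ 1 ∈ S := fun hv =>
      H.fib h1 y z p1 p2 p6 (hv.2 y hy p3) (hv.2 _ (xor_lt hy (by norm_num)) p4) (hv.2 z hz p5)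
  · rw [Nat.beq_eq, bit_one] at h3
    exact ⟨fun hv => absurd (main hv) (hv.2 _ (xor_lt hz (by norm_num)) h3), nxt_good hf h⟩
  · obtain ⟨g1, g2⟩ := hf _ _ _ h
    refine ⟨fun hv => g1 (val_in hv ?_), g2⟩
    intro x hx hxm
    rw [sgl_iff] at hxm
    rw [← hxm]; exact main hv

theorem opTree_good (H : Hyp cfg S) (hf : Good S G f) {x i o : ℕ} {s : Stk}
    (hx : x < 128)
    (h : opTree cfg f x i o s = true) : (Val S i o → G) ∧ SGood S G s := by
  unfold opTree at h
  simp only [Bool.cond_eq_ite] at h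
  split_ifs at h with h1 h2 h3
  all_goals
    simp only [Bool.and_eq_true, Nat.beq_eq, bit_one] at h2
    have main : Val S i o → x ^^^ 1 ∉ S := fun hv => H.tree h1 x h2.1 (hv.2 x hx h2.2)
  · rw [Nat.beq_eq, bit_one] at h3
    exact ⟨fun hv => absurd (hv.1 _ (xor_lt hx (by norm_num)) h3) (main hv), nxt_good hf h⟩
  · obtain ⟨g1, g2⟩ := hf _ _ _ h
    refine ⟨fun hv => g1 (val_out hv ?_), g2⟩
    intro y hy hym
    rw [sgl_iff] at hym
    rw [← hym]; exact main hv

/-- The part of the count contributed by the first blocks. -/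
theorem cnt_ge (H : Hyp cfg S) (m : ℕ) (hm : ∀ x ∈ S, m.testBit x = true) (k : ℕ) :
    (S.filter fun x => x / 8 ≤ k).card ≤ cnt cfg.cap m k := by
  have byte : ∀ j, ((S.filter fun x => x / 8 = j).image fun x => x % 8).card =
      (S.filter fun x => x / 8 = j).card := by
    intro j
    apply Finset.card_image_of_injOn
    intro a ha b hb hab
    simp only [Finset.coe_filter, Set.mem_ofPred_eq] at ha hb
    have : a % 8 = b % 8 := hab
    omega
  have tst : ∀ j, ∀ x ∈ ((S.filter fun x => x / 8 = j).image fun x => x % 8),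
      (Nat.land (Nat.shiftRight m (Nat.mul 8 j)) 255).testBit x = true := by
    intro j x hx
    rw [Finset.mem_image] at hx
    obtain ⟨y, hy, rfl⟩ := hx
    rw [Finset.mem_filter] at hy
    rw [byte_test]
    have : 8 * j + y % 8 = y := by omega
    rw [this, hm y hy.1]
    simp; omega
  induction k with
  | zero =>
    have := pop_ge 8 _ _ (tst 0)
    rw [byte] at this
    have e : cnt cfg.cap m 0 = pop 8 (Nat.land m 255) := rfl
    have e1 : (Nat.land (Nat.shiftRight m (Nat.mul 8 0)) 255) = Nat.land m 255 := rfl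
    rw [e1] at this
    rw [e]
    have h8 : (S.filter fun x => x / 8 = 0).card ≤ 8 := by
      rw [← byte]
      refine le_trans (Finset.card_le_card (t := Finset.range 8) ?_) (by simp)
      intro x hx
      rw [Finset.mem_image] at hx
      obtain ⟨y, _, rfl⟩ := hx
      simp; omega
    simp only [Nat.le_zero]
    omega
  | succ k ih =>
    have := pop_ge cfg.cap _ _ (tst (k + 1))
    rw [byte] at this
    have hc := H.cap (k + 1) (by omega)
    have e : cnt cfg.cap m (k + 1) =
      pop cfg.cap (Nat.land (Nat.shiftRight m (Nat.mul 8 (k + 1))) 255) + cnt cfg.cap m k := rfl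
    rw [e]
    have hs : (S.filter fun x => x / 8 ≤ k + 1) ⊆
        (S.filter fun x => x / 8 = k + 1) ∪ (S.filter fun x => x / 8 ≤ k) := by
      intro x
      simp only [Finset.mem_union, Finset.mem_filter]
      intro hx
      have : x / 8 = k + 1 ∨ x / 8 ≤ k := by omega
      rcases this with h | h <;> simp [h, hx.1]
    have := (Finset.card_le_card hs).trans (Finset.card_union_le _ _)
    omega

theorem args_kmask_aux (l : List ℕ) (hl : ∀ c ∈ l, c < 128) (x : ℕ) (hx : x < 128) :
    (lmask l).testBit x = true → x ∈ l := by
  induction l with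
  | nil => intro h; exact absurd h (by simp [lmask])
  | cons c cs ih =>
    intro h
    have e : lmask (c :: cs) = Nat.lor (sgl c) (lmask cs) := rfl
    rw [e, lor_test, Bool.or_eq_true, sgl_iff] at h
    rcases h with rfl | h
    · simp
    · exact List.mem_cons_of_mem _ (ih (fun d hd => hl d (List.mem_cons_of_mem _ hd)) h)

theorem kmask_test (l : List ℕ) (hl : ∀ c ∈ l, c < 128) (x : ℕ) (hx : x < 128) :
    (kmask l).testBit x = true → x ∈ l ∨ ∃ y ∈ l, ∃ z ∈ l, x = y ^^^ z := by
  induction l with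
  | nil => intro h; exact absurd h (by simp [kmask])
  | cons c cs ih =>
    intro h
    have hc : c < 128 := hl c (by simp)
    have hcs : ∀ d ∈ cs, d < 128 := fun d hd => hl d (List.mem_cons_of_mem _ hd)
    have e : kmask (c :: cs) = Nat.lor (Nat.lor (sgl c) (tr (lmask cs) c)) (kmask cs) := rfl
    rw [e, lor_test, lor_test, Bool.or_eq_true, Bool.or_eq_true, sgl_iff, tr_test _ _ _ hc hx] at h
    rcases h with (rfl | h) | h
    · simp
    · right
      have := args_kmask_aux cs hcs _ (xor_lt hx hc) h
      refine ⟨x ^^^ c, List.mem_cons_of_mem _ this, c, by simp, ?_⟩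
      rw [Nat.xor_assoc, Nat.xor_self, Nat.xor_zero]
    · rcases ih hcs h with h | ⟨y, hy, z, hz, h⟩
      · exact .inl (List.mem_cons_of_mem _ h)
      · exact .inr ⟨y, List.mem_cons_of_mem _ hy, z, List.mem_cons_of_mem _ hz, h⟩

theorem mem_args {w r x : ℕ} (h : x ∈ args w r) : ∃ i < r, x = arg w i := by
  induction r with
  | zero => exact absurd h (by simp [args])
  | succ r ih =>
    have e : args w (r + 1) = arg w r :: args w r := rfl
    rw [e, List.mem_cons] at h
    rcases h with rfl | h
    · exact ⟨r, by omega, rfl⟩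
    · obtain ⟨i, hi, h⟩ := ih h
      exact ⟨i, by omega, h⟩

theorem kargs (w r x : ℕ) (hx : x < 128) (h : (kmask (args w r)).testBit x = true) :
    (∃ i < r, x = arg w i) ∨ ∃ i < r, ∃ j < r, x = arg w i ^^^ arg w j := by
  have hl : ∀ c ∈ args w r, c < 128 := by
    intro c hc
    obtain ⟨i, _, rfl⟩ := mem_args hc
    exact arg_lt _ _
  rcases kmask_test _ hl x hx h with h | ⟨y, hy, z, hz, h⟩
  · exact .inl (mem_args h)
  · obtain ⟨i, hi, rfl⟩ := mem_args hy
    obtain ⟨j, hj, rfl⟩ := mem_args hz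
    exact .inr ⟨i, hi, j, hj, h⟩

/-- What a successful run proves. -/
def Goal (cfg : Cfg) (S : Finset ℕ) : Prop :=
  ((cfg.f7 || cfg.lm) = true ∧ KGoal cfg.r S) ∨ (cfg.lm = true ∧ GGoal S)

theorem opLem_good (hf : Good S G f) (t : Stk) (ht : SGood S G t) (j : ℕ) {i o : ℕ} {s : Stk}
    (h : opLem f t j i o s = true) : (Val S i o → G) ∧ SGood S G s := by
  induction t generalizing j with
  | nil => exact absurd h (by simp [opLem])
  | cons i' o' t ih =>
    have e : opLem f (Stk.cons i' o' t) j i o s = ifz j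
      (ifz (dif i' i) (ifz (dif o' o) (nxt f s) false) false) (opLem f t (Nat.pred j) i o s) := rfl
    rw [e] at h
    simp only [ifz_eq] at h
    split_ifs at h with h1 h2 h3
    · have q : ∀ a b x, dif a b = 0 → a.testBit x = true → b.testBit x = true := by
        intro a b x hd ha
        have : (dif a b).testBit x = false := by rw [hd]; simp
        rw [dif_test, ha] at this
        simpa using this
      exact ⟨fun hv => ht.1 ⟨fun x hx hb => hv.1 x hx (q _ _ _ h2 hb),
        fun x hx hb => hv.2 x hx (q _ _ _ h3 hb)⟩, nxt_good hf h⟩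
    · exact ih ht.2 _ h

theorem exec_good (H : Hyp cfg S) {t : Stk} (hL : SGood S (Goal cfg S) t) {k : ℕ → ℕ → Stk → Bool} (hk : Good S (Goal cfg S) k)
    (fuel : ℕ) : ∀ w, Good S (Goal cfg S) (exec cfg t k fuel w) := by
  induction fuel with
  | zero => intro w i o s h; exact absurd h (by simp [exec])
  | succ n ih =>
    intro w i o s h
    have e : exec cfg t k (n + 1) w i o s =
      frc w fun w => frc i fun i => frc o fun o =>
      frc (Nat.land w 15) fun op =>
      ifz op (k i o s) <|
      cond (Nat.beq op 1)
        (opAG cfg (exec cfg t k n (Nat.shiftRight w 32)) (arg w 0) (arg w 1) (arg w 2) (arg w 3)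
          i o s) <|
      cond (Nat.beq op 2)
        (exec cfg t k n (Nat.shiftRight w 11) (Nat.lor i (sgl (arg w 0))) o
          (Stk.cons i (Nat.lor o (sgl (arg w 0))) s)) <|
      cond (Nat.beq op 3)
        (cond (Nat.ble cfg.n (cnt cfg.cap (dif (full cfg.r) o) 15)) false
          (nxt (exec cfg t k n (Nat.shiftRight w 4)) s)) <|
      cond (Nat.beq op 4)
        (cond (Nat.beq (bit i (arg w 0)) 1 &&
            !Nat.ble (Nat.mul 2 cfg.T) (frc (dif (full cfg.r) o) fun m =>
              pop (Nat.mul 2 cfg.T) (Nat.land m (tr m (arg w 0)))))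
          (nxt (exec cfg t k n (Nat.shiftRight w 11)) s) false) <|
      cond (Nat.beq op 5)
        (opF7 cfg (exec cfg t k n (Nat.shiftRight w 25)) (arg w 0) (arg w 1) (arg w 2) i o s) <|
      cond (Nat.beq op 6)
        (opCap cfg (exec cfg t k n (Nat.shiftRight w 11)) (arg w 0) i o s) <|
      cond (Nat.beq op 7)
        (opFib cfg (exec cfg t k n (Nat.shiftRight w 18)) (arg w 0) (arg w 1) i o s) <|
      cond (Nat.beq op 8)
        (cond (cfg.f7 || cfg.lm) (ifz (dif (dif (full cfg.r) o) (kmask (args w cfg.r)))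
          (nxt (exec cfg t k n (Nat.shiftRight w (Nat.add 4 (Nat.mul 7 cfg.r)))) s) false) false) <|
      cond (Nat.beq op 9)
        (cond cfg.lm (ifz (dif (dif (full cfg.r) o) (Nat.lor (kmask (args w 6))
            (cl (sgl (arg w 6)) (arg w 0) (arg w 1) 0)))
          (nxt (exec cfg t k n (Nat.shiftRight w 53)) s) false) false) <|
      cond (Nat.beq op 11)
        (opLem (exec cfg t k n (Nat.shiftRight w 11)) t (arg w 0) i o s) <|
      opTree cfg (exec cfg t k n (Nat.shiftRight w 11)) (arg w 0) i o s := rfl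
    rw [e] at h
    simp only [frc_eq, ifz_eq] at h
    simp only [Bool.cond_eq_ite] at h
    have hmem : Val S i o → ∀ x ∈ S, (dif (full cfg.r) o).testBit x = true := by
      intro hv x hx
      rw [dif_test, full_test _ _ H.r7 (H.lt x hx) (by rintro rfl; exact H.pos hx)]
      cases ho : o.testBit x
      · rfl
      · exact absurd hx (hv.2 x (H.lt' hx) ho)
    by_cases h0 : Nat.land w 15 = 0
    · rw [if_pos h0] at h; exact hk _ _ _ h
    rw [if_neg h0] at h
    by_cases h1 : (Nat.land w 15).beq 1 = true
    · rw [if_pos h1] at h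
      exact opAG_good H (ih _) (arg_lt _ _) (arg_lt _ _) (arg_lt _ _) h
    rw [if_neg h1] at h
    by_cases h2 : (Nat.land w 15).beq 2 = true
    · rw [if_pos h2] at h
      obtain ⟨g1, g2, g3⟩ := ih _ _ _ _ h
      refine ⟨fun hv => ?_, g3⟩
      by_cases hx : arg w 0 ∈ S
      · exact g1 (val_in hv fun x _ hxm => by rw [sgl_iff] at hxm; rwa [← hxm])
      · exact g2 (val_out hv fun x _ hxm => by rw [sgl_iff] at hxm; rwa [← hxm])
    rw [if_neg h2] at h
    by_cases h3 : (Nat.land w 15).beq 3 = true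
    · rw [if_pos h3] at h
      split_ifs at h with h4
      refine ⟨fun hv => ?_, nxt_good (ih _) h⟩
      exfalso
      apply h4
      rw [Nat.ble_eq]
      refine le_trans H.count (le_trans (Finset.card_le_card ?_) (cnt_ge H _ (hmem hv) 15))
      intro x hx
      rw [Finset.mem_filter]
      have := H.lt' hx
      exact ⟨hx, by omega⟩
    rw [if_neg h3] at h
    by_cases h4 : (Nat.land w 15).beq 4 = true
    · rw [if_pos h4] at h
      split_ifs at h with h5
      refine ⟨fun hv => ?_, nxt_good (ih _) h⟩
      exfalso
      rw [Bool.and_eq_true, Nat.beq_eq, bit_one, Bool.not_eq_true'] at h5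
      have ht := H.tri _ (hv.1 _ (arg_lt _ _) h5.1)
      have hp := pop_ge (Nat.mul 2 cfg.T) (Nat.land (dif (full cfg.r) o)
        (tr (dif (full cfg.r) o) (arg w 0))) (S.filter fun x => x ^^^ arg w 0 ∈ S) (by
          intro x hx
          rw [Finset.mem_filter] at hx
          rw [land_test, tr_test _ _ _ (arg_lt _ _) (H.lt' hx.1), hmem hv _ hx.1, hmem hv _ hx.2]
          rfl)
      have e2 : Nat.mul 2 cfg.T = 2 * cfg.T := rfl
      rw [e2, min_eq_left ht] at hp
      rw [e2, Nat.ble_eq_true_of_le hp] at h5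
      simp at h5
    rw [if_neg h4] at h
    by_cases h5 : (Nat.land w 15).beq 5 = true
    · rw [if_pos h5] at h
      exact opF7_good H (ih _) (arg_lt _ _) (arg_lt _ _) (arg_lt _ _) h
    rw [if_neg h5] at h
    by_cases h6 : (Nat.land w 15).beq 6 = true
    · rw [if_pos h6] at h
      exact opCap_good H (ih _) h
    rw [if_neg h6] at h
    by_cases h7 : (Nat.land w 15).beq 7 = true
    · rw [if_pos h7] at h
      exact opFib_good H (ih _) (arg_lt _ _) (arg_lt _ _) h
    rw [if_neg h7] at h
    by_cases h8 : (Nat.land w 15).beq 8 = true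
    · rw [if_pos h8] at h
      split_ifs at h with hc h9
      refine ⟨fun hv => .inl ⟨hc, arg w, fun x hx => ?_⟩, nxt_good (ih _) h⟩
      apply kargs _ _ _ (H.lt' hx)
      have : (dif (dif (full cfg.r) o) (kmask (args w cfg.r))).testBit x = false := by
        rw [h9]; simp
      rw [dif_test, hmem hv x hx] at this
      simpa using this
    rw [if_neg h8] at h
    by_cases h9 : (Nat.land w 15).beq 9 = true
    · rw [if_pos h9] at h
      split_ifs at h with hc h10
      refine ⟨fun hv => .inr ⟨hc, arg w, fun x hx => ?_⟩, nxt_good (ih _) h⟩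
      have : (dif (dif (full cfg.r) o) (Nat.lor (kmask (args w 6))
            (cl (sgl (arg w 6)) (arg w 0) (arg w 1) 0))).testBit x = false := by
        rw [h10]; simp
      rw [dif_test, hmem hv x hx, lor_test] at this
      simp only [Bool.true_and, Bool.not_eq_false', Bool.or_eq_true] at this
      rcases this with h | h
      · exact .inl (kargs _ _ _ (H.lt' hx) h)
      · rw [cl_test _ _ _ _ _ (arg_lt _ _) (arg_lt _ _) (by norm_num) (H.lt' hx)] at h
        obtain ⟨v, hv, h⟩ := h
        rw [sgl_iff] at h
        refine .inr ⟨v, hv, ?_⟩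
        rw [h, Nat.xor_assoc, Nat.xor_self, Nat.xor_zero]
    rw [if_neg h9] at h
    by_cases h11 : (Nat.land w 15).beq 11 = true
    · rw [if_pos h11] at h
      exact opLem_good (ih _) t hL _ h
    rw [if_neg h11] at h
    exact opTree_good H (ih _) (arg_lt _ _) h

theorem run_cons (cfg : Cfg) (t : Stk) (w : ℕ) (l : List ℕ) (i o : ℕ) (s : Stk) :
    run cfg t (w :: l) i o s = exec cfg t (run cfg t l) 300 w i o s := rfl

theorem run_good (H : Hyp cfg S) {t : Stk} (hL : SGood S (Goal cfg S) t) (l : List ℕ) :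
    Good S (Goal cfg S) (run cfg t l) := by
  induction l with
  | nil => intro i o s h; exact absurd h (by simp [run])
  | cons w l ih =>
    intro i o s h
    rw [run_cons] at h
    exact exec_good H hL ih 300 w i o s h

/-- The state `i`, `o` is settled. -/
def Prv (cfg : Cfg) (i o : ℕ) : Prop := ∀ S, Hyp cfg S → Val S i o → Goal cfg S

/-- All states of a list are settled. -/
inductive SPrv (cfg : Cfg) : Stk → Prop
  | nil : SPrv cfg Stk.nil
  | cons {i o : ℕ} {t : Stk} : Prv cfg i o → SPrv cfg t → SPrv cfg (Stk.cons i o t)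

theorem prv_of {t : Stk} {i o : ℕ} (hL : SPrv cfg t) (l : List ℕ)
    (h : run cfg t l i o Stk.nil = true) : Prv cfg i o := by
  intro S H
  have hs : SGood S (Goal cfg S) t := by
    clear h
    induction hL with
    | nil => trivial
    | cons h1 _ ih => exact ⟨fun hv => h1 S H hv, ih⟩
  exact (run_good H hs l i o _ h).1

end Eng

namespace Eng

noncomputable section

/-- Table of frequent arguments of the first operation. -/
def tabA : ℕ :=
  4557305180758449317024958341983804769591828417292771539539121818336973996597233085342368704168696336332275972124594862883641204521781208716708326430161904427323108940714974917893814924544836864279808331459969354544498549130032618225516372094978280306796164067371130188342610766825309087524087379448951392313394033920493316023048981870895822989966503498018688594060838297037912594674946965214324946166649221303750896783694732222985596507673874605131227441696202829072124949488806444802565806210403512551374951478964046471038396520586436248051599965710467817433353492618335844322735981567858059223750561364352318435054872904536403397952374717667849052632939859079009489411481819928628100717009403095619244374919447895815487265692954216499804319267743867860924249104086570407758772242157224064845190817514415305492738151885482702013501725746444978573257485386094929358146079875180834060825000536793140222777714198868293264053721039052457658365564259255326512553484386287007558511252990821416347911734206022901006521162058658847912035475813094111310264192540227335032148022726308570523598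299817449605393489586812582057619598139711223549978462492843882124497097528704358165919144832321315834580593371484659055695015549222349832865815358357406839251933959384600117362392043006891628432935053824951346761948469660447770524751795236337688786154408330623262397042910470008026002601269987651910419046875624508898686085576724589785182344742677951601079261661737779716831015545038697961937860789049286974247826578086929088444595649118306741931204460523073267593899377281254963628236496842484133319929076505539149201900020816610913172366469043920125781484757977875392228716429743084555240022933273111573115131281652951612833277853828939267607801864878439138700381882532333624148230524394472397129365956877871286442544077850203722995908201967003400996719052688253790258887844772496531588805188490279145191171413133751309381899578955109553648000174970468961965393089736882093824925745047748325393629692501849399302268997725132399888286207894686611930355211578569527206892237779282703115609178191406954752899589199039137120630534092054597960581939651081648090025279557210128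

/-- Table of less frequent arguments of the first operation. -/
def tabB (j : ℕ) : ℕ :=
  cond (Nat.beq j 0)
    2583562305101654949767282566047306098642414018346568158839185459455669869469773497179215368598004089783931561588226747873605240932763336100099062651702150070743118691781011947906948865234341911672705957686116283240361902279032175115283834675271607657682596769353692831190813231818069413325580434505192592646964711219598989669848160190068298294492084630881882614447552945114704498431280458165822943971893409362604456482344315317597414190250129155389616630893047534331651810509520469204372042690036038511262478425525182554493122572580915971158716405814081014537155761873538092873265636831886839791132961549609252981721222786736823315895202919891816622090359517407607981508931429739794738836222434335263983945435728957859303968515954247179333090531833916000161638605817653302575293179059721040970419137910987677830810549297428170815549903080562746598556281712324993102830439226102678198535882754271196315262061283053550466464185451451065742125830125739575757258723269568386988174798877723807482533680792620214191859862573059138207424794176056561889397884704413453767602885026820785030454288099219753754222756482569800375875568930770774042234154816639275008580526029345622419262061443343705895179842664670452172700368169263115545762816401821745649577869093294155378052999503013694751809252848713351786368638056147835686557818328322019687954532354169089721458016424736337849161522128734199610632277058536256322186014006193429560477138313879382856256938180660134314528407031606177350668474691831131648489387921177522782805660825154877981454188888429397738772456684944342195173591046252562704808000203477281384786080944929880011520403380515556571602442368848181014033961857699802363375579690852301503832947251014033242758724330901522854068508722539772077487822501467172349144837022199205501705679134813593297269386493553417995964337925545686432503586524479182555974795482063067676979577280930933426330884642855085516659681508753956903992408283912281012108726408531591176303295806393675742242574012613968151336066887311351692673415515579721036951472367948347943500313710176614966739446956234024076105485390508566516343058873305030623669644390698905520242252460332167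 <|
  cond (Nat.beq j 1)
    4557684160113773218013266056523666856511438750611872529419503615096685141299519228173655587496873553713833331751141654499062809877055960107795805655950894603424546462512186468718023330868101551048363475506628786691772872538602924520941947531372523887972650515635111986253088524665117613098404828276377365157279881227559712648488642265089905470382295319794249602196368436852127323402870752618564900911999430239728650467919547754898940100965515202469260177205785071385961603488867348620982582156430129825945516369565287978010149411041480358729423321760445597326387714644265417881855994022809418058863354694192897980726378088999000396799474282323692254784591058866972358112654465703519714123540742381853222074159764053820252676221969149855115269490286004490472537039932126619922064084698966278562532203608747141340876196306759219856256487463527133390154954169644791756883612402134762202327618553139532760992037552212713479732634179604383470515642935203400206320097650447645655313469004182548114107443810434718414086138530075364652150932783152668303142210373756224112197508931652336506180982401841945230220381527445942882160311455035161812403401955566945125674724326392110125413937856709016348841421033015340761706625852928254641728777729658552463870177516392982787945414307078341734565263380638391833213158677594593136524468956885353844552825249559201543613631974154689947357602047379804951527418487672790960898008736023959729348146039979994880820977579964712489917164087484682011059421897748262051484783259610067151197387516850522668758392675208263935807946100213534031613006231689328862896414065045549112807687895296366591197769427113698670919301973848602340976196077751867759784432047601330570973151497766483768976693329275801812910925323880949198694339278313759269053097650404757522251671989266544848104424803519620376672409072551934461622075441489706774168511375562524826091633361071183138139428343877098333209371661964651278378640396106741862509220922453674527613177793034185243347838122876160299830169793179945545761690905962287101608591347815639301588195447281162931597522532405588539455904212454403395937360447178810499327001072001186266079146923528843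 <|
  cond (Nat.beq j 2)
    3804053752635219192957949058802820353533129175542696583859215855455235709725546335690937270538918030759639283148119404552130192701718962861608246897932807738093706207376655674234398975240212020552956091048399851877803154751715058561865660403827469467173238497982944287015793984778672762532127675405314192119314073079464952202822050517095110313988025038103507264321561248125340625724561617924132659303519380737326778536799857112542790250740388912880818707745870848848727842989886325595773811222425551997052213566807294509708347378253788269427936454486790144603011188797910785577870649209669271000428257317410038805233263412871314704177459048832047006220197394561409614518776529645454489024456134724352428736659952823183914008987428391237426863616760849798831168853442520956002136157649899467430428424380717875507281010720500115354684494122550282989945554192412828861612860646661160460804548826447044876761957224027325511325845111013190024932251174928695466139463563380370456174532648540740320646557300129713908605075041538794659336986195118723333867353164555419341858256509404977303385414425358147474136001418308416282085379160245551349262062302371366815037216690256213607482618579272798827925889604995366998006232388207624267532449149892311090916342920299426627407770134140463082747038426898514952080270900873822804870054898788338324011755491301541308047414341578179962484770658272171272045047523198915802801077591378053601216877679785334467677384933247418219186488053318671093590006331322109508283005606949501668672158245853121999440407289055158907806022158044624827232154015144125491514792255018916136973412744326470429535438414452622795405932102825371165689626549266099858102458265452025573229166077778159155878617103658168613452981847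797628166216623266110558751960170141438552562952836652402738998974133629221720974215306065550376577204691371945243700868199103313028368906764966178927052790876223946704211003862149533338497327061809697986714901237684369383175931814746238514620376024957396709133802188716306585029146584158422877125559484776999811660455706439793448484236895996035710518885075340208170555990798403166541006090806716218151625427613238215687
    4485830064103191124391494871071329818358326934575737920036793981577040801471838487650086908561419364203545036816295417140596613000214317389787215542615719357002958728312983610106878422108412871417204505603867770755039485246785751350153760584263518798721221097573587990399325616287230218802393243666797370472580021586772339876186891087387968403606805461024726289465833403505894448721140729412061929691099054220598821265089261943220021890627330066090175631033180354920803665414663497306516881283097970145025721136046104380763856802761650642270693129017880443047595368066888605173100061839827230472873112896063459264013422318496878544782760514475081614547952435357893922106838426857153914559670164674382673301511450286937413740551104941940777840278791963644693384842403599111626680537292491884351526802554577382207655199861356424874955496101159263978574412234536401834673492146230492942104467380806660951405036952055139822664061835193966618084703904208133376493134760485150433077550906335678559705777614854891107140396571879490427045720730075319115420062339813807929406687120373020247860200171172813550641558195513596841466150806832379755447093186477162824014496076347503561516362391270329899817830619886101285303309598508110620407717321582064335104243741754821997010024669227149777607339171679836539113251128832509104198266902571926006400162879646346449998629675865114154596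057806192084293449091635531802723142352358225558819172516362497928148265005084037928350379259320200514810965099573157183350511734113554812310187379132830781923646762454544237603348801825550210326145716502498012044623326171276785049479002494395897035355542985252869259093268566330598896701844834960023748316887898192384396232811438937553609153563098091901383143220132365875927685774384217047845350030603376269887909251480359081149079443594617283571062350331929175297826082327063417193285407274232976108576185883595421965486932146352445396285551107517866739957990411691060923557829382579496880064285151526554311046858167445947468616106750555073811154028780049039412661734198411451763675580376495846493175467602424120104313286954724304474754691937455490965542402087784380019741735796084012

/-- Table of arguments of the fibre operation. -/
def tabF : ℕ :=
  3333621974595674757191312187924978725619359810848719210785872698164200110262145772353928269273961471995254832815674566840709147383216389869250509947285965227641411044991129576497766900757904748005283303205411892113783172563159474955243711660578487245235751162748460911023034672088295196034905158838710696958669202524682645602256517185073063816103301261020303084393765768071036154980130657062830254806544062489287545331323866800453648390646801734954181087834066465132322970186799385150441405317246027672984521904937102228346566885021348801890052918725237295890937908013227389690474086269289877335860455810265266560061353749546718403600518084244252775312860263771697204730822316325724836650584218248261546880333688039368931394558905955483871324198120481443713511706592013627925428504491187904413271825186449855883152336527512201574918680435373218262048343858149044675130534182945561690938213626596009421246535637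8090935432489889537621324484726100578066651287225081845329161683743786673610417271679207770310290544267563001860338659070319872912397613286001462390413024986914799782700717885149564926310929971558903897774580793109038122630873484697248117923900397970320758760263337711915731645288830410199829508088251653191146153667728332350329358223861548566194037839946948367003181706963660629295815967539591480518217130024034749602516112291615164696895695437139299808056659847218781712203072669015948706035067695522240440456584503993608692412242388112833479126861443682293600688302889035200532905406247241763274050240177648290302701082799112349035198609209804575969986621351544042402431246510867001015159722777372964125686846108539554815762700579314945236799516073202383017548593388431470196876419453074034885102541481263497830509012075304328774509131403799860573820981721771702503009014910500669526547241461128041324422152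

/-- Number of arguments of an operation with literal arguments. -/
def nargs (r op : ℕ) : ℕ :=
  cond (Nat.beq op 8) r (Nat.land (Nat.shiftRight 19173290869056 (Nat.mul 4 op)) 15)

/-- Expand the abbreviations used in a block of operations: `q` is the expanded part, of
length `p`. -/
def dec (r fuel : ℕ) : ℕ → ℕ → ℕ → ℕ :=
  Nat.rec (motive := fun _ => ℕ → ℕ → ℕ → ℕ) (fun _ q _ => q)
    (fun _ ih w q p =>
      frc w fun w => frc q fun q => frc p fun p =>
      frc (Nat.land w 15) fun op =>
      ifz op q <|
      cond (Nat.beq op 12)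
        (ih (Nat.shiftRight w 12) (Nat.lor q (Nat.shiftLeft (Nat.add 1 (Nat.mul 16 (Nat.land
          (Nat.shiftRight tabA (Nat.mul 28 (Nat.land (Nat.shiftRight w 4) 255))) 268435455))) p))
          (Nat.add p 32)) <|
      cond (Nat.beq op 13)
        (ih (Nat.shiftRight w 14) (Nat.lor q (Nat.shiftLeft (Nat.add 1 (Nat.mul 16 (Nat.land
          (Nat.shiftRight (tabB (Nat.land (Nat.shiftRight w 12) 3))
            (Nat.mul 28 (Nat.land (Nat.shiftRight w 4) 255))) 268435455))) p))
          (Nat.add p 32)) <|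
      cond (Nat.beq op 14)
        (ih (Nat.shiftRight w 22) (Nat.lor q (Nat.shiftLeft (Nat.add 1 (Nat.add
          (Nat.mul 16 (Nat.land (Nat.shiftRight w 4) 63)) (Nat.add
          (Nat.mul 2048 (Nat.land (Nat.shiftRight w 10) 63))
          (Nat.mul 33554432 (Nat.land (Nat.shiftRight w 16) 63))))) p)) (Nat.add p 32)) <|
      cond (Nat.beq op 15)
        (ih (Nat.shiftRight w 13) (Nat.lor q (Nat.shiftLeft (Nat.add 7 (Nat.mul 16 (Nat.land
          (Nat.shiftRight tabF (Nat.mul 14 (Nat.land (Nat.shiftRight w 4) 511))) 16383))) p))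
          (Nat.add p 18)) <|
      frc (Nat.add 4 (Nat.mul 7 (nargs r op))) fun l =>
        ih (Nat.shiftRight w l)
          (Nat.lor q (Nat.shiftLeft (Nat.land w (Nat.pred (Nat.pow 2 l))) p)) (Nat.add p l)) fuel

/-- Expand a list of blocks. -/
def dm (r : ℕ) (l : List ℕ) : List ℕ :=
  List.rec (motive := fun _ => List ℕ) [] (fun w _ ih => dec r 300 w 0 0 :: ih) l

end

theorem c4_0 : Prv ⟨4, 12, 0, 8, false, false⟩
    286 0 := prv_of (.nil) (dm 4 [
  234343168316732112381034251129984822659969250821056791463387505746091027451810322634600838100687024626194400711880773289444858665895748648183046427340643417281469786164742586879533793132950704663255145092196012114,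
  35078683502427564324959047201094488059411601042692180042021562298060726714289341692893370718202687751300089903621209117805831124259503791295989231648272411856023150585537047105968394399033867511448465567272663904703438848014,
  146579225623236007339665979794732614663579443457897881662198641263341014142156585164384744560449053719961097601211848014898139849814214752393667079857159022834550219584638722760214405190913786250438817672591491409913419343265806,
  2488339691969828253964118945286235096957048851919819964707099576591943033180791756984888472259129094086053492594551154714751711924895048311804415063220920988023547362578540016426733390405459760788160827102022744400888850603975475,
  3737551348735037603850269581518381817145003871927154115197790856366372555814169286410153760435301528737979357831688444450810672765445868248403366583191236899044123021985598240276779673174261170190])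
  (by decide +kernel)

theorem c4 : Prv ⟨4, 12, 0, 8, false, false⟩
    278 0 := prv_of (.cons c4_0 .nil) (dm 4 [
  153887454411975032292885360366877653068788363472452559905528722163614247811022938015473682704022624788699066074735560270992398667702955514675879392153597457682919352228100969296450971880121819719113475021532778498565582877991393330,
  2609311093256903945065928295751109052084301953685660288879541671690598498113799479671945971271850219364428382805692012985994932010501447858704767185074310865577093456161067042392711931412902162726995012802048976823599350742707476673075,
  285449538142441464535307314186873474261123086])
  (by decide +kernel)

theorem cF5m3 : Prv ⟨5, 16, 4, 3, false, false⟩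
    1116158 0 := prv_of (.nil) (dm 5 [
  1341707171248315968599888532830106372483953559500487497756010142259967760237396405312134279065145498320029480513422777385391551281794182171305432705800077582])
  (by decide +kernel)

theorem cF5m4 : Prv ⟨5, 16, 4, 4, false, false⟩
    8460286 0 := prv_of (.nil) (dm 5 [
  329255821474995563916203369683395259153298514099241230])
  (by decide +kernel)

theorem cF6m2_0 : Prv ⟨6, 20, 4, 2, false, false⟩
    4295295998 17293822571535072256 := prv_of (.nil) (dm 6 [
  529260168916721170278185120061247523461526366461499966801635375965666917639994666796339940003691032005598196588511004292776649830127227073155335579673613060229788056842546127630411286653831204254549733842,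
  4862276760378561600408455869816461376500173496316563145380600324201983438242615232791008001734368647298515058989202582905280162079196982450893996183253280493344191332983234667459785579447788578461005149806646,
  458832420025343956479527051635236987002241720957736274806835261533429807846806280277548769810993532967710219079751305019083717672260327614122950232904173034303212688218197254745814961887336870387874550176716270,
  15140306535830251379623116434181651233467585308489859285951675349129463980504825290842146016330759666210102791216186515980284470159240880797085920383234273302429830109299482655195459539189992493051183661358,
  47310385472220918705581637675293393297893028034467127079116443583913134299488769833815371717998960211529883286567794587450258306855062696266531606101620754660235344862408639067424808729546160099638474871463933149486,
  130535755222826867580730341981751416887960102766842547687619583380373296028439689928148921085461326680282299197963596140171961933475454823387686449036818041731861793249944717784781381416918674473689747470099185977487978500644,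
  60544409332406407116206])
  (by decide +kernel)

theorem cF6m2_1 : Prv ⟨6, 20, 4, 2, false, false⟩
    4295295998 10376293541478071296 := prv_of (.cons cF6m2_0 .nil) (dm 6 [
  725119763985632081564986080379323324787048504834641367711445476185210724622535883175685997508262980393083559033987441097013536192742954883250852755133151356488926078076217542066074586308082176356790694338,
  678240658135012086974412631832581588368042687211857558416102952049016410069929053998582698204042584243692730373009372759369282269921146177127509142461094081719976103770391582298494677668429984649037012749615406,
  1282506943141785724434011660730656544284399362304344223952550977048174212126581703419603379586107214211581225027770269116808185395745258826838019540566858493504723930806992909028255510267671049178820934909718295122,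
  764858372216547014537195561932198734875926800311917485117439344476803689105033375804181511247415302089345501465888237563783174769431183600578796149624475558704643569598759163527605881581710800398,
  410263187909722295220519748587825397486393912155607530947930028313538622336935537429882933268367098784408667116770413568946744225285799647097951432369649212561883472626443010811182790304552358179982,
  857817951863813105765697586942448803233207132466775073354444361305707832754880765466767320462213900772998208975110522890833782103225650723810506181657083545181750954265511138156317393734409255438,
  7763601564766021750801029370652961777279970303513788651701952915218580885566481457966690018069461442355636177877065568304686823566])
  (by decide +kernel)

theorem cF6m2 : Prv ⟨6, 20, 4, 2, false, false⟩
    4295295998 0 := prv_of (.cons cF6m2_1 .nil) (dm 6 [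
  1457807236414900830500411712005036193102034474151466835529844758768524045312185481862995684778974625658625326194284100791104499340150330662337756265654516508983995800515111637881225273438383022092310,
  980551894229947603706395198060347787401689738216519081577924408688738076162023721001010267607035647798400514828883179161653537054887256892373116094752644735243308799042441405018156519671661036805980302,
  2615280303636026542944512132081470416881406867473545865754569028071605819575699374039000880050032693692794458535636468066404535807890164502502599776113198293257913244665975762742312798721687274255346,
  572852684621959253598551323762253849957380441048856907591391522069724041166582419959426496402084460080930732275301393332260406450556755742382239912036])
  (by decide +kernel)

theorem cF6m3_0 : Prv ⟨6, 20, 4, 3, false, false⟩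
    4296083454 18374959161390725120 := prv_of (.nil) (dm 6 [
  2958629348930360427717171387731867516074206277884611498869507698611519046828001441702435110945241723395792033394293015298635331895510281228406355715023527980322367524997722575738271714088818068354078190367522,
  359174509396308712308019370450656475656487288736703975298175585399578029579496805752380771842530675709153774048418600206700649617446154965906607129501943996794560093816876399447563224897010024138864028276868022414,
  46441685240684998102420783744598466951683087379491900063716033832808706696785188088422172903974826464863675606841142975974036380633283900533477781948647693992118250620024631622340780620138643042098350,
  5913154013487924040516580463204802864825259164482851927484833033297283200741319789258469300084484301502501192693554902577054120412034004738584154305973444173650325103281505726389978535508289653343515465518744851630,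
  55569551973409644338944761803567844564854254090808814184618012975432777399613240241273399326225481708800929995435725203761928383230181851314428797029970732590664019780302352840521902509245593984008826364673953262,
  6176401730408383918501579038025896365729066544668710])
  (by decide +kernel)

theorem cF6m3 : Prv ⟨6, 20, 4, 3, false, false⟩
    4296083454 0 := prv_of (.cons cF6m3_0 .nil) (dm 6 [
  3977136754393168799703799419480910289186099096638441773259696739597275208707435106584367818810998920165695498060118948368379809525376941506278051106844765632342917101411498395028806293029134,
  230715780559179723677752456269220479934267737611594583083192927190940593483574343680125065438714823535668181874504666089876243156677255616711692920256295166832686637265188538949105564408512654,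
  313288051375094104377104796239693352021194835202117423391528056927184969749574881222339348385841503776537977937307160670049761645431249066495543287413267517112361669279537848688827064491888341518,
  468766519925174883400100281735320163878834974804453447001160651767761565922109330572066613987299265446010680651959930005903690990727166533192077122189854208313122740519000383985721187218709954760877324546206,
  23198381649175474839085368841476271748836929891225138471648247108256791369066692352333322418478027583843389160806430593467865130055439720168290478109907725974434458987008286052692770898172424481586170015496526,
  105866516263448433245889641516190445830363916404498211816502322095376958447521972758366677092894531505894041219570802571985093355976044461411423219680687374719307726276947716200826327944968155399033230])
  (by decide +kernel)

theorem cF6m4 : Prv ⟨6, 20, 4, 4, false, false⟩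
    4303427582 0 := prv_of (.nil) (dm 6 [
  284732829399885232066838386535041664597982371758831804675830838006562696845184906729028982696808748497913607830066086470393258795976688925400016496643755515408834365569342697623675460825565856014,
  383966023241066945565949558077312388023668631769281829373696478826247813549431516064714090062955676182529981238394956886569331173288516059278661516192408818695590468177335355910240461713566387470,
  1410117928481741002490339282445079157457055900351242017125197927243856885924985756036618981569255322149571141957211133063042505107716631869618377212701471204556904444545478694772777852169276476737311600313614,
  967647054364051272862990])
  (by decide +kernel)

theorem cF7m2_0 : Prv ⟨7, 25, 5, 2, false, false⟩
    18446744095184716798 340256081784720276114254332900046208000 := prv_of (.nil) (dm 7 [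
  16606772836618751190474647133062666214332344329801462133924388845177261009012160759824541327644210175595409437853615662017769000457555887411866926071360778007022069985436846056932407991596885210277830436538328401840923360520141365579330,
  3071294891390574739896156578206876998013219290249059360925394850411539428738808287958867767793899027021124200502232160161204000065798644999965491035578342433136195628991002270118848298987395697132527719387418309157218396,
  2312810145228113414971248835455454317681382519334153487992177696534608197722849790490972457695774534849088558330044263601212947502987063975295482899210064190937288965341540484281088997783114477950935219780894489853321084761860192555347919088821502081,
  8371594189995054555194285075100172918367337321712222985997548038621320030510602997590503113548787866220422586823222553680045031167135597501590650546214796530869031483831497558937083340030539287814679759310474902629797373886984309244049,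
  25709720284817521556321822422522502223869088502757329495913671632882715745589265490945408915644362501457993211273415818565428260364660975069202002673416961761940756896123099089318134834086015996303852596445143672275895548747316334052648964847473150086752595087372,
  4632255079059521873893554615733861449484674326513906813893167496050451460162118137044245259589293803717773883198812233004830514544528909950784900655631894502643022508772481896460,
  584400904342])
  (by decide +kernel)

theorem cF7m2_1 : Prv ⟨7, 25, 5, 2, false, false⟩
    18446744095184716798 340256081150827276154241212917911059456 := prv_of (.cons cF7m2_0 .nil) (dm 7 [
  2454755636539893740310774722100508857042592913371605315367610309201061569939845824028812962756382564134262916275314046995778000006135629492479055575340941117141303563558046196315973525151439654194,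
  1544696476091488832097855430114415404616496736468467817221914688184295072690327735218733976500495797540850769898881843202925034342510832052724509169350436584646073791460613618471847348463900278493700,
  15129054762814217566576230108892841445363598079058256101603400973224473633134049711765337484715241430629993425514854481209646277904738769368172618817550952990742857375561307920664691260547965,
  504215185186724610750463764519606988787454835540530490170948775016571142182568995259788500356952215453553024705077505998233988504168193534900506507775609900462206041684381419671920714718825376971441067606561,
  72249182027114655456170728207880295860985938768955127828559478315555020287021349454365750942694137664841423568920221504332317486440163548397463324399388638435150159803407592352058842305405,
  1594799199690367780177506442764007814795634491363681321484940700595564924122962293350729177878258338])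
  (by decide +kernel)

theorem cF7m2_2 : Prv ⟨7, 25, 5, 2, false, false⟩
    18446744095184716798 340256080992368533274073132548465818624 := prv_of (.cons cF7m2_1 .nil) (dm 7 [
  3946042010432481212857557989346978561952648383547186935317488545604394807341177387916913857745851999930693403075528481914781970370583823122711596206741180752742039414246498047986063043282,
  11902554279461660613721927168196050240697664536468553109395894364197256715191932035457448613194406052193752558118700714527664975212024451613342206442993263246947010159418642348160373176575717343613,
  380924702482287715026658636128458823257144570521660922101778656273391740699051991257778632851768203560122041751698677573223959378507926691383125485868402660769285252423015530993,
  225006046887349993987352063133523099427821283754253947694854504493555574897462427299751780636275849952710688377624094841668142111041837722717188468283876763309836123269437421183364550390869615725,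
  162662635877399692094859961381454643266440888502043267307334579671633509344104882528161504779750776498612752191132028660264698869548911427531509260670213388410148503275296215881367965834880189,
  14840561418389508164925117566407194917044400813377006089998432517953916639690228548476014482394450433962475539020959453236642664949665809887067100436601275364079551314786566141040642695886563890291762,
  103369269298876449375471924679695393483921598835787954436811196029112835618877246571299497645247312138298653])
  (by decide +kernel)

theorem cF7m2_3 : Prv ⟨7, 25, 5, 2, false, false⟩
    18446744095184716798 340253484804325184603126698502992362496 := prv_of (.cons cF7m2_2 .nil) (dm 7 [
  8829880278777951639977639984332650557011363412012007344180282498905535123663879859481389332953276722488706699679844583587916170672507565258311946867699038889751721735579191863245979762396658,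
  421839971928468143963123749878797540938346960616913973855835462677129208624185397437872032571749579937935447524942697134321310802554642030595115131883185501,
  1683016398576307038578522832795456616277148314655768756829611731271170210552163644219237252646851062221820558415308282025867807979550189233585628062405584672764314413896110337,
  1521704181277276455347474936141016088915674370636434952267434685403120720550235358060093206121349725929815991752477306454777362695356298956,
  100485952593511208990900131503656438984007124599474259196147509840877287184333168396561983185403629998939839563096937536767249035076459772582300475376719264884700545313,
  577274522169959974770505590805950844046636380908973147346121576844569330675950156964837968820700177915832763938147717485316410985662874356434181399637911194870217494532484,
  120567338610387354697556025690583146762756])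
  (by decide +kernel)

theorem cF7m2_4 : Prv ⟨7, 25, 5, 2, false, false⟩
    18446744095184716798 340252835757314347435390019623014038528 := prv_of (.cons cF7m2_3 .nil) (dm 7 [
  4878275801958804435748021506397902854208954521891045867337152063595699841733841737652068496940022367170290914643762808256159637143132087544649841621225107650076623200417411590739747554,
  6610451715353612098098795493028013677735357707566472274536548393269142298475569126664034657283266157816578968480498614268020862587664646060448106609240973753796348376790652318453051923899012076,
  771541542994114615157014997811765128623802691752227658480994441982078552441992941221000223910061039940463525259198225554241931775584906129690362062963201,
  1899082244055266555025289762521030050431485143636073637869827869006072744258999434098351334487955493662919194650722826273286450009999089736082059107096893226324564385196,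
  20385173168170946855551107539492016222284283451510060032520037819339745814285117682648195300677549267973465626064510007297859080385337385803740569544899543081018981771810610033660452,
  1077079934690206976090099481135361506704946295723810519667126962226130665051860173308549767165082891741981645827284439586634921489733429882328672093,
  443741888194386994829690987026643850732719779725909466227735512868376033388202777090246781732636725399121969941907448195858070810981810916529594108109,
  97874527086477])
  (by decide +kernel)

theorem cF7m2_5 : Prv ⟨7, 25, 5, 2, false, false⟩
    18446744095184716798 340252835757314347435390002029485816832 := prv_of (.cons cF7m2_4 .nil) (dm 7 [
  659613256767543430831386433267500212353065305739238402265328443726611834023481722589078284658398545606744323832683839820043567661401645525933463092491902804418,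
  18894777737573097591537489490297110922506427049813953714409394999815257711797088083157705058124385966217380863432337015548108332755875829480817129140221549739393278989196,
  79527092815668202957626762817640371265346276410285030851182033693068949939951335893299218286768504777066981044816020132149000470608151577451613712838922351273192552206785,
  98022954342217954214506369781770955785461127341893138399978234810038732800607453964217192399905448191363369887297670700280985207411383809965313302632903233784518852652,
  3759231365226429843877104496851022544124986684111562158184684201008113998027599996525868087754775831404425944204801352769290119019311041337563878592021007505666606043268,
  167028795400186043001879849165163899958767417338074047577825967830548984058408521050923835875970519803139903786827160380726012762447370073219224349124813278001369925538700])
  (by decide +kernel)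

theorem cF7m2_6 : Prv ⟨7, 25, 5, 2, false, false⟩
    18446744095184716798 340251213144739014673190001850996947968 := prv_of (.cons cF7m2_5 .nil) (dm 7 [
  70344136362454131852566255073925244706416304042396770034241640019004630228387761903931911905604473205418981259940715547007501564535681469076356029518004195010,
  2587177013202196579912049271602567341702568425389367045237110860379585256516322017078562106490740960811399576584553553063292778272553709847209354073202341805719449100161313,
  77033470890035772881379652264797341900409935579992153520910176364448723912854410486041816198280166982909164144267317866219840510540666338919304753894157,
  2712449563022370364559571020749565534359983555693069984234776214651980553378342200008022676045772453343009001061935440580818641788412990909489282985394951284236423503645397736612233265,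
  556669574341313563096578449363325457437065079845515897756526300524492685776507004770344694820891154547857182742702307849763462758543030091863989784314760980747821468109,
  5539638833432240496338719931521696035139967377935341197748608550353934362918385564692889844125853778074432862251290801739843533192506767885138266334928179888417,
  38217830536565228881283335304128027857119655616087382657817197375845068648209266054623448382854906262972357709140069378193142098321162008496734425238754733990167908868,
  34063377920088193711502675250499281102148786195896505940099447718214319031238119242388903765481516825650477074470642238759352333260601472326249372313576827650913167628963578707667373,
  66610064758598809260270124252142780860476152355555693])
  (by decide +kernel)

theorem cF7m2 : Prv ⟨7, 25, 5, 2, false, false⟩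
    18446744095184716798 0 := prv_of (.cons cF7m2_6 .nil) (dm 7 [
  7267305507236861062425120307719464830708361727912261063054473604792003212616958479204616968562091569487971059149841723757787538790351478526058372033877261058129858454043566256204291950508895760091665475046499048384253660300688895497327793713357889357377253398,
  1672756438045288359822211352454679338499041819599261730775607572573950520001598946027696649345469505523173375302650266597038350237797229657002602564109726778905502557254197233,
  10478253605966039836144340433714232289552843114242231148198323308566016093907078064037484308509777499292893443873704350785011367258151174311464798470349403914577846001420937789,
  69455225609547656948769222980388719907069506761022779889579979166961470242457030298146338345442478786084083105215038305680525035899944305120588737941275037,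
  155046857724393414210963248349301642749220431142071716786413849078381])
  (by decide +kernel)

theorem cF7m3_0 : Prv ⟨7, 25, 5, 3, false, false⟩
    18446744146725111806 340194077670853616411791736304633444352 := prv_of (.nil) (dm 7 [
  7572771012396808441217768284931359191262358606600226046883851419174637332600182951840926021679268060873061715598537631971989316216107348703835571295274523750974989118101658097053520634510107417703353221533717703805482338706,
  189202836516860062914504792915947628743881196482869288045685719579032293941072276530383714880018101921313051902490584618906392718252070027405499197505724791699215811014053001147260685686447002130729878623740950544785,
  635549079569165338898975665365811527243755230035751381136305026988602823288175093781450032724645344045915912036324901786307280906003646485688203516846030145868546334504576025084054291911748718835545153876884403660177047915782542589,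
  763701149411304000919435302944802306705304614444175071128270479719717819651902629362193948365695163379465185402469855225892331626533137143544858758359823953947350073771970440457654136272025925044901594636622476,
  89716824545312209395318015832538568166418002396187258282246568408424299223782847641047895636921992398113100929530611909571328429168646821854906608314237089794967072434513281771315999074,
  1727739548759269529204073481134580151106333327040354084095651397393343668870333142636409715869940692925773478502838985661766193333537022035840756598739165458418085605191383638105396671799519316061449800766060,
  23221327724885890431838675305148122826165510262214209638359979314576352717303149097792754494697758940211308539270571255381047554067027253332168564194010734898941982758635693346629634214066003511351020,
  9516261974179356742])
  (by decide +kernel)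

theorem cF7m3_1 : Prv ⟨7, 25, 5, 3, false, false⟩
    18446744146725111806 340194077670853616411791736303761029120 := prv_of (.cons cF7m3_0 .nil) (dm 7 [
  325080581147114696890507868578655192888072861875597017927174254161931380117571649565818871622820316625702465711087118027238164458662935831920808795851212910632313066586616289777401544294136816868001797746365194706,
  25878373384272140370397371800146101136066492756591740451560516694084217595297479677379048410863200113460697459431284329143631368777881455305170850005447253204973834644132530811177670482121246531856695761,
  924324347167724648818195437709353928431670286153122056323339755833163853504696235144326646732337268810266177929841207852811260946889721575314441194251613134529527176486306164189100094421666900527196116479016897023676454,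
  3158072333798101043850854476957284747791581245194074961206716571065891757164296969583015717125159097165023465617060190832618038196709023527688057281810187967521407206689599629416937117209188260259068695847386185953672539996577,
  4199137375584309494264521407302649063748682487327674493490484120198500694968966948466299663639224957444230897929927151454016817500065052922160483545799783311412280775589739525813840969244373983105683652775222818249130669,
  989037622860341805016597711683437979502081502928188325582993837996099383606816882416832467466557231140963260830699234675215005239793552372638343305599132200295762915915175973770867678026745715024363655073863992165470372,
  63211685589053131966764152021646706492615925876])
  (by decide +kernel)

theorem cF7m3_2 : Prv ⟨7, 25, 5, 3, false, false⟩
    18446744146725111806 340193347504107431604474118716757440512 := prv_of (.cons cF7m3_1 .nil) (dm 7 [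
  478970792367090304249658349046366769411268326525235733585906676771962270303581821580618500045083290034258751228011400401242719942700621321018494360835464736699035231229184907438333585635917956266122729747577322947688757365696943525538,
  230730255569649583993826090138175975882807032109007367119512108780163524752145623303993388004670737715455838997506465009627726209699384830963300127417016823485180560177707297539431534294166798107877515779590505037293309860710687139607135415133,
  1159943242149141179673302123462448955371068957351874046178645723412962132771075508649121330973813649332493773290515176310907182422120061679074185676645665458303471266283278807413526999102305611793882941587294601031732512604855328500771615033084,
  19507382180450753231451709624355521341544876957274032325094577633869075742794133470007342680386164642981090064019145055220534850554220156430801960400228927128106659052064459337561184673490846019239079872765,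
  145714951039347559960203437662311669523916362430769393223269647874588531082364699636820019309968573308027184570755789758325349532025782683744494503456699943639521737979691250336012505680018807916675247026083991814350469783820495242527105,
  23650299388633418243323891732380768527451784759444850902531106323450110533723663384029701173649524])
  (by decide +kernel)

theorem cF7m3_3 : Prv ⟨7, 25, 5, 3, false, false⟩
    18446744146725111806 180777765876545258938081843702612948992 := prv_of (.cons cF7m3_2 .nil) (dm 7 [
  535164778369928466621607157371796770110257543878556617257047298219350479797676552989784934604506565865224970903306235693529958414142595443410560862760285796288589343873891103973730625446983144631757272473517687726583807231761,
  108698672215502396774913095496553399269511358931013392584736717743771584976778868525593322591848015959471089943232243543108177480944479833994464756208848532838259655639510324700997454964669719049267980511835390321,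
  495693529588281601271377114831928034175517349706456080142296591249445916716429954888351486179389540864920032154682713749768095125703090629872029882164931360182547700767213800184201405697996035040193842293693,
  171800011569149185175751357728709737210386503474044518894146769214097057114453495923972909156576087980784461570987985115997560503935111811870770322428296221911433984635555753892194879572876780541043481744931912523807848659950252,
  100486167394414073507167642573199544872312493224398824406767787363139151188854517319147336346887658582799631619931400867304329056873325063243665669970883721718657063747543526916167764549281936672198128139721311790839217006082929186,
  918353235189710518064223388729992012849619375259450725001788320903725483236712061122584909488093799462941409434773739432246841321083516602702635295552163470555111282942262026690464981735153934667315103289729326192802771138642049,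
  129791887200126127351770213376090969864335752633611552954219838805445008002026246227001886722977373429063377200646374684943565425360632227585781605120975135697820663081689541420453528776498194472340135635134674078085220228727546951852498444604934365254,
  956660779898974603923053950688462374429799383300861662478865603817615190675402124141916835186786038528351481027940422218772801212])
  (by decide +kernel)

theorem cF7m3 : Prv ⟨7, 25, 5, 3, false, false⟩
    18446744146725111806 0 := prv_of (.cons cF7m3_3 .nil) (dm 7 [
  35251716061576616453069737276559258699496674592133137271332771473363156524396027403442485682989618835580576290463613070543809433703176162645275158401400746004913110166573745803697814834053656247645526732322597077072640283773091852,
  20752673592180363989740263496711800471063399162777071232732261958222255966986497])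
  (by decide +kernel)

theorem cF7m4 : Prv ⟨7, 25, 5, 4, false, false⟩
    18446744627768793086 0 := prv_of (.nil) (dm 7 [
  325225684660590185498214776962218321334337232313867803994856064518532102364533878976910930876727092492410765945023469])
  (by decide +kernel)

theorem cF7m2d0 : Prv ⟨7, 25, 5, 2, false, false⟩
    18446744078088733694 0 := prv_of (.nil) (dm 7 [
  908])
  (by decide +kernel)

theorem cF7m2d1 : Prv ⟨7, 25, 5, 2, false, false⟩
    18446744078172619774 0 := prv_of (.nil) (dm 7 [
  268])
  (by decide +kernel)

theorem cF7m2d4 : Prv ⟨7, 25, 5, 2, false, false⟩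
    18446744079347024894 0 := prv_of (.nil) (dm 7 [
  3548])
  (by decide +kernel)

theorem cF7m2d5 : Prv ⟨7, 25, 5, 2, false, false⟩
    18446744080689202174 0 := prv_of (.nil) (dm 7 [
  3548])
  (by decide +kernel)

theorem cF7m3d0 : Prv ⟨7, 25, 5, 3, false, false⟩
    18446744078290847742 0 := prv_of (.nil) (dm 7 [
  654377073])
  (by decide +kernel)

theorem cF7m3d1 : Prv ⟨7, 25, 5, 3, false, false⟩
    18446744078576060414 0 := prv_of (.nil) (dm 7 [
  855703649])
  (by decide +kernel)

theorem cF7m3d2 : Prv ⟨7, 25, 5, 3, false, false⟩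
    18446744079146485758 0 := prv_of (.nil) (dm 7 [
  11277])
  (by decide +kernel)

theorem cF7m3d3 : Prv ⟨7, 25, 5, 3, false, false⟩
    18446744080287336446 0 := prv_of (.nil) (dm 7 [
  11277])
  (by decide +kernel)

theorem cF7m4d0 : Prv ⟨7, 25, 5, 4, false, false⟩
    18446744080177240062 0 := prv_of (.nil) (dm 7 [
  11293])
  (by decide +kernel)

theorem cF7m4d1 : Prv ⟨7, 25, 5, 4, false, false⟩
    18446744079120275454 0 := prv_of (.nil) (dm 7 [
  11293])
  (by decide +kernel)

theorem cF7m4d2 : Prv ⟨7, 25, 5, 4, false, false⟩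
    18446744078616958974 0 := prv_of (.nil) (dm 7 [
  11309])
  (by decide +kernel)

theorem cF7m4d3 : Prv ⟨7, 25, 5, 4, false, false⟩
    18446744078415632382 0 := prv_of (.nil) (dm 7 [
  654377025])
  (by decide +kernel)

theorem cA6_0 : Prv ⟨6, 20, 4, 8, true, false⟩
    12885377854 18446128368351477760 := prv_of (.nil) (dm 6 [
  50304837844974962739599724904133432365627381764207109650427544370532081680318991185282488925425293852786251999608447827698068999795578318514427335896056641712408425540383365426237616949344226629135261504543093074,
  2100029460256640243622309539022088751060152031050179497249048463401911595756727142872887424872158631640629227234984338637657196985357589583344532820358267101877819778547213733261857315211333557459076476679728472711004365762095625859170,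
  929821221751734616033998822942965221180249289571073969940277638907804095931158407138303755047512809943739334197237309845321957859515995141326401065605691778651816145705673955804280776798315018977867667032446887192105540,
  13742670962396157738114132597751119125498202805486782718654952035864683401131662441281161584435418600596592218750587477572257256658822222871341199615779999549937959727484884987702471945563644676095651715325529009233318265070,
  25853511174223912381414648130980721634063181458341623669101036489875855966308381310322339899886153469062689911443075623313644328671742980372260861712824766383669314197729359901667590431338258102534868545950919191077579243185090749235502])
  (by decide +kernel)

theorem cA6_1 : Prv ⟨6, 20, 4, 8, true, false⟩
    12885377854 18445829284007804928 := prv_of (.cons cA6_0 .nil) (dm 6 [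
  2550251857651557088402371216783615539887950713979353725918584504833645322463785986722140797593301270176902060784883087389790706704993448731174971345669736045137254521955360653191490170392275499481366491458,
  1689310503888754277202110124981481598990185413300521297888367782354537900454970906527725154255002763093194811332838737524072538176351052800901515582520346592683479660367873384754807666033944624383377663346200809764,
  13106032335834353213015903223250317001678372756713921922279139787085284184289072540938375362943500956321588060841449064794195047354332355143517377240854953787193155819736269328228728398496583755070095244897643961991406,
  14551634456128810798081462109610676727550028898232761105173035656089941522425118444460097071389218641136369064728715028811318386985162334665366286338209293651948817168732766985533891958819346431112335628381400487727231307973300452,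
  403143090708190320938924732379488676471624397472870570515985381520793574080425727089261359207924191219042260486532407762566452301946225049693057238479534552159014436942476716374425254764903526771818798,
  6523362213393378942184685951442110264922497637689643422358941091468709035944177379883119039104151699734766])
  (by decide +kernel)

theorem cA6_2 : Prv ⟨6, 20, 4, 8, true, false⟩
    12886164286 18446115225954189312 := prv_of (.nil) (dm 6 [
  1131276552825413518077152698416292210007222097733750283768099613394008958156785788023777561085838836001738214572724135653093913607953151377786814356034426767495618278267902773683534379748365616717208544396629573595682,
  845739868544961664499671580054285999340548369283058482573179334810270170445241766968859932284816972629144939418427457650113482840655999212339012101644041838893806350362963511681589980551245176009163221643123729858846,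
  194826722436902997607712958289993102053055155453965838847045215363987750905402090921553803649087504388320978995892464044477617986484597523858690583092912294828800539956203956977007819166021034168487489137274147991821706079992035374,
  1255044141953326979224456057540375333664911672961249793592923190572298661637844288875018446034672683482698504970213342346451889696858991345153404618035406526501140115770667259378680116064146025015352066595764340474075227533234642940098,
  831765235394266190879559545814604483912388209675368330391185597540089988292664217953034805662737786289949529374347937774742024414498058795884824924212])
  (by decide +kernel)

theorem cA6_3 : Prv ⟨6, 20, 4, 8, true, false⟩
    12886164286 18445829284210966528 := prv_of (.cons cA6_2 .nil) (dm 6 [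
  146952149942745260091773141390982157746803869789017478346633098765778861642215856877394355277697058227079898706993900646144817030125871257093587994990423189228201989567219883449793525410755964872521152505279042,
  1623527076459012693294224340878701786035058643778990950967562781006038872122924345554895890320265572929614818792571213816205847722864626585773906880052830746856255268519138928842340483093378422149317172096535912794285637484445838,
  9103710277762758185475759690863549334414119411033774597138313411149852754023956212806248594493054439544265970507908544328444829845593050662995824774525287808633416146794275908444131833468498682163957480044922353158659332155554,
  2551917490472642509527096789195366220631023882502457915619062046218744002164790861065943755562703248051926322602145487942631533798725497677074897101675317040078435568554411914751506291874952452587758,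
  292140218161935973152912674274485088218812888790465137820228566840637974851784476111280569494482388177624668437283091645308194678971850200355973056768593542099319953534895143217140311980523666095790674309718753518,
  60708838938617843522598032511892036895982])
  (by decide +kernel)

theorem cA6_4 : Prv ⟨6, 20, 4, 8, true, false⟩
    12901892926 18445829283262005248 := prv_of (.nil) (dm 6 [
  42819322838449355250957396300953606820545941496021822452411712880579590907654607703814255013140411992983728896218973110991990642345193837484452007187467880897083569676049560832976567810272414722334446223598,
  13805606032098802689356932523082922431495548363174915441729266083329915434694305444323849936200448394033787173337279303265815630734433878609938247114553100901619542746630456691684085976603649730502548535390,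
  53277563615292766087651254475718409217124090323362668986888478381110724258855089220110351855396825574186602807911787286149605211061085106511393458874380662142017696909798073186328760401265539219796200174491829694,
  2869974603982650353195971595529852709185536669306605343161291100726545074456425752651970014651987396455589173949083856872637348294093921166141525623619664475805725595833077512629069792700865035188246152400074218246734094,
  37193361055196487467384024598042813046515487313715495747680292203291902957730071620312099476791075113563683031438218945660120642111088329454913855411928769147917027430918734434196085160293205612618048724883108021732297129893262082,
  404801835209384083384147502409471673624170527365798326842287634981179882674766732500934710231310])
  (by decide +kernel)

theorem cA6_5 : Prv ⟨6, 20, 4, 8, true, false⟩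
    12885115710 18446398091903139840 := prv_of (.nil) (dm 6 [
  9597123115662421397325394756677176972311403141829705269912603425747683608992500268766494615872931993190901854640571163963589580036675066686249213496661640878781819610226399098942404471461152517175104294356840313538,
  2557513198105630279554845175383929011448437677030897499616659791293843160167524294802821786091321613524160039390231139623237478793869188544525093226584079118690401149225453046024995588076186429605084150147800411515741665798831858910437604,
  329754815841192269424036220531924895861945068387523106444089131811802142363901726961281503833602266595865267123308573540145211389464163702231865985548943095567360865817696252096872159289236056994076288532697369434173196042446,
  112605990869164413844136978176672291750604989669424527670582140683533232224360080419995058955410742716972751409133457716620359586819101315673076790588174265302996519490650886389965105301639183856500397019876074381145740595859684,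
  14152181415880791960579448862165916788042845311444365664786091087406913890147537945433781014336607472019108488012027621348221665119684030124263996490449087351161952516755511987968885425598])
  (by decide +kernel)

theorem cA6_6 : Prv ⟨6, 20, 4, 8, true, false⟩
    12885115710 18445829300794195968 := prv_of (.cons cA6_5 .nil) (dm 6 [
  1527015871855924382363529853049083050374484055589098327151251522264927523355493281815316899918854623203739079762962640998894929450348455880322979711406149690419592276354634758541426558677543718684568386377651548738,
  227831071265780769120630983257770010081395172013436206887797450255289170555585261930895035604136218360878862453118719081015278691424917848269392116273502055941867765824790012753585875962432425763337391454852798722983146762111330402,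
  527257597304815642182709134063436065391773417636826568397256791833035812176362011502439631278707552088552501872256505524363283980670494028805113403700965066261391184720808871134103096016641248154264110603094299533965903437762581,
  14957584132453096138930230980954736280483557751787258955467109367859337587808488669310776083724934404640812279050514312889953576005010870327324845380597782079799740761999321002478413360186762736966887768334,
  10302576211440364133570273232253175438350594468319441315302536526372018454537645667778783667352913910794278744094520514726228560780605780946722191920874426603198501046955865437534496520282686810530499764827439807135695086,
  223914755446782221745461141594345497181906032285265384738227646141227702481118208641590895133514391721587262602352577715583253958187825097862158608863472366276454363265598225384196006219187494602936211474447516702404786,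
  225500942583613249739317841941])
  (by decide +kernel)

theorem cA6_7 : Prv ⟨6, 20, 4, 8, true, false⟩
    12885115710 18445829283345891328 := prv_of (.cons cA6_6 .nil) (dm 6 [
  28675185496239857527435069625975435979307005084957433039676954421284794793662364038001357786899030272697957571529969829486836832152402726876331355347706013140803794301973172257039494467858296088194031269933506,
  16750594251991451738734235350922013019722457228224655783689931318024613305990579603599152898308269297666669240736631724038255628725084766571545356178790070496952563606011263821244416777918445623385856125946720798645719691924766,
  7680306186936973133091139224148237806149641504426874224546975011778373978137964173137929400657187045800389558965175549136713507829950711481388321074004775567631261800130627758299532059550062433657864633058738414,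
  339669856052996869749636833813591781618046935063883471359388150983513627657629953487742433138342421490165929628800054283406939916900613647848857260835877729637865981413669104364990169979583439346226927753103512136076532472962190,
  280468366111377185845244520013934260370317314001623967240980008496955672299744459339121870908585142849258188498272347818314213104153666342465473428095014639730774856308791238412892188767254715886342731342071834824174492964843570084387635342,
  1691267890682532370633678082882771314836709632719451382579330492082312972261142910670884187217559941205861173630])
  (by decide +kernel)

theorem cA6_8 : Prv ⟨6, 20, 4, 8, true, false⟩
    12885115710 18445829283257810944 := prv_of (.cons cA6_4 (.cons cA6_7 .nil)) (dm 6 [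
  1831489230673410536048708877421413508196816907699509804890454549337936937885260513337837460262275729045502393967165982688013899386030194217331991082224820804287903207018918640132214610923943748923746,
  1604387704229177889351500497064899253361664004172939547023923925577975043439913559529187344448459414328855709088134642885566191194889661355146007055480046728712195455053213185970002077097409836842060012913735074062,
  3590808652611314256123032212721249346414202591908383607098583943231778743838031502260140507039637839642723560228178798920052132744635668146462149647915707592346646654679302849427936556414341224173138676296540594434138502846766012654,
  1258905513826856202084616041000154510329005618672188232207680884966808511378264871328510558632699923915286852606327091635093811867529552822619805078646592823718817429104261465673461414260599205137264667585755942638152952619236,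
  3706581189721549420952436539687588093450610079327311840073205217569968128067546861967247767076311956166928189742119851295826057166172480698348200706690123381303238161060626196664260480848684202116253842414704585501406,
  2245832315624925296093444633413068962])
  (by decide +kernel)

theorem cA6 : Prv ⟨6, 20, 4, 8, true, false⟩
    12885115710 0 := prv_of (.cons cA6_1 (.cons cA6_3 (.cons cA6_8 .nil))) (dm 6 [
  683502730261338694952204089949941525185486932639105070957109347735094961605938079004456582709431289908779331336827765800905040562154221676377058675315051003724223995277403225397854542943745118994702,
  1981639710077634084128234149710916082941071904120738986277601718715798549523168104164289266052517893094833678166650927353781049723648993661792536089441925427333679158506399053965557923269250989699995820848359522,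
  63795249388506598264497974451973077577946814584337221372123091103224278869827415898281273261324668735761652245330081991204522070562638232398077900123569742034439776628094318740177517785104679101756753891753093358,
  236780292816133268602936856699241277113168772685983894866342612013195971606689455409280751038525931074522942126236570931596213463935357103125780060950437399282662966849357636973942874277333592757670347451821097406,
  258163513900899169282133779784933775584231738371717259567636353307018861393451589943945928107966253558729376074340968760135687812661070181458356189583094567623051761678811892427325465685633081972466489097830434254,
  1533165118037187973954827473080917322076453788904118194473135153543732444041225511807103741356272955042685403392823545063263522654558828835871174547225856646655296792379264497799996286239248405])
  (by decide +kernel)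

theorem cB6 : Prv ⟨6, 20, 4, 8, true, false⟩
    12885099326 233128111427340416 := prv_of (.nil) (dm 6 [
  2335653424001143773262250079138078778610042868852580789797617214877627624442619070385068847067966820232099320655468540674915370804146619831972407812685910742338166193618008514652251928935221129290295815066873178574120532058604208622,
  277756080577880678783974432782595679237909010845300393945060923801162253853357393826335435124728816727151438445563075827960169014983319587710828982422117033138690204441622966181688679462031231176503625362159368296873110419768013278142202008420365124678113608452,
  298326729415118563200912651670443138894660016110735320365692972652089828008876361395268612276993184523619720136006024198332591748462718290144878991674941855735107142152773350625364428829418007529099172789598499181581970702787239538568878075663080817661574251345606615061,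
  210559226303872867667956278090194817591063047315477])
  (by decide +kernel)

theorem cA7_0 : Prv ⟨7, 25, 5, 8, true, false⟩
    55340232251193901886 340282366683250046930113676390327418880 := prv_of (.nil) (dm 7 [
  7736560700004690772418791107185710301842688190876975081389779573103126005709721585665592714676389341183210500083630794508385884282596189108809997494268227975489095913198148184094192052444,
  10290964058055302394730020503619278622361100860308288543099976017805802484426676976858412673406203848117422839997969076932787089632428010364224841588476792325532193396,
  2914754639304079406535375644958633652818950695317648513273594268919694666691633034359306519476347041715035720080648260081716591900076661076801810953697652687738919343688017,
  20884424216610609814130454409418280805663002895181228895511082910831609147277640538493686201441164262036377255489089868207059272914553080601835435886977537212,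
  257177240974184611520155065997576873802156602222860377997484213963033979413756508473464319341420442901963387672972002944112792862960114965514318720130041646590505907471133,
  2751418556145483894735189224770780246503191781913326414602048021788170104814834350526460728921836048308922842012595823862620684])
  (by decide +kernel)

theorem cA7_1 : Prv ⟨7, 25, 5, 8, true, false⟩
    55340232234014032702 340282366683251331487584292313008472064 := prv_of (.nil) (dm 7 [
  6351354959551267900263477002686136331250246003541888258199889768977274472397978817283913429928198730629757642185218495972026395591765627853611292173803984521277616069331180003961518009218630214210,
  30066399340032594685809191858552799186985527410319304217894146028642824142725414484209867880288313761662707646494717496778251936767201743013141787091402866261371480328096337452933641366519614732843133143353529108,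
  110800454824578975192431778943323643758779085442712776958742759313115844602448127864881625598891033397812351568904104436658158828825534094320896979379137587427048488244774602789504925826390920409852829051748703630955867817579195773,
  2607619649018154518493778322845978443226305346369794790451338059692003812403124186077416205624439454272230071227818258474214821994648922314161118410509667469610721865633627642537643994838372973077064066,
  464358889191320559765671007950254065281784593212717159197733069456325487136909858245217705171902299039354908786908432308738021759030375528403261959398289879510796014620641357857419049525323258163438092,
  4502570883530045581130539797819374500610465899888789160993662207868302016571373517907054808755654687473159450555987337593816800718489588050627169511140577332504979738641685492515405645394505197,
  14508767351125364761902215980963760671586796971881905654968936591113912303151425732761884250333603405751584091699536560564478229822689507651494486929540639978034609038575700872947027768894994516708492671556891248485829395251087043266333])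
  (by decide +kernel)

theorem cA7_2 : Prv ⟨7, 25, 5, 8, true, false⟩
    55340232234014032702 340282366683250046930113975474670043136 := prv_of (.cons cA7_1 .nil) (dm 7 [
  89565607882957534752206262156253420708470688267799218942581966898526731970512222065000248900575335216500690953201739380429205241336765630963143741946021427862550882148805666,
  128623484734776604851635668435669289620078627010834304591507602344793495786507604667274282127431040747219290134505039478533609209937093561461215621479330776891648407021386681468626551674798271339563286051241087512093,
  166279929088338678480554633717334321754375528724231559900385232697997031850086772698651928726984213571303363169999206863993534935854542222143029676395128829315232408815141719664458997781,
  3582158594109117491374451298197099618449877387768324348604965751563926421463515286453126396458885943219953138707530954047572302124750574221568878997859437185674232372494780557793611812898685349485,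
  369966786666845462822846856483194900787237494657259346076581799105103260665583957120072430406375364000938613495087958777145388411916431766565266889369866462183651749795649843232630716596433216574229319701,
  195393543438513680157131847228549825059530549986447692306748036775489504711737397636561386689847218411099993835889457991085290948260588578735969638771561015569253327403377643495150584363521901,
  6043317662004466580935679828915755584943972630525158340635394490124010968796802237833043159521408206104408477228822940343178999166367227756864278714881779075732164169123874924709360800004])
  (by decide +kernel)

theorem cA7_3 : Prv ⟨7, 25, 5, 8, true, false⟩
    55340232234014032702 340282366683250046930113676390326370304 := prv_of (.cons cA7_0 (.cons cA7_2 .nil)) (dm 7 [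
  13952845229862725157862446085054034934902203588361226587145980537530900546881878626253271315160985407504862169930607881283928509350111545187415141806583417545837953611269548769135435166094692041996000618818,
  5356515233352340686651551354231317396302994988502965480188483959547658169794488627180981724929468601738607558492638677071382708185341167215691702628488363771760419895359332543955198721847181047425971345697,
  6982099277445171653510626491322124345547055858468880337750162847279919454249011725908918206781054647256716761776256348273328004040388896422400651987328395652217909410284792476328775661696382203414580974763985924550801,
  2640663526543538881457601028383553932552244976192168766900004632634453430665009249712170442698546050573890660949388154531487197408020733549828998801638880572552198645571162570599476406204508586798988056640885268985845731500,
  132719079183486502394300886669177498056794572176297994875417842141826834363704911736955397871780650227835171626729609407761188981560665678832469360005709449249468,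
  26301789167019348343227154909211285766666827048598316130206657109637096443371089358769685205208991967410693044549125667177976253462980562007779026699831742913604301978054507203369928176845418889763226898827994743746365,
  178992347291575275868804806761741565192899789701749649549362685445552273009169251841924289292173909403352828113121545511518867352600274579273552856747870514912511294925885,
  277637156448757417796735265188002])
  (by decide +kernel)

theorem cA7_4 : Prv ⟨7, 25, 5, 8, true, false⟩
    55340232234014032702 340266789792674442447228084900587405312 := prv_of (.cons cA7_3 .nil) (dm 7 [
  254900955182957509420671485232508788016549249187022819649104098127171842897355114553479630416014491046554622715211424554765744589164952682417559011428502850691102350003053,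
  30014032448946349726475536609008064801020645782938247966453347412886597778133292815183353874677517195781384472747793152979264335891208522980689931437262799352336600008300630347438749543406809165999694512273,
  67301038328409996939807965109553459831171700632154970752749573923174481875415806451041673759509036081168583424785194660549973032669211234154973416225333511470676760961980500320529441087530602363889884,
  100191390846930912111020922542718383224323982443756372602218294867791437594712015860503709262406186482951621178834897037426878447733826238676190274071055037753512479697207361,
  2019173271685775138658574595536172326811725122283698036074133679608688355938860169884417241042156389917639120048032195204321198519230168740236562062710448918666967171022493872164940894069181054521764,
  72948127367766677647951451734590361574317693994783135894977990216566774384909022619377500490045351223102826047019924246524293551210625082323004090107100])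
  (by decide +kernel)

theorem cA7_5 : Prv ⟨7, 25, 5, 8, true, false⟩
    55340232302734295870 340282366683250046930114248548892835840 := prv_of (.nil) (dm 7 [
  5450795911556803599499487918697622824148983710965389195904332213210126553643421102998210089383630469598054896774920557037172875220405371978255111838787684391305294196269682,
  16969463013404685031531036146820547704742754237115540219932118367409192972792759876165686287895841293134504851727550769462711988580156542731328777847305421132331396455632343073693,
  27834361281275870969319194225444388618205417460961946352554157920229053427787207512954602745657636653631880401482861667823099429008980560922651445255083849727903847748292,
  371652405829412677832499671149769938594924118573044185218166730758260241183048237901626765987103022968718472805528040235091595666248887679404665470841088718107105752793340,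
  7272354874657891113393773543510420779332756500662760878225849299855734928191185942791354830737339826626463993027495986324880298899273393976293781597546226400914036588,
  15707823140108876921258108629165359214553654386072631560642953538910886180111788221806364261981031817436431461398643021750590532234728425662630949204939795045533563062479042])
  (by decide +kernel)

theorem cA7_6 : Prv ⟨7, 25, 5, 8, true, false⟩
    55340232234014819134 340282366683251275040547413619381141504 := prv_of (.nil) (dm 7 [
  26678408812087438019483704892901334833639925863155358792632208184939460238939775989171042961068540095937331303517559742707181198798215649194971788355591502360112537828681240898263984204243374816377925887730508322,
  148430378452497460360317473527467978591823098624182096186665947989916504848335799386160032803047811630772660238689254017570772771781349758130961099865307751573595697425,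
  13480859948932006828640934458940001404836251168532106288225354535265110738169920069849799671450752032161695126579248839516079494144636598764821918767303484795258481948143658139279594557336762886182497267265816279296507362725948466,
  5420930447334705651991097120682892976200298249913288695368851466608128435392626237589883334018601987876175771818463223676633049407548712022083325788809541184252790282076862946834675583178159874751766497345,
  77456154403998116565858463007444261377258113953364060227343325294496386017181938211533445001389682209066945132167375045454647471386326921655468032300258160458546918625673722910772614516972898754811772,
  352033473964776714361685480190259091147034857657244618166452608853895301043776257976706660628085726206293144511440763946427560349])
  (by decide +kernel)

theorem cA7_7 : Prv ⟨7, 25, 5, 8, true, false⟩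
    55340232234014819134 340282366683250046930113962332272230400 := prv_of (.cons cA7_6 .nil) (dm 7 [
  100501334353387510236323377558366732803466143145894925002387844413560054677566810030397168530929274270357078275661712525956160646487083575730866916109117594380672254058585789492290,
  161941298214710081410387068400832923923237188157272204614565689945664685454336258687417012513771375762984326282081270632402209128507966392449067446232272925762734094464847584842574855124732996366434911207338541,
  3436809573924010459895771218763267917833284042345667797417003476168400178141857271432865304351782682425087466059434676698743126262863495750713171846753141038159191451802607547526781341717,
  951924763162912119644176436287659019784623160437966079542039997882238788447036874208668953440500195354567236019330581130110514218261905956172143228779775273206809747195440707770883330146818796254631594049,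
  427422866417557309682071301870747411151041716418264205026732759466954298784918896847592689168657390627371456470523536656343690556347403621881711998856833680197136000272979505894226856844683262812258155741847573,
  13161883892655323903030106465123431597115048692899145869514446010865952124226109109683821627628679582942596813794192425498738278434233200539814493532979311044030221848457015674897437882552242682790209,
  361020351124004611914259959180661025967542361628488251521223945624611351007305431708444109688679802776154312908286910147542376080422830308691265527374814155037481383407320624269939382295073028,
  390947016687660])
  (by decide +kernel)

theorem cA7_8 : Prv ⟨7, 25, 5, 8, true, false⟩
    55340232234014819134 340282366683250046930113676389992660992 := prv_of (.cons cA7_5 (.cons cA7_7 .nil)) (dm 7 [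
  321177743494230692250699768628559487380287065709888552618703033906969027122554026776685402074956624358475247589510868489928264339945190154005985846368568523533271838050920613536308759722547109153366482,
  688198658524287151886345262295803503658832148733840802135696189229182459668430123573368540719163626345328919215670844190420858452269618005211909147771889938085743109098099772,
  162299805584980141059736181973417903049864686900652988951465369242306092656750080867434982171036826730365063751355429158245890811531474108061357228271327709478054803491805,
  30660314690037007160047662596828302610574155873318480566499370752664286456389546631553185060934822071827462054166070466572585237825799597296884445375348069380204552240419571203176135596411803750721,
  6174034648230465376653623805730586884025794922053572907999929918609058942578833097348077890751132284360611537340551665169388189078275535594567961736281068166844150752531469250475612326159113422226983249953581138145931122525,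
  18025662829995557782605700900820349384019001533645471677331351304555232713284195525131891951935297022350754952075530542601033423800801271206058663693740767670392379573118392237,
  39073956072713375862837877878983882265509503492])
  (by decide +kernel)

theorem cA7_9 : Prv ⟨7, 25, 5, 8, true, false⟩
    55340232234017964862 340266789792674442447228084901637292032 := prv_of (.nil) (dm 7 [
  425409805945958441441734738478349823707278819033975642646262217856862191880013046851333200959588579709161341745598964533330582746523235999220632645162894152510197487335225632453677,
  272824915373038841407408623173156432351843863932157605843677040248846499809166876200937584127345214802101219089560314691411161149599760497098116486900666642419961724476610647855809957801073357244547132,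
  1083981083700448954890602179768430648841034873414887586166754489099452635791762614587461799808130880012508198986302157602601127072935524869802785288390472515299518220678666305466266689097480140803069064534254178,
  9329117858205861580388956959664776726307259047175427802104853166349409673531869907458920831590133433799177477983743218778184531053644032660916635143457177013484137936099916566130258624779586326219083580,
  208135373360728448916212598544285070564751799129728594176160039896645241184383640342975153908957077481135930555169466781188970177735195217900698152069228744241429773435102205168805776641638763571304614104548604,
  261532789923721639756775492354841435811075375662017151376550696628549210487842825622036115568144595747808732])
  (by decide +kernel)

theorem cA7_10 : Prv ⟨7, 25, 5, 8, true, false⟩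
    55340232234030547774 340282366683250046930113676665507053568 := prv_of (.nil) (dm 7 [
  5827093169229968420148088341978403999586560944347792559236075747463895457066669753195220476382152074852363215171791141088654256624255311081134503794950551462530,
  87915743249976804208140029380936728319440171321106141831088177719883707524047139437724313911856414107148181269609053757724872645516207475848415880871987145762,
  364802081224497890335836824717827308117305850743218608259724895481567730078928549472477271560282864727185911554971990184294671987905179816755274540454569275769088416931877614903116,
  14760849626434672831855609852886887266905989126763262317790265557562406088905232378696425743474382646562814525401136667699017271603385376658763058771470085798741984258891072044558170804017019277615650,
  3706162504381722012324575986325663228907694179829141603912665538227153479397719631274125484853513856983697332228337506372192732501967565817509384608849551113488572624089969236909538360341512509,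
  598665936153662279567592825716252328513732237438217229792302256692914025497284260364201220248357666113419751705775794366982170890241286102817352899694841944800304773940224662348894596,
  343968717544363263356536794442410937491000747637099074121570113562910414056674278185256713682284667885049510558116922340353452])
  (by decide +kernel)

theorem cA7_11 : Prv ⟨7, 25, 5, 8, true, false⟩
    55340232234030547774 340282366683250046930113676389958057984 := prv_of (.cons cA7_10 .nil) (dm 7 [
  1675849233155620155070792424262174756083056226122804553648794388520342465536705321376279344247977457510840805846477849535196348587670285755305135709191678365746827582891351634976982949379049386839994308290994,
  247437348943050966258532798233880630983941512320721432541455631262010429176768892576741113305510083975612219055633956959883467137458499361878804433794912713112701215164852875601373505171345222997187463588937809,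
  8296488118831795876862159337629130689170888760843010462070891680840132643861306905833845855000886991842284757217460390166128615284690037674529851200317907982790128397,
  370641222755620715806732974306271231597132506754232626545685022048426220594489939112617951648217796977969249459083864678900416892396708475759416100609848861282,
  33175498926601990205965374743063189617155839953176998196544315041660356466093541561624984706565037761579161657704373337167623961184472250030944178469966239806054438229258291105784242985456312581773374989,
  36627628793433060823832570987340883397056010372141676682471710982990716901464919911658851995145903679939491452658997729125364123494519372076957812955549])
  (by decide +kernel)

theorem cA7_12 : Prv ⟨7, 25, 5, 8, true, false⟩
    55340232251193639742 340282366683250046930114007171134160896 := prv_of (.nil) (dm 7 [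
  1338230714701764593177438272117467068018638027771523383379422460551223081689512533611139801174001393592166052581414830580737195819057462479635660700154805205115397154,
  3281698900367227984237248104680618393345062515213241573739824976656101358928830239832874302241953722593028888738999131485110407736011070068975570980218825592558144149170772954763798864231802995099800481932892199495842,
  947265580589039527477203782523638418165327648884558567229951991432939928081494709336494773951885622469863874253424526134449706622931835382608238373485294369258757296415771490309599807285020,
  9965858573284005231202894598113201275469621995759706400182400692271861227446539884193749651502868312475891274087245653259242080910036021812046056008225590175969852599853242781895846630770405811716,
  88816547438639678910216916996580847973863244690629278225888851927242398061791596502274858070884783320566992940770400493307798105385755842455667674937177422152962497180252076828335503325622265414210296259744836,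
  1483503302604953307827502762500133822425497366083497594065554333659333315598619861477384496430746503256395237642023124251438611431375786927340636328054817419234149139083656967242142885320324949124145889997415523802631874576609,
  4795633196039529692730325647599469206923937338269584288484108131780252064443963128400899266376215595122])
  (by decide +kernel)

theorem cA7_13 : Prv ⟨7, 25, 5, 8, true, false⟩
    55340232251193639742 340282366683250046930113711883542626304 := prv_of (.cons cA7_12 .nil) (dm 7 [
  38524933341076188821194618523750754849989694910245941573815366173602564944875810425362946953826573706629720613119947257046007062398253667307185111519632206080796544874867314,
  198226749505454650616706801032702404934447962129581601026379338184662199671970550703579280958654848904481056522383635704522434961553235854002636398730487331536834672449376711658743906,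
  186672408227493128738916487518643148902636167281121772063177467791257239202734413412583320149599782755231343915463592779263047242240921521013134725452231610142725588096603645,
  30231016962688749757200519420891056096555445027962719348435292150293454697654936179931433591040220510131233811800043246784732182090320705598470239021135995146092210552346762178464866,
  76141925700255709642736052371838994677131274790137724081368579061515155366010124294029835760894780989960406978981161968434456682696537153104847491278875915867957517471533396530198351725507715217,
  13451735882064711671423524])
  (by decide +kernel)

theorem cA7_14 : Prv ⟨7, 25, 5, 8, true, false⟩
    55340232302733247294 340282366683250046930114020416813301760 := prv_of (.nil) (dm 7 [
  402108384775596752268300604395976183871374781475796786717228873483353135043823661273174657790972382954395258464008679372426301076183394110525638653159157237713095023564284994,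
  10757627258493311363106299909323692644834520744362660608043427613981237015264337345824151836080496395994588545641693931506292621330177254661133853076008497080125936034436503829835672770,
  6535167263542126041715337654708014130300051223052084712883244084117722871730112850682683670117144329365397226369169962835597322844044892816523375570756117618431947480473024017077008249177295427068842156,
  294774681185689118226531824003146143223603490078203985678183946734449469366001493753302394703381297782965510284256868539922200582009149233151268828993371150043528214590762038243121658061619533501,
  23550380252778253982889625782476993909812053269016325508738837164463644756580306845682357884536739137440503497958908922936835410102702326485685284150385686213049602731798601747003422439246962,
  436077460240814885945476493393393022330685164224872802086858508263473820270280486341497809080133560346751457894791316349430346940328560129285208105496458152571900290839067578616049782856010773015291128114,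
  280658633530622710492695179949835078003358792122528668299053986951633925382915505112878395681933073077546824577238344276642072191517849735603589226521238270079468005195472357090516049142033])
  (by decide +kernel)

theorem cA7_15 : Prv ⟨7, 25, 5, 8, true, false⟩
    55340233333525398334 340282366683250046930113701489721769984 := prv_of (.nil) (dm 7 [
  18330262489177087496702030225933069439013220946440726169675399302558786857881287431995370880687407822125309023885387395040530939042422570849292433884511610532546401219570354,
  4802215380770993059162459261771470092546109788312148381034978818891470733483748682981827476959409795791244260159070010263584252083925021037647843648188846727277478170332,
  30696414854500216945954524346787751015468046506159343179131577158002744456775923904112559163678464193544699056868889129810560419521861630345681104613273320408635022936217246519694426179466690564117,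
  701580474884885851972897813255275180165629670170251088253340885621313006082944821809759822189396360630440845681731322087954219021361013667962436082476044048710675348111564951883367453,
  632312533498195043761517789233518703722590198864931036824783007202541605590654362589835827557510108044408193353647584674495369063722613047468559528411013825404880575116736720589764750199526873160226990129])
  (by decide +kernel)

theorem cA7_16 : Prv ⟨7, 25, 5, 8, true, false⟩
    55340232234013770558 340266789792674543166450750805618491392 := prv_of (.nil) (dm 7 [
  3222902028106046678439659364498200230690816928719761844440331197199249133616433464425952406430001343998509224981002933075755090630716766165627241688239890195557403931113518560271580384207354390216159862710939461730,
  304775319466529474014162252555020927892736447697702352603551013261559849949998022619061777331894679856280558887539528296617893681270611541168081499560170602376329919519341731641563938725289777491179719962157,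
  349444426718808972670903689727909456346584641565744194788006829600454615861067884544564354303014992002610971294843684600695674820632489862763973591386552356817125152783865706489835040788716440284,
  36539015236599468204845537313244354135075214139812423500173617939313431019677445757870530450807223898621757637544781976006929808819038723585238429816534366617016753741375900649066735222007682482082125264957,
  1676190810208866513833896585909001995854649387903201253868283770341739564173199889346513672649806385194784494239714152710972949206539494712780547030900670826320467918051765907098064543107405613082682773297447297926404736904143152269164229575966545760092,
  5400516333145446004484328114541925138])
  (by decide +kernel)

theorem cA7_17 : Prv ⟨7, 25, 5, 8, true, false⟩
    55340232234013770558 340266789792674442521015084646304874496 := prv_of (.cons cA7_16 .nil) (dm 7 [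
  61447059803789427699638799377263980689168448702684202643226312456806239644319408952973903340707265542569351476442367296053036311030839426786446076130259344147999690700141442121251360367682,
  1778713243598480512543844469057599207188044574906901372292927443168377204478020791630173686695266048225107009549031874547322241601322141036006873065149179498388539841764000825263550908658215317308563068445559901900,
  31481240300302447615268700818849734380613116807005490698550536456550130666387337639434683988824744995030975371983864735136082965975946344081803806633607289918708766636221217067446330875532858970515071124748,
  13031424028382269395532868135881701664249322760425446244725942666839869771008253468857982671520072486276536111087721767619197552991419349865999642796564127751489328606303856774067323008835606991210601064975517,
  30280170823230252412006228030415177145152447339138396753563440851453269637520309434242205698019485248104880518887250877461137918530454765110132922028891398303298800585865007837866790949757128725,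
  51341566767221415699609508435792959290718633310686718901379000411460179761942702580764823901972991392843205267046249459229530468275194855064645058855096826334305596294271093856230586355958225652542432320249819789229,
  23748])
  (by decide +kernel)

theorem cA7_18 : Prv ⟨7, 25, 5, 8, true, false⟩
    55340232234013770558 340266789792674442447228090759280623616 := prv_of (.cons cA7_17 .nil) (dm 7 [
  3600400561451782120984300444756288568243614997956196651806414937638361181236311014522724428802740773766594595657681551901814703044245070199248064638280258199316627469038826152642,
  43575149729074948952822855888577881037715767123127857898322068068192366196077805540164033985598984336844621148383057610662238865058247088485037696244634195039696200921551519156463770375646294055671898148,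
  190398933028040873730280545692384899857979113210111674927309837386625143317825310950598616298465257931659614855239321398105168117615789568698686553838083912995732914143695204660219005,
  22399781130411013522889108657832356271593161575131517705074082643179565919037132878480436417930762929628617592754414988454449748768269230396506271273618498558579161574607215141358568286451549585427341836,
  63527318966975361870225060743637825265530189262907971994960578884956095410434563012137521902534779170579390063079301048574268298493107580314043255645051128741094696036198085493262092361551136725429399964460118937518140])
  (by decide +kernel)

theorem cA7_19 : Prv ⟨7, 25, 5, 8, true, false⟩
    55340232234013770558 340266789792674442447228084986844577792 := prv_of (.cons cA7_15 (.cons cA7_18 .nil)) (dm 7 [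
  22710951380002080262021257946731037180253504241227817929133504844140961023287903393779370103376122665673432782915332796244609102302070786662874409446204002,
  6517977834045438088311247394271548395584993397351480468088250576860521389314782166871052805789381334029594431459657954757188801237633848828337187059428870676334226084221689994948929644223585305658331962463276,
  698664681537647775970733255366913653594989019335788752394165541637253834939730249717041457403378129503002182126509711545045447275904088241826902737184945127243028964142010903629752120114762522545980,
  784746804813745174767935201516436507304325736749983884289534481488646734504834354960598655190982912128219903350214963081564133367126566542773855438655648217389,
  1389154533305313426597975802231776073487194228324814728918901900894045803366906458894836128476109994565949879112711881703956920836266521971892857829048110604,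
  180755329108571375129623784926004984943247053526948569626920685979166858736177157415988729694110288890218586677348861884476616564678286296034496016689833182819838423606793963144033690470544349,
  89686843602584299669243894597577601669993593965158634253927321621])
  (by decide +kernel)

theorem cA7_20 : Prv ⟨7, 25, 5, 8, true, false⟩
    55340232234013770558 340266789792674442447228084900676796416 := prv_of (.cons cA7_13 (.cons cA7_14 (.cons cA7_19 .nil))) (dm 7 [
  12148534598881818165491642084986912108981613207864506589735872178693459625425143349744738748887533697917320135407312519608263618548404207654624684989442498,
  187681870855097895114848343378140587354900981822059081776681686249545247682534162874995179591626145416514560026896468330298441273662718636348008356662094792008878571083213,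
  906671871387387737411496762926903954027137463039245905296931874121133067964381306701454346757753404401718592147315815413665032201975561334840739398851629619578397718956291956892313475528755890758483126103638289,
  14503014164111542051039779826056126357024946849239251732302689617349756278892105748549981762869130999195427216719157516393646965240293825132263422110098826021795430120587509091782288537194463226042189,
  2867667286349202859356562427712655590914960740338793643010621172645262585394161134123466233825389378087161315023330863717914871673532700502198885576210998834218102941796103657027339821077,
  9460872820214410624656505397830476403701741212836429556333774911036109364037750949405937867240051147353000046874872004052533402930586370169780349319947485785114513793664188449,
  5272568235156772047178136835179983220229050670306993958482427702546441830381280755071448629016857843166297155275303821808559074073774856776980131306802483812,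
  750087847329094921791260814107852237733615051515004965998168053351696559434738780154398981674926430544405816893133623319791024444066984201325201650246751068235234858038039661252629,
  620223954220074009174449160989130143994504428367878776350191122907161955850041486626286229915869762753732065782309268556204185055623675268496665771534395731204103496967236305036195696905160785704049708,
  369480966404])
  (by decide +kernel)

theorem cA7_21 : Prv ⟨7, 25, 5, 8, true, false⟩
    55340232234013770558 340266789792674442447228084900592910336 := prv_of (.cons cA7_11 (.cons cA7_20 .nil)) (dm 7 [
  8373881019449581976804971610127086278456794669253522611141407848580487534387811202512035051208927888521488009663401418257447538285291863413017707476231544316558653830900358832514,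
  4111849011315528720644295005416374244142315781460639251585632256281554822302945561070012440720564415139179128754502145381734225479675938074045403443652605327640527150417472826465736527933145153,
  394384149072369974168611449671652788753797984432461528652678691342971099683243673873198348636431354506507979363548875370636686799721914975401546652630119552176895803046333,
  40281762664463511790041581295560136747927255287140808609776334462391895556647102402543107360018839390467236520225679867772647649524073178765560076757369002653310332120716,
  44167770217753763194356615865223271723809288581713872452245131730239198753342047027743810660933609926981818707733692866180444143613023520214588067971779299154782825362441622423018371444976951741414676173,
  115855350968049679300066872680766999921982979831320617153289097631850185473151217754495341021266786965806682918231668040901062109232140478459756083091889020370040719055949272731232595869780160902891634964970530571145290240033,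
  855825656195668756306305071118881366773794642546157093847847455133532974701744796881351092660220610958328383366661431926266853107528916692054438188468533051248082121829343869645])
  (by decide +kernel)

theorem cA7 : Prv ⟨7, 25, 5, 8, true, false⟩
    55340232234013770558 0 := prv_of (.cons cA7_4 (.cons cA7_8 (.cons cA7_9 (.cons cA7_21 .nil)))) (dm 7 [
  4451753490101534250635848458669505389971922556239303605597267686377052946252642348998018919588159121354608128518379437518688409363753767516320361119309496317975495271708381585479246194364418733643148,
  13292289355270923315032170623357387544635220760787008279014196530530506445393401337865393272646140722275383954887153194219621542375509300444765956673069720227266137454113,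
  135783443559666072475139597894596601731865238627305191811434892686553078027916734880932754892750030736764933543701390067775916259661374221407955454882551564,
  10640103101691796184423194388654923432952616435359434572353988827581818753623155484447489755315901694533588012958476657926315191653374337353275153427589454283222641073761356866,
  57846916857801198557790949674459415188935249918527726035533237280426225309299660664764486844559201766472512120789982668903640594845805009035609386441688153579253644728058499938314143055747414354423502674253,
  931338411981874907520621391204062021339402594035281953283640534146293857806211610863885814014881230845839378617921513424129868813766512080451093361647435255326262696481347614129161748430613250,
  26070317813341245011215036635438791917477187204372277880009619508464177324])
  (by decide +kernel)

theorem cB7 : Prv ⟨7, 25, 5, 8, true, false⟩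
    55340232234013754174 15642492495443903968946932085737600 := prv_of (.nil) (dm 7 [
  210638564757213271984848138082922709240763704297066962117918849958865785199729486144120650128914102975122620370868724390148192459048017954879736453995867572753485,
  14546167697102042066670517593058340436735225316988186562292911512044076935241486441736959257174409067176443639425681056169668520244989783375646318354021807727719189332537729812851010310676178781869793,
  1589303190298134259781532346140054420712333356604361125203986024076649156661764648916613248649985957897024585113423855801966202313924110571253792046622449924524040575604576229423249256473299166993019559429406303695741526528493908219526995588112651795280968954378881863704,
  19938285948973168624926975192467064248480023665059734997119288339533721054545450422023194896673624507642383723491076723894265359161779836882369997847004661184170300482826551908108408111872634484099327950984336391006065578078437765268862076609512042764485410193429,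
  772598740819462140952204678570254248274171861124000823185688397868754015438416635331945124606930177366982310460448394252649784591949158938831141255603967117244379932503324575595853773358314543167271246486513234912801849449183086840741856446139434544107506467279012,
  31038189189977726671731958337643003875059400509077718697265877654747179288814933330432963381640523610869250844907128230638221224772747704716154675004217376990598931437934925436421607468835703217086485638091856437544366442088598759355734707412102813701968034,
  828514480243291358847627011300629447314704161242581047237767372189683944006491373228352781272379595253913962665954184444277809783600380404862625859673731568176531239106437268161253906784466064278623181513193628281749318015755927398758115578154500575899564801099741568484497,
  3684366561218133073058345198371505581813167398786131778131599410253108628236933507978819281206254494983346236539528831461482816449897516544592934408292])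
  (by decide +kernel)

theorem cL1_0 : Prv ⟨7, 25, 3, 8, false, true⟩
    1213666633124151329623542 340282366841709086175672501006619558400 := prv_of (.nil) (dm 7 [
  7949047734704731439966015591639859985795950523520052661033408640894610674104828565007472570838403373946457859958624938603518334847788748872579896689079991275570,
  4000508471218388871778298013451140477887499331248293698964929989602978485662683737473671742646775469411383037104512553841980882550390787158266476347260780,
  44576166752672460821948303819425427051859012782395308843567696290063924229949855849866415070183330158927417199960286481362277295555443938870913938874869809973501006018,
  315745642282834824488724176207921708519491642857695835991814513055571492739753735577294030048870549363968833987596399871312445707880797219990180239717591142237804183172314197133928559968959,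
  100337442290860619419278381803229210488548810509602681060837011656705584532021258900093958591437506514281372387148053437350417250192626070532763041757033757301859576762340640127524615418252,
  94076303916525339991788021298063589370251803707193134111008479553861587288460])
  (by decide +kernel)

theorem cL1_1 : Prv ⟨7, 25, 3, 8, false, true⟩
    18446744078004588022 340282366841709086175672501006619558400 := prv_of (.cons cL1_0 .nil) (dm 7 [
  22797264719009626447170671713259624699583178525700049260004657449464790419534886676440076414594599178268070824103738196530915443685167492219869789741365159232372216194,
  10888318334955400313104215250540551473076518828020353823556667975344313177305109361091742047413550307581483700769113729251339809145213270461075309291727057563791,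
  92242798719344099325367814987685776880394794414311827356451657605569241446150713501518725909621826006765158099898231369689150130038963693322125694005196440204828,
  1217446778958219176574211575098354143537787951222579788253630840853780652883217064585317374007365635129404000389522180753185266338493532181859897170044047,
  404025077445202688474139826590633805459160528665044281172727080213957986205990958883544952929565873843658279531317164053387883017081067692126823493919,
  74380247806225884271237517634307761022876122969383128163509552917411478097417886772391822153676931749820713510942272920655230037093356305281450616591209279236918248791327949,
  1477633144841836939273552268])
  (by decide +kernel)

theorem cL1_2 : Prv ⟨7, 25, 3, 8, false, true⟩
    18446744078006685142 340282366683250343258610545463809589792 := prv_of (.nil) (dm 7 [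
  55439851564604661640314311939076929402480477555238873255276397815747803583543912199824588488748570712177773416429897450662107920438519661330527353076537276344527634,
  3062787247908693741003253486411518886125179872892793787664109935502095896003696965870873699403106652077004099807328784674504587857490086992765958375130679109068001393749789446832401,
  124444558911064882234875063223599690137347840578119096948925149788349564718680601089693553584518086553378851557483515872847102633829491692729686109951002548223149369293566222391043759,
  301771884677685001838651971554083982333708947631408801324887599664685325634135994362266881197427931537902772142408776298350071820301266468566722580275384790023893230652783,
  237383666744152298662117689042710480279510716651621225802849574347982131553950715419029864747214723202829138994932606616041476078920814246390177388380082772621293206991925599,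
  74641133569417318889142093912601927376529604945])
  (by decide +kernel)

theorem cL1_3 : Prv ⟨7, 25, 3, 8, false, true⟩
    1209239414545430229355990 340282366841709077321235343564419023400 := prv_of (.nil) (dm 7 [
  14063508934306125520144183991493433098160641209506338476040865100586565329062682473851882508074277148303079810769597338900453995644530458596734276412936386,
  266016102009622381848469171813257703361670093194801352988057176109487519670343111451857195471400463053933253487666715133961341658041610902641347069452331046323888508117609147116521060029721438062890429,
  22569174623505479477925193387594386805602830090691495595142554790884591951359481879027154922579605703954574458815360922274925933281282246324811613896893532754180674717646949109358590183100203666785387512451,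
  215631230525640940535324342855347421480177706088147278445022344921861364676172886990154790250248097347836465584180278769386677442226498031654572290551398160314820860893,
  25091390083209211477580865333870025506213599014627469232376466674488338456897957758355108394828382600982463464287025212591370173707290113410435537052813183461309533203588735,
  178317112450051315115725532911062534223346099918532019197420977573008795111562145107520189623060217496563266089708197332645002413183048547416731071202275843101])
  (by decide +kernel)

theorem cL1_4 : Prv ⟨7, 25, 3, 8, false, true⟩
    1209239414545430229355990 340282366841709077321235343564419022880 := prv_of (.cons cL1_3 .nil) (dm 7 [
  8490495890418891677102354421851297950861383579019841420426638797968641587595806482061898740476959379727431023801290171529985651458155183967151100552226219608170895806514,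
  229044927751105035283146057344324324101543781263512983536729626538245390960096036880232816135954090961954626614474418230216943560851264455217873315832363191711994289807909999866639117003916,
  614761827220026681472166684939812862109913546014669053728739443244041578183599622896261611093606850392716562284035754703802372315787355975124482926409988862937639280632652541233070531323165317394602273,
  1944888500814335011773753787960944928164578813176319519917699634447837277007913159270556634899635989387398974436972390993763327924343240649289720992252925023818426627430441890735551,
  200348749868107812663925778669776736969910309797822210599062304404470835301543999541411633671563197084228569200525760463723192409966342702484676620202415825145443360778911437028444,
  77582511139196560985787256609212208437193677026517992281602267621565015116253298317319522654767931518072215844076176479294162531330695068126855947967919913943439818717696129,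
  4331998609469833343982722346494387058074934518659800991157213382827522240468734732388715684101666711439306474681548075591318683347110273311067709])
  (by decide +kernel)

theorem cL1_5 : Prv ⟨7, 25, 3, 8, false, true⟩
    18447025621701823958 340282366841709077284341855416999919648 := prv_of (.cons cL1_4 .nil) (dm 7 [
  217143129791721365578365214597408556226432154618903713080752528449895444146347787094676100418548359386192081698528283510365010851062689782119088579202483640666669053586280719003245334271042,
  83205454319746600161978782122637196129644310231425013541575201374800097827479997389009577516960840818406691841591322770695696728995855042357687879433112439113891513469316998216957770624049,
  251623000337691946858557081197993825700403503976236256217280564888603190093157982274996021128178675098029456435182840160172146575495717654571529461380368653278792749346,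
  3442057743326712589086668928263991485344177732172745017906533142315064480519225570669326226407909921053189125185497466659047316016261876078607304010220442164477,
  5327361920973099723686142795421163013236630549967110858525486608466698085355365225086565984948627105885161991712217959136328190856500044865756030504680713949269396562362475584972396584,
  35362529533620938356504788173323283407760393577668866847557521824701884378640427343767120616710438369243845260680503665815509949223101329192113685722613390430300,
  238908642416874730996700])
  (by decide +kernel)

theorem cL1_6 : Prv ⟨7, 25, 3, 8, false, true⟩
    18446744078005636566 340282366683252752255813180221322084384 := prv_of (.cons cL1_5 .nil) (dm 7 [
  508010138869299414483303261441205308114035995075074703716918587850892682282163959925001723044487092482987189518438389389286237464189690688119149490825814110959881059544014110066726740726338,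
  60429419411033981091290869382446026832110519107955496505362308557155373969095332052912041238189867763450128132008098500853077509660892762809951362391353172022699217831848507232220947137869,
  159954589208161105623857809689019281950770359242824423313693202394062030351980645931488125428367693482722319120952617772829287915964365932212634870811943990573017140032348,
  39750957789553703959021461827613774885283397967224964426017199730382061962031661617046741021800117205911637402346042292934340978748496783237219426323564860010588,
  304041039032518006855139444566779459286534392705938289745113632374617250524343978497465443510044109790845752444664626488067836517350717236286954529457799746635669637214270867124371548,
  176726025695141354888923211873925198558433727545342686347626592933617478859873121726725113454153927429514447560527406451917904925716537119348576656769053,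
  153336788542189673028911115678077704806144611184679991154669917810871562301226188098246095557411638452225199429121840544593065424983495819440187441,
  7501])
  (by decide +kernel)

theorem cL1_7 : Prv ⟨7, 25, 3, 8, false, true⟩
    18446744078004587990 340282366683250333813877577654313467936 := prv_of (.cons cL1_6 .nil) (dm 7 [
  230807715667227535939331357793177407060767349725988909148165675859623315773466506236066050671925335557657597497206540006034356955535675367483101873194418927552095947845827381191762,
  681283395572960204205502097224385856766837074182886155712715932605740777267652555024326602336633899203177998735302995238516280499329635115999746772683293687565,
  132215114662124508828663336867755491995070127428296847635910602443942922171245698701244018870749328816111404522431117133244608812246486524417695858686921812428378637405,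
  62917564207103097179187008261814176768218292668509230537479135314072407708923591829471690970591299775621796792362122181414685388576999528615537897784480801039950045286154634264185532927,
  141155737311734863021033416425095458287825685620058821947689832291314814939398351795931964937482324647538790414571519407838016007935793757401300109324199750207711215751272488,
  29364461231168467196009105789924393599759933392668949536329828413752622496234565278481873484026155929850578855204806767292670178882441234701872266270111913638221961679276,
  7463855296303966551403722238912176257])
  (by decide +kernel)

theorem cL1_8 : Prv ⟨7, 25, 3, 8, false, true⟩
    4295302614 340282366683250333869217809738001072128 := prv_of (.nil) (dm 7 [
  3956278910225172253403587945711138257924774072071730324008924800697453562631816392721858485216874073862804073125843758297826190388733037021628453217057327195799239983989788994,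
  506152885250847884371482148336775410172251540538161161563199760255564271546813778656181909092616516181546801028140178387012822257339841140215132447985842818161249738326637534765,
  249641984049702162595054351665451322077725878619154946592398810569924484174783225991677134788668896256769757023744031469782208568189454907651129872643717422114820497866749,
  959984970161701328179101515285445089323266766654705597522714914386258981373880839777213197716895356073680064071142822632140714700605588583817271456964057255454141652919692597431885541066747196921641048954151841591041858631929937,
  4714997754795105863440779022052499119707779802003433713508134856776131506466896301584157260174502043900551707577185409102542183606197587636402515389617452735867144998420370298675555432150077841,
  41153807534899842787495323379964734051727566012887510488388055772109592640116332466962346991711585825774739207272338476017616185516980483162047657968913275388,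
  1293439657452321988700558430838649423652346808533066690805133349192415])
  (by decide +kernel)

theorem cL1_9 : Prv ⟨7, 25, 3, 8, false, true⟩
    4295036374 340282366683250333832324321590581968896 := prv_of (.cons cL1_8 .nil) (dm 7 [
  526798697163983995103772656451285393094014607409365706831556257062295249775695216141442577033595032772919051490862688506559425192672833914124472183111407201676954895599391407516550704735887575802454822074355267385299978,
  4032657322390835821648289759007021095022229215275324508421546336954986936077695214521414779386395126699861225043106074703875859297692920849306126715165546918640632943741518140889580115630863861591994639026295183441,
  433559151022460954264500299789543931577724683712084890563680431483096816835109465278524200295366807459141665070946018227080211207751517817418653005915205642338988943583353854562014774346419776064418560691616358359401604401409,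
  7274898580736651220919558875630780664225582847751820015711827613025687448281838749764084806884575984946918781074712122804316524592341347074944716886014153640718949464682606329485251674842825355808147248257,
  718012158186980083072623935435351265290039022325654568994355078979706934114128867530825523799606805823512360219727734077377845865739253769036814425360578003705911116219257349826946527,
  8564569355198154255727969461756729414770286246492822085608954223410595016954956897185998359312836840375439965785820516564280166531352924032005432396631524600589396646195644651700335870750519865526524397620861516965822721,
  1876348431719612743544270190688313349420892955959476108820338997123640371071981319864083215598486851080721154124969977071487604622846224452002899538019784425107473379091820039615877718235217,
  208355492291830217430220593520915488540721249278632823853859911385359312528452360749178233296342204764383407533300330986854544686543028794042304637189647265060501282980224018503549681759,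
  2931585161017364328409749096481153756751812726485670201761077406780772898306561309400581241932086360778681174278930769051984381321083835133954148302507142042310103854881633441377724746504631670489115442800991,
  396979718827567775390487025557578240896445062442558351883106830323521062798985475557756144693310563124588914859878165056998957598633951936619870046162343847118559717222747657699227319693296990464870165769805488559,
  2794310617261791730300942222853536446375062055050976389095853298508953414084436711698209599569653245814499928588916259046321304188431275739496987975053779807070396673])
  (by decide +kernel)

theorem cL1_10 : Prv ⟨7, 25, 3, 8, false, true⟩
    18446744073727712726 340282366683250333813877577529757319168 := prv_of (.nil) (dm 7 [
  13405807522424686483536954750078151902840557936857239859864666051978974905379200682618737735535115881951386785030714045430679580177058185708184087674996473700739790001050146,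
  3748796349687777750924964964920922066393208041471937421202575064961932642278781900663508247428750507432589935458626166284894551323557609595432834920154387372025031453683199398899150528237,
  437409605214994118761044342803781357093636374093228040183905361075542771677028656433643962306750535342058234411552023687443644725070432621399805063481901946516978743243828398341464058757405316130,
  1738868204304159287725664221896363244616124047370601791976229743392499640611082237259595207397841633389173691390246416257223382035442088207821189694099136449111723445183820577014704919051353788075711862660161025,
  8071683946762139312643126194393021950344211524152334036193423466657412003121203164638651671197956029373049334433169275504810694241587583519767994166606094152502634567458883048083655233760000860367,
  3417262540742141552813882685073670437669477189610995155078586991022611055382984580004149174963253879943004687568694962194180698497320519811120723791832678765147506629438860546178608457763013183,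
  241283393280198948027233250770069616608697569942272239983040687215715453046028705368388654473598883764142365602456518647735962122857850767207908173290676463])
  (by decide +kernel)

theorem cL1_11 : Prv ⟨7, 25, 3, 8, false, true⟩
    18446744073709624790 340282366683250333813877577529757581312 := prv_of (.nil) (dm 7 [
  4876356668926980388648108074316588449615993619202376870279109528293738458209465156234300362860483769706089616563648357838092779937826893562379721141684657084775501540383555774017664468900995276621760463,
  633548279988753019023508415693860161091515584878502019317475389177445272556474471170734160225562006326045518419652432511274292381791127557479812203497045799478710379875435465735779552659850153504743133,
  271398437030631398922554483025943957298475878454168701395858173972285586758008408533258300142453274820825890697194116443020176861922203681788744340702855028122971912619223080646633144859387865487940915265695,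
  527044706274342323349589701515277801452178226141976515128811797782828639371736276329003523759732944957576561041653917623867599997738034847902761379894790707082295650414814152611719314,
  84374277783411272943448222254558931926396663609379735606743740613755901972031206924860729459393347552052397915710272044100271596821328102085891201803797526778806603759063562870866193890501118739050925635199746199104134332,
  69294485228213956744375899522841803517576865851055643399792632177255769536814147259090990604646544526164459194976250999244513287928668075027456510217338259069932102379318211266325524779777,
  105062353358344081028882415689883168288383511826910609882504896922189])
  (by decide +kernel)

theorem cL1_12 : Prv ⟨7, 25, 3, 8, false, true⟩
    18446744073709891030 340282366683250333813877577529757323264 := prv_of (.nil) (dm 7 [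
  483056136007748783716826740239214244173927262569032893999995297489142387509422031961548200336189823405392632887508939907699240982552140489691276704700875646744679859200640685278560147459608940866,
  2254182968871695603384086271365379833533489288879522407868800827023925526044767708767537918093895629154908325771780374171843433503272134386640519736406360641121757884077647533467109875660,
  419895933617510087565858788352964503161365710512989817205282722641482641262947171986676067230818198113999505786389582796257902830155636618901565586477148676742668818046370842672941,
  12349543260182677694328876608129977887309877922016104014060109307129891533065629570751863173505510863065625035840865895640313181264070023331030680288439273598034839690769626400148285586,
  1229105860943778137620272186209237504881645674996708764270125809383196515332300787640404784277228755160812850819086132925735424999181769411423378141846397801284099427226043010961397531207574299419315538423832703,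
  31874318880146242960913025292173334174485950310514018054425077342191695257118431438999603989879209437354664040849567])
  (by decide +kernel)

theorem cL1_13 : Prv ⟨7, 25, 3, 8, false, true⟩
    69078 340282366683250333813877577516872417280 := prv_of (.cons cL1_1 (.cons cL1_2 (.cons cL1_7 (.cons cL1_9 (.cons cL1_10 (.cons cL1_11 (.cons cL1_12 .nil))))))) (dm 7 [
  250026411718963313563227945376891728737778601761852321402968965772037972365027399492465025614952040213308223797172896494245408797320038296677853760994254886526034963862018,
  12331215539373061144528413457609098174914846301193138689149602674691800129473577940320286352360317687805993812742627080158185657807781388510610467114979750812,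
  386789604574176025616199122651844923644470796900736607996789780217125511944884540133923293290668279013868894292148054069409888296725625554881515271034763469975800095631,
  30268529662443358930859156267774317633060085082386265255671500460417141482490721244521672078462639686970685735200243835616580668646239919750172932770760246033174096018815273595388,
  159855656446600980496705160817417318280400346891239867763997772208754524411859224863428087054772377498351015619254395564120646012882756583375539348349229040500572319,
  1985462736610311491808597833241335239177942194170094452354130531713891125199737924644436550318550920505224050417725966951969751265899284209707173540232582149611194117928876200398683020,
  1205193381441428705990382116893091598601502049091185989497429668401362568724335114170560571400898616235969674656863051950962801757259054356370548780994563351646756442205,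
  133533498544242715117137001423451432958349120181178388089973947467990913675713147730126253409335663333458059990124155519142991867193711113285938681615275715453087,
  1464413448414031])
  (by decide +kernel)

theorem cL1_14 : Prv ⟨7, 25, 3, 8, false, true⟩
    18446744078004526550 340282366683250333813877577516872613888 := prv_of (.nil) (dm 7 [
  13427526380481928376595786059248488478404722290143949675523916153552208839393981351697482738567003547374475026550588756820319484865583809558179156936427059197413389140119271173551259051343746718347259767235692148691234,
  435353829878550205252744807131179385684148964280202550247369055984608263150790402814402629752690685770720507361063316010904335229712496214822171391742990711076863472569853112992151190423303001099122583661159055,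
  2255545240147084322217342872767097830294907490595400462702095596816931324198759623544399898510989896666165167072023380577896921994858715478837949691121165022706636026752699463886999874,
  2347802419680974968786164707155918628920375201759517246769909341486569441982629695836632092272043445710801260004551826549172585833084823387229458659164471186240458482872378264275318276610394531476816969754770,
  9399243251403174885775613497262138067132362919468977922519902458860573830798473891546469801023978078259913441612844530139975861112033843835674129495029208879338697879300675651250964270172598396,
  116314080566733420803809644210456312585619165350011530240405502793709309387694862757016731555691454097135662469839047654775256107878153715365736354250232431733281394957518636982740934907903047997231035658789199,
  895977219621399014901379773983885066954961397414499390151822080965285958492472898182099411815649329901507553696474340217678078857138678701692506806479408127574839100207129196179767309799334193,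
  480201349073504849811754798447410783489129144022649764371308136144915154025908319015347611057537664510513879332510053070041866486755824762793313314990968538966263434853008390724255807810859876380,
  2930315360900431059128917766657596055721879347907239348842054691401739967394352990126766601865311676972640369368070702184468270165150221690060869225175136490417807859168105085450912032149160169184609852,
  4969370970862106620860948991])
  (by decide +kernel)

theorem cL1_15 : Prv ⟨7, 25, 3, 8, false, true⟩
    18446744078004522454 340282366683250333813877577516872617984 := prv_of (.nil) (dm 7 [
  170566937780313896761530426254602172995319439357379396068442812148263726197583529991816275404222195883244569082821483572383933086006091799547310701950489365544434827591768103686880261700865071,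
  548047226034407909107657504790950701232255288433555684020006305426293192951694427132130040169032284577898167207787474117207771527132145195822273017796923174650158405510874824127794491130507388,
  11141830478681950273929828414340559019863752723284904908819876967900173111332712650578672707551438579454290054480572285525479692850433092533655087038100200140034579811049455389491021209661,
  170135768536452842405176382533653282657279154051747018670535500798873070587624828029078639209774454523069081416619222466756204721204617470356552663775436494025093379276085600047015323013166621595615142017,
  4867416312122366583788728143197670495618424601680065034470512689420749825373937818396106328006695853552262868601387570174996766793420631766617909633536684892725233372068292890135869,
  2090427761539056462733781138175305530127742301140359606170741460934822677491603881723327250011315231208685851890650840233235633007137246055642677959297722137053984212222882214421586447,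
  116664004552577350131025778107077521611376478694040957701294090912179102614144077170734032017887306008679980552280443050961986276679110118641147024273758365767943435057572925488236497456616721913889,
  3851252625881629830722377536877922211116693275502423704975153760229095409124528690450942789515605239838895092026094606694700658243960317348060628053512169312894276634281304378144457672516289838446633298,
  32465323915195657108244765518206875474941747920807875256562678810319718463134542667630381705700384839062873898034321024689013364889312117781056754794692125242143984897297132155534466430847227790096970240232804717,
  1380327477865228953864600454256364922764029720604399226591234130212937983])
  (by decide +kernel)

theorem cL1_16 : Prv ⟨7, 25, 3, 8, false, true⟩
    18446744078004853974 340282366683250333813877577516872418048 := prv_of (.nil) (dm 7 [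
  147973852107342111102924149462971933622575348709339667370164696840105174214878851877245786890164624489106446498372913720153904560984941555321158329546538104377307759019600373738214979997983271165071249098418276569410,
  2673871510796348740443824083205925172309524569053807723492559491071992319761304798984210998513443463303404232076953162685497142819918622567067406619221339800971530762432624827478353508278475100,
  104809982644626917542777194413189301719335024189673146194929252690687889487347210291183808591692945116036161221577340742305368212719304437623876021216123041293632869348349663318655439,
  122430245066689224232290273765141996780082520921910402419151026895243555917214251690125173437527522378710374806186170685382426180973206267767334897963382684867919008003868755932,
  13115356667127020927587794783242214760409904566868942789851767763925321107848458314522147771176394378029062871337760635245344558753104148172423185273307934419671060669514303717177436953239695,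
  191875742528554771425938054454177301483688116620241386011643113281782178655454706385454827609320442049920585368075859940932078586130870523155537])
  (by decide +kernel)

theorem cL1_17 : Prv ⟨7, 25, 3, 8, false, true⟩
    18446744078004587734 340282366683250333813877577516872422144 := prv_of (.nil) (dm 7 [
  36746022585898470484077912199500483747089021903588009379152858179726429753586182708841616262925080359142523684571701504294686287480682117913310853687182825216557137090025113759,
  222701608988981925375080095921032490606054652402226368924456445774129627395552453738121005428808569897478256813065517709109550717792307424313907419905728168325048910279292,
  3903143383184846944955439872306531559920372118919088495103088781548791352598206301396609912278412245907137835840786328523709005233807672947616144379936038036689772687,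
  40018718627224619617084837270609224156738292681999093877839355683445419883564100573550982333491055304171678711038492173533783938563079764545471649521567089150391062375844730511007907752659933704145109105,
  17388581401161741795838024791067086956572452752649207740855874199949156746204147392053869172126729961361988161204708528344649255603105311286991821452536126917420255036042032003697166401,
  225221222550725669930052867500677267760680682212616402019576381019505260065182668510908930372551050231329363869557933652574746411619216847602398141033301598831371998061276593379337167727,
  40491922394267545074277211368142079864968228466745328348318055169126899570922088210443918971510747803883682240251233314352637520161747430278930362156951365227942702440051775562496658405645050242,
  3927707931184485070293157478621442346283772674214135732236439933])
  (by decide +kernel)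

theorem cL1_18 : Prv ⟨7, 25, 3, 8, false, true⟩
    18446744078004854214 340282366683250333813877577516872417328 := prv_of (.nil) (dm 7 [
  65665618873844843497728895370946368506293939828963134331568635904980385051653792819546860403035589231514792250472195856047859843316981361159425751556960416041616785243298861378,
  90170268802254575577369661050423617669296224904670759170784322536622043753906063323503583266906540665103605993819195969260673686264233057832198880683726637831439156686846144579431286899613,
  199330248955135665835520215642724328461406346687018580364997427669774325836002583785613408276075635803235672483606580764972524491820745519243048345444201804413525001965257363124534483115923990018,
  18869803222757630290262683984476923092238413951029766811785656109673666607539408958604229746806508637816504553597096477826352189900753039246715419578715201567,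
  34902124197228188743630851674198052708285760663763542115908762837021895277570634661429020911035770027405429501253186913657225821894956532991031183238619519895157619854402095,
  77901406734078392815089315610459709696792713785095957989465740816346789373666197110589334902046162865132165096348156679675782560524271434678357427254947200996600670511147381829184372280807399448525258764,
  62509003241122243819079705582103834106663999537485656287851573952220995663])
  (by decide +kernel)

theorem cL1_19 : Prv ⟨7, 25, 3, 8, false, true⟩
    18446744078004587974 340282366683250333813877577516872421424 := prv_of (.nil) (dm 7 [
  92470429521423810627664731963370749075673139808077203783130390099918776983472501552975262033865273078280067570640881309660710166041080458171993356405353916582294953677407,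
  31499023139857418574827618370935919179594800059202512510133474512752119709802244634088691594179258821805894382236515696179565324085926221306381998621979847004280664041649879892013,
  13648922167164737573863722381462672346021650398906316226465745001482021941148935258451917972459328707884466249922135666995697053538359377071869192067745656176943,
  77682297899908406992469338896901393837414467095079706226353084490578267650142112787389132926480365799734766180747704310732682386846378242807472079083257877460329253519815625587913140844,
  373610038107673783161940892255462438408102781657017215684881943862058089476553833380236394971574887027428922669619836689731409248143621438374161918355440454123000860,
  232145412471124525238469848462142914584577660553699535863623264060973146066662239835755244028440862292136327752412404813422078190702978453465812756293627390510048532814658391044367343,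
  50288111094543290660635785653549436323281134021090372762153840733176863280959018023608112924577360599343468775096573100670093533146923413956163961206278473381822360439654940377383089,
  8539033153863343955814062395026634565391])
  (by decide +kernel)

theorem cL1_20 : Prv ⟨7, 25, 3, 8, false, true⟩
    3270 340282366683250333813877577516872417280 := prv_of (.cons cL1_13 (.cons cL1_14 (.cons cL1_15 (.cons cL1_16 (.cons cL1_17 (.cons cL1_18 (.cons cL1_19 .nil))))))) (dm 7 [
  151753957036995098721461594795974663355484817544434969473002766870886286405793127222893941419900739930643082168015707993566241207706899056015307991165533384449459259814971764165816947014464641536393205780546,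
  37952807279388231616075797680008696453665001983224926108474918019192221013606662489284699323648167107010345444273816362149060075064892210764545139034749388974926001052,
  1057367531686241897579707491355677856158208697160697718685880000492454073232269287641825148674705498881931634135276110770499788739601774240232891217841222199407874404895044512602977290552568914141,
  1257319031669506462695829864937527838030748897830189338064027931885269232322322157355010835310455331552558055671808415750915407112441582082854978390325810593841071213797270926719026303,
  87699314534074239478200294860065426325892779279328962723552758069498049408044929893774055408244122032678740213897304002392561285653039748965183131407417885415072432156355366891956223,
  9890601508642117725412662204484168634335347101185298662217777367187373147484065278805217669097972604272117159053868131041607605737468122879064368426430123576772540,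
  129270697466033327088814118606794077048062922773129239886585333587360889974684302487222301505232998395228839976090138134320043616280637270560836298415553125415019133449356174319,
  1544472255577281871])
  (by decide +kernel)

theorem cL1_21 : Prv ⟨7, 25, 3, 8, false, true⟩
    69074 340282366683250333813877577516872417292 := prv_of (.nil) (dm 7 [
  15370436544499290673692569592073621979031233139919289507652745825858001515889567607318530360902498742913400351695242132433463210893908703603234848703261115867927748284930,
  14615131382450678136596086617187943548331468699930418499907192258979027962816200525118087445065040187882881315910626152671639242613661594086723242859797263794368085706125640814263965,
  22905455321362219219090492462229373507054539316498480317068642437203116442928674343422108997686053625201625164075088341429020236261128712307228927644637561112922437813785261333436474026359900,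
  8761148600148056678124653812085875850427006927533198750364242173624310198949628778155485945289836924704951412900937427171750260602943079079129832977920271939035940913759932791883807242662212857264856172,
  63749969385632297087255159950652543214843981819004036645478867356668575670513170258568588071890641532809196014502198179332806894696794494859065512412011531133802041755981812436379643141293,
  544465527024287321629617005952297525422403343228764733679791])
  (by decide +kernel)

theorem cL1 : Prv ⟨7, 25, 3, 8, false, true⟩
    3266 340282366683250333813877577516872417280 := prv_of (.cons cL1_20 (.cons cL1_21 .nil)) (dm 7 [
  487744865532764595364088351406634368994662434])
  (by decide +kernel)

theorem cL2_0 : Prv ⟨7, 25, 3, 8, false, true⟩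
    18446744078054917590 340282366683250334404173388013017025064 := prv_of (.nil) (dm 7 [
  21402182362847658361495563769863947004531269458708205546123742128538528206134561090405732121166009765403000094119788825667110359657883196058447437455522128450598457080037686337730,
  136809372514043748264489252394245258670460676668873900393520638142520587040759990085981991148137813190581888188308970498572482702919825734327324653311480170251540183976146,
  100079943153222337076117355654512737230587640556492912563052568449240553238748543247589740288415745221552119208500563593975959736952343081325649009660624181655148,
  8322864925269279753633382653250435481106222293639757302771141167545408592856541080065998472755182951549626641928978744708159920948775049771225293444639833781766524993,
  287101391226443818752054358995039565921059491854799790656386412692439120276256899515156079262172971491247635037682565997269746234522102112514457273929642183597196228271612780,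
  6944716351141673574047297867868225268117863370268449425658937769745873784426039941504967162931129734366146439204169632484982962382797885311696467927486989])
  (by decide +kernel)

theorem cL2_1 : Prv ⟨7, 25, 3, 8, false, true⟩
    18446744078054918614 340282366683250333813877577654311372328 := prv_of (.nil) (dm 7 [
  140710225406766023629166743500316276587906660901314277995669455009834054826443803875165959901008670019427330842159576885194145504533505497412207643687464491222495891235722476256030778450,
  1203363778410421438990516329956369751229094653202836932125638237777575741558115985580186433955292294003602803681170170420943728711763468227834219978999961473279344882958571656965007,
  1150516565262045364590814951981926165692369318560389747860589681930215165202474941794878824880150465342019317650797082117913133762159565398241624450415,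
  3799522364205998971853908381528840709646741614866731241872983385572295611637490539984010492046404674186706675416165971124290640622812750898229089708201259392163113071,
  247146134363159203788159268819562338883825908680716202335540156948699305187056339418021765934307205197907433520469319392906464716854687192560514166978141072118213641478645524717869,
  13853452804809896971333653895483236129377629549668880759005100175478992533683845056480947096961594190229215868848639928200484831757005703344332])
  (by decide +kernel)

theorem cL2_2 : Prv ⟨7, 25, 3, 8, false, true⟩
    18446744078054916566 340282366683250333813877577516872417832 := prv_of (.cons cL2_0 (.cons cL2_1 .nil)) (dm 7 [
  134839224710729028824031467680523000685992020767407467815964505823098166515603407159847711592587352741047481633649076451603103259359153814911526271277289206957917113520290,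
  1803332172116118832895951715701258556555435208967657643793500951502493853279954341778655709315296983232389783611717185854597643289893726926755972419857977817973048512596539871810,
  55571133508042142819113738084627843904372645983590201271007006700231979066303193903819215270913714471426659543199303707512245876418458092302103789756,
  7326106354077508933570006142819434492711665174648675407935591342295373346750247032645913997319887058778777169605338937752445593608693572675970617608875939006460028580678279404,
  4121261485156502214006329061948797885582495829219848603084730514804493052854124364434714135765179468473494498750081312632403695592384638842302910578262731406625788578771279,
  804932559324118010628596507999518119378329930454645656354749846085402945161694310972074282311596463072324539256984516300677893967730610661111100464186911973637453711376290065228862681708460,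
  3471673025410039350107843281576328738708299906714848687391374780632900681590904043029177240271605688415777310471282552748195259184051893841405399139038154081241000703,
  240549214117453007243154147780581713410726439348076686862877814697547819173897978672525482301535705006024171891200506827895987676350717502029628247517899222343082332751985,
  2188059329692918584721506377096636588641170367315874611617978726915299249529734789540602555327697382730848621863199029401555158684])
  (by decide +kernel)

theorem cL2_3 : Prv ⟨7, 25, 3, 8, false, true⟩
    18446744078054916566 340282366683250333813877577516872417280 := prv_of (.cons cL2_2 .nil) (dm 7 [
  760578329308296953439868854095070918628358517728700175260455012494995729952298476680733480019934766259573522761150727760303493491441624499746106898360453467041772615602470910665993621554,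
  279193736890052979510897176657206392942427260880117184897874748348590882815196944738197638295299370163255925901398922639583669032690500400967514897620181654657255735011839,
  73991352840997931638943557434178808170671678835390965528388162461406237995790802011893475568319181894985938866490905854388889651373317038633517799809478503264940818276893073,
  413712024029374342911457313707545585860017643993633419383670191226498266889389602514114491275545594022230074812279541940793464988212216505608686265156039974448972076,
  98962572026171658966042832572772881978639940042098231270284887090899227497383229054123572654500760025914091343841293424878936790688705242800672135076608477577027997,
  996668524395989373552104900074902076015436890328182921664905984510595177005454108852329797275972834288094759935820656766428361512233536754602831554225922912959906563442075695,
  6546704970593686233430075214440998353105956041529841614136793597934044088562728906426871749963866876485745])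
  (by decide +kernel)

theorem cL2_4 : Prv ⟨7, 25, 3, 8, false, true⟩
    4345365974 340282366683250333869217809738001072128 := prv_of (.nil) (dm 7 [
  25573762677873815362845113203888423671176047072298331906327243822814976946613827768709545265844044615261320633915228687564861244074955224525271671783252264471778429307367597805762,
  465725715988777728922176991968453290209234474922641922786734049094972494393397344760298913653765303506195617067197599041898235663673589184584022796684090535560284167080329780736951139528048050253,
  4263438297805651597379275700399141608623833196871522390505792739386639685052637813838308459021122541684453028461882979721651163629550781968685271458168713401887095661317798289915505525686112553861505,
  732921069748278693000679642598508288286187418090922571800226235513677867773926827190379395410348314447873390254171995260613377364715858268196832546753593983929472480988700288962204361064246782299365792669887,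
  14788020768049204359142091103478140106821261844144685041850465589391862267273741256486139601786149699306320564330424632758387629217076076722350728379405027155283631968763660132404093618740097774001010071791955792437361,
  1717715729832477517899124732767670022672459757540774614962273837875416650804115721250899543874772455406807129228989969138095539565006242650510953071327168672018905347805664712573312740404617487311295,
  597206561729624115266156097131993121725868936418867325301220455527807183843305443177686518544786633953245365170820950672813296822191752372332084330309206023626838685,
  7677140785923527152181405993704716226555380258623848498851876120866078516786265369909088826577461645418697152323283307603190958414625875293122195421723696639151674826347200399716445596329736322100035681,
  2139701759947422042440599351476650152123279055])
  (by decide +kernel)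

theorem cL2_5 : Prv ⟨7, 25, 3, 8, false, true⟩
    4345364950 340282366683250333869217809738001073152 := prv_of (.nil) (dm 7 [
  5928381042374134917947988382332330926136727249487871551899044462454615077095924380975901782631881420926348717387942614144991217320581216163568979949189040484307579664372095631,
  524924521170132657374379817503853334333457086011124532845485527278602235152783423225285882412622162257569855512972687992705431222174648035520548006825474022413405619353354711324424054040181424263342735510544417,
  1263389096235106715459949745891523743689801325931090941681534678964124190522291234405892788660378624527609076604929499559222520990617038115541251863436769403735340027620693735478404938539766579038846024123887,
  386701704102292529093731111192264519802976852401265600014810147000096392554711964380426545400827037108100658426952545994129038050944761901856878518041256526627859797202981243056240713919,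
  90950276370403653276255379031780361690975804011322253889881762348004152925027626854178059813458002590807578514474243075930115893646339594951520841460232363008340706214359060290774297702856702357633274103446384733884463,
  137457964333518160664648231652730433278133626499360267538962894899441991994131236971025618628878201544026345300856347850621740101409620060117344867324489059988856599815436377202784080674273471196360760003148554887250,
  297277739608040959])
  (by decide +kernel)

theorem cL2_6 : Prv ⟨7, 25, 3, 8, false, true⟩
    18446744073759949270 340282366683250333813877577529757319168 := prv_of (.nil) (dm 7 [
  444072243272404819964942319916003221034155208380370933192812929316184697223008475277053208770317049653739727582236999910953020768171919609800155460682098446342700149629911980271079586,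
  36936184636667328498420565243576205633767850538775309678812760677393066331873528609518398595671265641718190645584184197163859064655399513650683004918541519675527268474425128472778174010739788228928502015594532,
  1057454708209928398506910394459870914459175634883748821588671342659423589610995656631899979319740655047916506781447846918096726783635301748631315986061204435233721463043236012269462695811801293007,
  42560601734836149565312499491646434602637947478415102247823660921997105629863950851144954533745689138133127800948973226524401359430217699780820119500631270381432275034272010050366367649386780498708736095846621,
  88725040635784132487347839961953765473794075695079413622486366790897572350640973997904584357479237826114060465113699900806689880115265165245974690618007679,
  207785823829714513529328644933253101990934542514602642142350903967886195081912557204595436674550825897699916576817119489567204263327193333517225594518132348624493672812,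
  6471849435589813037579980104583528508036607252238184089107243273619522599103974638334749493532532938779375132433794618682695282838036515247784877727983,
  536021150713013852356783459541889283927146010950636901403788568155004542878382806414492611051428034354012213293662057703800415072666191141823396637307992722349437915344781640977205236544633353519523034344626561871,
  464700830178263644691895764651269662676099242323398363904183171653514412690763985222536538732297350242231925553562831333940148018292297320784250067235966266139564524198970285159430237491063571039,
  22877592675118640274371125470046821299873637207399101600409156683781178201168349918068739153992961019802688380605650927078495848849])
  (by decide +kernel)

theorem cL2_7 : Prv ⟨7, 25, 3, 8, false, true⟩
    18446744078054851030 340282366683250333813877577516872613888 := prv_of (.nil) (dm 7 [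
  6484257504585565223326968665678233840811707347472753322124667687920494336398364404482694881861110399218020033301760041772543558518480867778761840403203605532834,
  2423277117195646978206849734373726157732978610679219197823911257832004223153772436658611299648436318748814220355405088381261577351554322541482849670773514782750360200383,
  145618058172516732214529094267517305893874035225230565992759122504876959289230584816932847484297886260686315094399963878491399869233137320684427272378056458373859523474555855378967320773563860226771329,
  118802481824442138976389765837806997632845004688193404845679906965663420427822066450513159375431107555682203626965847420031739569258993780957737677138759254557789,
  803987610866535702995337109374360852438565816810970572202438566115484982105716037111724488547970678808318500301481748069315025419172664435770503885877605987025080817877393,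
  822077681174429814759624767151450823838881416831535985555449760437569618149489159437194326056639608552960665804715987567417408647047947730328429341542798311677,
  53858898562021420875205186313664777295594076103847681776965436614761197381720727149792986341756672874541842159528089275248301043529884645982270214224726778219686068413,
  33303388672231413577106853674539948008617097448607195846849437204265304947442703814187971968020682415864969374980006558943765503727421952517711040429324590351927877971886255,
  26442033537359])
  (by decide +kernel)

theorem cL2_8 : Prv ⟨7, 25, 3, 8, false, true⟩
    18446744078054916310 340282366683250333813877577516872418048 := prv_of (.nil) (dm 7 [
  4084251133117786721354221156206825238799841435614016544061928916876430877385657184368933734987651968785596402825487663380564791840186944406043020561462462931214351428248362121647657122,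
  351161543149415592436963314181303682355894275991816251511243737900880983783052725092323569846200447144854665744182765481063221987361021037509462511104228292775779275141932659308625775993848614977,
  8486956255624959275415113006819090941734460220715984813993485263681015093721998083396787958335366413468098208898805494918058780189908471555550659565290676522108749325439,
  988799353274498920491356336543724969993610347518768976454924235456086738088084764951397611462460862640534622707535444122845476853518745167807896356937021951477575789806899192679503,
  57041265739734591163527330080412532481769569764503757604734259396835262977802998787079823283675881904851146328919184596155158925642242974902379067263489037403504893967,
  6931927196512469527548245873598137639797993035725642663332192613276346454084487947077025769760359170897224311894167443175314657879399715347816846377308,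
  116221085601045381700042730373296673022883656947190468271429380833394600830068765149086788160864056080859796559615805897946303194959872637995377198538716246779245828041647169010180478514736674849,
  480503015600537557640699990298623132825313579417089835970811144310549375761769712901465928043592802288014617745284104088283625656838841455377842652906816952851225233409354813818296385,
  1653463742937617968449127062140288615523086848669680611663258210463063909671531172244960964641546896486630670217472187087015900759373651873021592240869553392928400507324085932638349,
  51661121550750198264006355475727594627204034405277475219930342821410489514888522868458968020653403166585174752074178389975022196898701572781354866017544539567442793365519,
  4875578164001048955030147206069674524831985296495])
  (by decide +kernel)

theorem cL2_9 : Prv ⟨7, 25, 3, 8, false, true⟩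
    18446744078054916550 340282366683250333813877577516872417328 := prv_of (.nil) (dm 7 [
  856327165847631802262423897414149280761128053672287887547184330785585301934726718203960089494720070873589231368172334648880642801353166938439866121489995826838804830778559184022880522402,
  4779480708638431468472789649927422844687675447925916155216237918834794429438561474818832869569000180469161969373312287660455444636903042337719702688034055418328817028662255,
  27772318507091007458793617982983217447285734479287658482066880611640872733437554160519328608471027589178169569279741499377145514274833136995455355884880621,
  273103237009981578330235983615857924471335623679692687604883448827611156229791239470933825982391139159964074931189442340370208076431990276317345641222445414018848508,
  22811830650001280213236968464544997844312927183561470228857396715459366792189127203588784124747155664359971154052257069364994488840495198991418157823260,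
  750054860154460991734039613757028748046849296641004132001656919351705491270409248793738004552211459236882795900491887973846382474428067389549562317327027468,
  96007025603322019996268024012404290880266923934006518314936683780444332862531047638286962936695311174889237932687533099210168110481878142282896951853920756253,
  23729283516169549606494749])
  (by decide +kernel)

theorem cL2_10 : Prv ⟨7, 25, 3, 8, false, true⟩
    18446744078054916562 340282366683250333813877577516872417292 := prv_of (.nil) (dm 7 [
  5703774282813197172155559046529754194883982365578602222138736066535997423094413575298146938102871422315634331664291719882799370973270075283276231151837837327664294707071069340481299320994,
  831640508088795606398758713625591451999384590352992820694125209594670238589152923172667654141071677795766524362212904456200207002954325379989856653585926577931501127774203011759,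
  48294146066663599291578181150894447915094692026896696769073913880664386768156080050468881883289538938861764569985613666873212329803899979788961341717525047082084164429748481,
  611869231311946615607758708236918991301490629760475856734298589471348890356586127947234888134740999764843896046016050369420035007207150414282052625923416875423032248495,
  453737253196914728530236034188445488535714764473361113428032078729491039433957928527756466631263861895402647197047762244164093459194696425208443594770631397885264966794368002420972,
  15954053971260257715410483944730152190217412344715836151015141069030961717738958478339440846459697345463007127898312958813719737188730245500205753441024296781927449313345597,
  70283990115495657945473106715984382759000532107451245203676992733602895746045500109977874103232651274166002028907826485616619300006232280249463358195087,
  1041871162866324246423102222844298168293278668591108185859420178752234919200968655006098533842950290869212330599203531653910302189])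
  (by decide +kernel)

theorem cL2 : Prv ⟨7, 25, 3, 8, false, true⟩
    50331842 340282366683250333813877577516872417280 := prv_of (.cons cL2_3 (.cons cL2_4 (.cons cL2_5 (.cons cL2_6 (.cons cL2_7 (.cons cL2_8 (.cons cL2_9 (.cons cL2_10 .nil)))))))) (dm 7 [
  259059828885756556112367192233158937661618447618388101780470044407356799910007466518793969102645688899168288849497886763933582621014786926084091891175685344923704643425233976649687145837311415297390302747067230164991256685580322])
  (by decide +kernel)

end Eng

namespace Bin

open Module Submodule

section Basic

variable {V : Type} [AddCommGroup V] [Module (ZMod 2) V]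

theorem add_self (x : V) : x + x = 0 := ZModModule.add_self x

theorem add_self_left (x y : V) : x + (x + y) = y := by rw [← add_assoc, add_self, zero_add]

theorem add_cancel (x y : V) : x + y + y = x := by rw [add_assoc, add_self, add_zero]

theorem add_eq_zero_iff2 {x y : V} : x + y = 0 ↔ x = y := by
  rw [add_eq_zero_iff_eq_neg, ZModModule.neg_eq_self]

theorem eq_add_iff {x y z : V} : x = y + z ↔ x + z = y := by
  constructor
  · rintro rfl; exact add_cancel _ _
  · rintro rfl; rw [add_cancel]

theorem z2 (a : ZMod 2) : a = 0 ∨ a = 1 := by revert a; decide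

/-- A set of vectors has an `AG(3,2)`-minor. -/
def HasAG (S : Finset V) : Prop :=
  ∃ C : Set V, C ⊆ (S : Set V) ∧ ∃ g : (Fin 4 → ZMod 2) →ₗ[ZMod 2] V,
    (∀ x, g x ∈ span (ZMod 2) C → x = 0) ∧
    ∀ x, x 0 = 1 → ∃ w ∈ span (ZMod 2) C, g x + w ∈ S

/-- The first `n` vectors of a sequence are independent. -/
def LI (b : ℕ → V) (n : ℕ) : Prop := LinearIndependent (ZMod 2) (fun i : Fin n => b i)

/-- The span of the first `n` vectors of a sequence. -/
def SP (b : ℕ → V) (n : ℕ) : Submodule (ZMod 2) V := span (ZMod 2) (b '' Set.Iio n)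

theorem SP_range (b : ℕ → V) (n : ℕ) : SP b n = span (ZMod 2) (Set.range fun i : Fin n => b i) := by
  unfold SP; congr 1; ext x; constructor
  · rintro ⟨i, hi, rfl⟩; exact ⟨⟨i, hi⟩, rfl⟩
  · rintro ⟨i, rfl⟩; exact ⟨i, i.2, rfl⟩

theorem LI_zero (b : ℕ → V) : LI b 0 := linearIndependent_empty_type

theorem LI_succ {b : ℕ → V} {n : ℕ} : LI b (n + 1) ↔ LI b n ∧ b n ∉ SP b n := by
  unfold LI
  rw [linearIndependent_finSucc', SP_range]
  rfl

theorem SP_zero (b : ℕ → V) : SP b 0 = ⊥ := by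
  unfold SP; rw [Submodule.span_eq_bot]; rintro x ⟨i, hi, -⟩; simp at hi

theorem mem_SP {b : ℕ → V} {n i : ℕ} (h : i < n) : b i ∈ SP b n := subset_span ⟨i, h, rfl⟩

theorem SP_le {b : ℕ → V} {n : ℕ} {P : Submodule (ZMod 2) V} (h : ∀ i < n, b i ∈ P) : SP b n ≤ P := by
  unfold SP; rw [span_le]; rintro x ⟨i, hi, rfl⟩; exact h i hi

theorem SP_mono {b : ℕ → V} {n m : ℕ} (h : n ≤ m) : SP b n ≤ SP b m :=
  SP_le fun _ hi => mem_SP (hi.trans_le h)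

theorem SP_congr {b b' : ℕ → V} {n : ℕ} (h : ∀ i < n, b i = b' i) : SP b n = SP b' n := by
  apply le_antisymm
  · exact SP_le fun i hi => h i hi ▸ mem_SP hi
  · exact SP_le fun i hi => h i hi ▸ mem_SP hi

theorem LI_congr {b b' : ℕ → V} {n : ℕ} (h : ∀ i < n, b i = b' i) : LI b n ↔ LI b' n := by
  have : (fun i : Fin n => b i) = fun i : Fin n => b' i := funext fun i => h i i.2
  unfold LI; rw [this]

theorem mem_SP_succ {b : ℕ → V} {n : ℕ} {x : V} :
    x ∈ SP b (n + 1) ↔ x ∈ SP b n ∨ x + b n ∈ SP b n := by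
  have : SP b (n + 1) = span (ZMod 2) (insert (b n) (b '' Set.Iio n)) := by
    unfold SP; congr 1
    rw [← Set.image_insert_eq]; congr 1
    ext i; simp only [Set.mem_Iio, Set.mem_insert_iff]; omega
  rw [this, mem_span_insert]
  constructor
  · rintro ⟨a, z, hz, rfl⟩
    rcases z2 a with rfl | rfl
    · left; rw [zero_smul, zero_add]; exact hz
    · right; rw [one_smul, add_comm (b n), add_cancel]; exact hz
  · rintro (h | h)
    · exact ⟨0, x, h, by simp⟩
    · exact ⟨1, _, h, by rw [one_smul, add_comm x, add_self_left]⟩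

theorem LI.finrank_SP {b : ℕ → V} {n : ℕ} (h : LI b n) : finrank (ZMod 2) (SP b n) = n := by
  rw [SP_range, finrank_span_eq_card h, Fintype.card_fin]

theorem LI.SP_eq [Finite V] {b : ℕ → V} {n : ℕ} (h : LI b n) {P : Submodule (ZMod 2) V}
    (hP : finrank (ZMod 2) P = n) (hb : ∀ i < n, b i ∈ P) : SP b n = P :=
  Submodule.eq_of_le_of_finrank_eq (SP_le hb) (by rw [h.finrank_SP, hP])

theorem LI_of_span [Finite V] {b : ℕ → V} {n : ℕ} (hf : finrank (ZMod 2) V = n)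
    (h : SP b n = ⊤) : LI b n := by
  apply linearIndependent_of_top_le_span_of_card_eq_finrank
  · rw [← SP_range, h]
  · rw [Fintype.card_fin, hf]

/-- Extension of independent sequences by elements of a given set. -/
theorem ext_LI [Finite V] (b : ℕ → V) (k n : ℕ) (T : Set V) (hk : LI b k) (hkn : k ≤ n)
    (hn : n ≤ finrank (ZMod 2) (span (ZMod 2) T)) :
    ∃ b' : ℕ → V, (∀ i < k, b' i = b i) ∧ (∀ i, k ≤ i → i < n → b' i ∈ T) ∧ LI b' n := by
  induction n, hkn using Nat.le_induction with
  | base => exact ⟨b, fun _ _ => rfl, fun i h1 h2 => absurd h2 (by omega), hk⟩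
  | succ n hkn ih =>
    obtain ⟨b', h1, h2, h3⟩ := ih (by omega)
    have : ∃ t ∈ T, t ∉ SP b' n := by
      by_contra hcon
      push Not at hcon
      have hle : span (ZMod 2) T ≤ SP b' n := span_le.2 hcon
      have := Submodule.finrank_mono hle
      rw [h3.finrank_SP] at this
      omega
    obtain ⟨t, ht, htn⟩ := this
    have hag : ∀ i < n, Function.update b' n t i = b' i := fun i hi => by
      rw [Function.update_of_ne (by omega)]
    refine ⟨Function.update b' n t, fun i hi => ?_, fun i hi hin => ?_, ?_⟩
    · rw [hag i (by omega), h1 i hi]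
    · by_cases h : i = n
      · subst h; simpa using ht
      · rw [hag i (by omega)]; exact h2 i hi (by omega)
    · rw [LI_succ, LI_congr hag, SP_congr hag]
      exact ⟨h3, by simpa using htn⟩

end Basic

section Quot

variable {V : Type} [AddCommGroup V] [Module (ZMod 2) V]

/-- `tt S e` is twice the number of triangles of `S` through `e`. -/
def tt [DecidableEq V] (S : Finset V) (e : V) : ℕ := (S.filter fun x => x + e ∈ S).card

/-- An admissible configuration. -/
structure Adm (r : ℕ) (S : Finset V) : Prop where
  fr : finrank (ZMod 2) V = r
  sp : span (ZMod 2) (S : Set V) = ⊤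
  nz : (0 : V) ∉ S
  ag : ¬ HasAG S

theorem mem_span_single {e x : V} : x ∈ span (ZMod 2) {e} ↔ x = 0 ∨ x = e := by
  rw [mem_span_singleton]
  constructor
  · rintro ⟨a, rfl⟩; rcases z2 a with rfl | rfl <;> simp
  · rintro (rfl | rfl)
    · exact ⟨0, by simp⟩
    · exact ⟨1, by simp⟩

theorem mk_eq {e x y : V} : (span (ZMod 2) {e}).mkQ x = (span (ZMod 2) {e}).mkQ y ↔ x = y ∨ x = y + e := by
  rw [mkQ_apply, mkQ_apply, Submodule.Quotient.eq, mem_span_single, ZModModule.sub_eq_add,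
    add_eq_zero_iff2]
  apply or_congr_right
  rw [eq_add_iff]; constructor
  · rintro rfl; exact add_self_left _ _
  · rintro rfl; exact add_self_left _ _

theorem hasAG_quot [DecidableEq V] (S : Finset V) (e : V) (he : e ∈ S)
    (S' : Finset (V ⧸ span (ZMod 2) {e}))
    (hS' : ∀ y ∈ S', ∃ x ∈ S, (span (ZMod 2) {e}).mkQ x = y) (h : HasAG S') : HasAG S := by
  obtain ⟨C, hC, g, hg1, hg2⟩ := h
  set π := (span (ZMod 2) {e}).mkQ with hπ
  obtain ⟨g', hg'⟩ := Module.projective_lifting_property π g (mkQ_surjective _)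
  have hg'' : ∀ x, π (g' x) = g x := fun x => by rw [← hg']; rfl
  let C' : Set V := {x | x ∈ S ∧ (x = e ∨ π x ∈ C)}
  have hee : e ∈ C' := ⟨he, Or.inl rfl⟩
  have hmap : ∀ x ∈ span (ZMod 2) C', π x ∈ span (ZMod 2) C := by
    intro x hx
    have : span (ZMod 2) C' ≤ (span (ZMod 2) C).comap π := by
      rw [span_le]
      rintro y ⟨hy, rfl | hy2⟩
      · have : π y = 0 := by rw [hπ, mkQ_apply, Submodule.Quotient.mk_eq_zero]; exact mem_span_singleton_self _
        have h2 : π y ∈ span (ZMod 2) C := by rw [this]; exact zero_mem _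
        exact h2
      · exact subset_span hy2
    exact this hx
  have hlift : ∀ w ∈ span (ZMod 2) C, ∀ v, π v = w → v ∈ span (ZMod 2) C' := by
    intro w hw
    have key : span (ZMod 2) C ≤ (span (ZMod 2) C').map π := by
      rw [span_le]
      intro y hy
      obtain ⟨x, hx, rfl⟩ := hS' y (hC hy)
      exact ⟨x, subset_span ⟨hx, Or.inr hy⟩, rfl⟩
    obtain ⟨x, hx, hxw⟩ := key hw
    rintro v hv
    rw [← hxw] at hv
    rcases mk_eq.1 hv with rfl | rfl
    · exact hx
    · exact add_mem hx (subset_span hee)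
  refine ⟨C', fun x hx => hx.1, g', fun x hx => hg1 x ?_, fun x hx => ?_⟩
  · rw [← hg'']; exact hmap _ hx
  · obtain ⟨w, hw, hws⟩ := hg2 x hx
    obtain ⟨v, hv⟩ := mkQ_surjective (span (ZMod 2) {e}) w
    obtain ⟨s, hs, hss⟩ := hS' _ hws
    rw [← hg'', ← hv, ← map_add] at hss
    have hvC := hlift w hw v hv
    rcases mk_eq.1 hss with rfl | h
    · exact ⟨v, hvC, hs⟩
    · refine ⟨v + e, add_mem hvC (subset_span hee), ?_⟩
      rw [← add_assoc, ← h]; exact hs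

/-- The simplification of the contraction of `e`. -/
noncomputable def quo [DecidableEq V] (S : Finset V) (e : V) :
    Finset (V ⧸ span (ZMod 2) {e}) := by
  classical exact (S.erase e).image (span (ZMod 2) {e}).mkQ

theorem mem_quo [DecidableEq V] {S : Finset V} {e : V} {y : V ⧸ span (ZMod 2) {e}} :
    y ∈ quo S e ↔ ∃ x ∈ S, x ≠ e ∧ (span (ZMod 2) {e}).mkQ x = y := by
  unfold quo
  simp only [Finset.mem_image, Finset.mem_erase]
  constructor
  · rintro ⟨x, ⟨h1, h2⟩, h3⟩; exact ⟨x, h2, h1, h3⟩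
  · rintro ⟨x, h1, h2, h3⟩; exact ⟨x, ⟨h2, h1⟩, h3⟩

theorem Adm.quo [Finite V] [DecidableEq V] {r : ℕ} {S : Finset V} (h : Adm (r + 1) S) {e : V}
    (he : e ∈ S) : Adm r (quo S e) where
  fr := by
    have h1 := Submodule.finrank_quotient_add_finrank (span (ZMod 2) {e})
    rw [finrank_span_singleton (fun h0 => h.nz (h0 ▸ he)), h.fr] at h1
    omega
  sp := by
    rw [eq_top_iff]
    intro y _
    obtain ⟨v, rfl⟩ := mkQ_surjective (span (ZMod 2) {e}) y
    have hv : v ∈ span (ZMod 2) (S : Set V) := by rw [h.sp]; trivial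
    have : span (ZMod 2) (S : Set V) ≤ (span (ZMod 2) (Bin.quo S e : Set _)).comap (span (ZMod 2) {e}).mkQ := by
      rw [span_le]
      intro x hx
      by_cases hxe : x = e
      · subst hxe
        have : (span (ZMod 2) {x}).mkQ x = 0 := by
          rw [mkQ_apply, Submodule.Quotient.mk_eq_zero]; exact mem_span_singleton_self _
        have h2 : (span (ZMod 2) {x}).mkQ x ∈ span (ZMod 2) (Bin.quo S x : Set _) := by
          rw [this]; exact zero_mem _
        exact h2
      · exact subset_span (mem_quo.2 ⟨x, hx, hxe, rfl⟩)
    exact this hv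
  nz := by
    intro h0
    obtain ⟨x, hx, hxe, h1⟩ := mem_quo.1 h0
    rw [mkQ_apply, Submodule.Quotient.mk_eq_zero, mem_span_single] at h1
    rcases h1 with rfl | rfl
    · exact h.nz hx
    · exact hxe rfl
  ag := fun hh => h.ag (hasAG_quot S e he _ (fun y hy => by
    obtain ⟨x, hx, -, hxy⟩ := mem_quo.1 hy
    exact ⟨x, hx, hxy⟩) hh)

theorem card_quo [DecidableEq V] {S : Finset V} (h0 : (0 : V) ∉ S) {e : V} (he : e ∈ S) :
    2 * S.card ≤ 2 * (quo S e).card + tt S e + 2 := by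
  classical
  have h1 : ∑ x ∈ S.erase e, (if x + e ∈ S then 1 else 2) ≤ ∑ y ∈ quo S e, 2 := by
    rw [← Finset.sum_fiberwise_of_maps_to (s := S.erase e) (t := quo S e)
      (g := (span (ZMod 2) {e}).mkQ)]
    · apply Finset.sum_le_sum
      intro y hy
      obtain ⟨x, hx, hxe, rfl⟩ := mem_quo.1 hy
      have hee : e ≠ 0 := fun h => h0 (h ▸ he)
      have hne : x ≠ x + e := fun h => hee (by simpa using h)
      by_cases hxs : x + e ∈ S
      · have hsub : (S.erase e).filter (fun i => (span (ZMod 2) {e}).mkQ i = (span (ZMod 2) {e}).mkQ x) ⊆ {x, x + e} := by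
          intro z hz
          rw [Finset.mem_filter] at hz
          simpa using mk_eq.1 hz.2
        refine (Finset.sum_le_sum_of_subset hsub).trans ?_
        rw [Finset.sum_pair hne, add_cancel, if_pos hxs, if_pos hx]
      · have hsub : (S.erase e).filter (fun i => (span (ZMod 2) {e}).mkQ i = (span (ZMod 2) {e}).mkQ x) ⊆ {x} := by
          intro z hz
          rw [Finset.mem_filter, Finset.mem_erase] at hz
          rcases mk_eq.1 hz.2 with rfl | rfl
          · simp
          · exact absurd hz.1.2 hxs
        refine (Finset.sum_le_sum_of_subset hsub).trans ?_
        rw [Finset.sum_singleton, if_neg hxs]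
    · intro x hx
      rw [Finset.mem_erase] at hx
      exact mem_quo.2 ⟨x, hx.2, hx.1, rfl⟩
  have h2 : ∑ x ∈ S.erase e, ((if x + e ∈ S then 1 else 2) + if x + e ∈ S then 1 else 0) = 2 * (S.card - 1) := by
    rw [← Finset.card_erase_of_mem he, mul_comm, ← smul_eq_mul, ← Finset.sum_const]
    apply Finset.sum_congr rfl
    intro x _; split_ifs <;> rfl
  have h3 : ∑ x ∈ S.erase e, (if x + e ∈ S then 1 else 0) ≤ tt S e := by
    rw [Finset.sum_boole]
    exact Finset.card_le_card (Finset.filter_subset_filter _ (Finset.erase_subset _ _))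
  rw [Finset.sum_add_distrib] at h2
  simp only [Finset.sum_const, smul_eq_mul] at h1
  have : 0 < S.card := Finset.card_pos.2 ⟨e, he⟩
  omega

end Quot

end Bin

set_option linter.unusedSectionVars false

namespace Bin

open Module Submodule

section AG

variable {V : Type} [AddCommGroup V] [Module (ZMod 2) V]

theorem hasAG_of_four {S : Finset V} {C : Set V} (hC : C ⊆ (S : Set V)) (u a b c : V)
    (h : ∀ δ α β γ : ZMod 2, δ • u + α • a + β • b + γ • c ∈ span (ZMod 2) C →
      δ = 0 ∧ α = 0 ∧ β = 0 ∧ γ = 0)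
    (h2 : ∀ α β γ : ZMod 2, ∃ w ∈ span (ZMod 2) C, u + α • a + β • b + γ • c + w ∈ S) :
    HasAG S := by
  refine ⟨C, hC, (LinearMap.proj 0).smulRight u + (LinearMap.proj 1).smulRight a +
    (LinearMap.proj 2).smulRight b + (LinearMap.proj 3).smulRight c, fun x hx => ?_, fun x hx => ?_⟩
  · obtain ⟨h0, h1, h2, h3⟩ := h (x 0) (x 1) (x 2) (x 3) hx
    funext i; fin_cases i <;> assumption
  · obtain ⟨w, hw, hs⟩ := h2 (x 1) (x 2) (x 3)
    refine ⟨w, hw, ?_⟩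
    have : ((LinearMap.proj 0).smulRight u + (LinearMap.proj 1).smulRight a +
      (LinearMap.proj 2).smulRight b + (LinearMap.proj 3).smulRight c : (Fin 4 → ZMod 2) →ₗ[ZMod 2] V) x
      = x 0 • u + x 1 • a + x 2 • b + x 3 • c := rfl
    rw [this, hx, one_smul]; exact hs

theorem smul_mem_or {P : Submodule (ZMod 2) V} {a : ZMod 2} {x z : V} (hx : x ∉ P)
    (hz : z ∈ P) (h : z + a • x ∈ P) : a = 0 := by
  rcases z2 a with rfl | rfl
  · rfl
  · rw [one_smul] at h
    exact absurd ((Submodule.add_mem_iff_right P hz).1 h) hx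

theorem hasAG_hyper [Finite V] {S : Finset V} {C : Set V} (hC : C ⊆ (S : Set V))
    (hd : finrank (ZMod 2) (span (ZMod 2) C) + 4 ≤ finrank (ZMod 2) V)
    (f : V →ₗ[ZMod 2] ZMod 2) (u : V) (hu : f u = 1) (hfC : ∀ x ∈ C, f x = 0)
    (h : ∀ x, f x = 1 → ∃ w ∈ span (ZMod 2) C, x + w ∈ S) : HasAG S := by
  set k := finrank (ZMod 2) (span (ZMod 2) C) with hk
  obtain ⟨b0, -, h1, h2⟩ := ext_LI (fun _ => (0 : V)) 0 k (span (ZMod 2) C : Set V) (LI_zero _)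
    (Nat.zero_le _) (by rw [span_eq])
  have hker : finrank (ZMod 2) f.ker + 1 = finrank (ZMod 2) V := by
    rw [← LinearMap.finrank_range_add_finrank_ker f, add_comm]
    congr 1
    have : f.range = ⊤ := by
      rw [LinearMap.range_eq_top]
      intro a; rcases z2 a with rfl | rfl
      · exact ⟨0, map_zero f⟩
      · exact ⟨u, hu⟩
    rw [this, finrank_top, finrank_self]
  obtain ⟨b, hb1, hb2, hb3⟩ := ext_LI b0 k (k + 3) (f.ker : Set V) h2 (by omega)
    (by rw [span_eq]; omega)
  have hC2 : SP b k = span (ZMod 2) C := by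
    rw [SP_congr hb1]
    exact h2.SP_eq hk.symm (fun i hi => h1 i (Nat.zero_le _) hi)
  obtain ⟨h3, h4⟩ := LI_succ.1 hb3
  obtain ⟨h5, h6⟩ := LI_succ.1 h3
  obtain ⟨h7, h8⟩ := LI_succ.1 h5
  have f1 : f (b k) = 0 := hb2 k le_rfl (by omega)
  have f2 : f (b (k + 1)) = 0 := hb2 (k + 1) (by omega) (by omega)
  have f3 : f (b (k + 2)) = 0 := hb2 (k + 2) (by omega) (by omega)
  have hfs : ∀ x ∈ span (ZMod 2) C, f x = 0 := by
    intro x hx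
    have : span (ZMod 2) C ≤ f.ker := span_le.2 hfC
    exact this hx
  refine hasAG_of_four hC u (b k) (b (k + 1)) (b (k + 2)) ?_ ?_
  · intro δ α β γ hm
    have h0 : δ = 0 := by
      have := hfs _ hm
      simpa [f1, f2, f3, hu] using this
    subst h0
    rw [zero_smul, zero_add, ← hC2] at hm
    have hγ : γ = 0 := by
      refine smul_mem_or (z := α • b k + β • b (k + 1)) h4 ?_ (SP_mono (by omega) hm)
      exact add_mem (smul_mem _ _ (mem_SP (by omega))) (smul_mem _ _ (mem_SP (by omega)))
    subst hγ
    rw [zero_smul, add_zero] at hm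
    have hβ : β = 0 := by
      refine smul_mem_or (z := α • b k) h6 ?_ (SP_mono (by omega) hm)
      exact smul_mem _ _ (mem_SP (by omega))
    subst hβ
    rw [zero_smul, add_zero] at hm
    refine ⟨rfl, ?_, rfl, rfl⟩
    refine smul_mem_or (z := 0) h8 (zero_mem _) ?_
    rw [zero_add]; exact hm
  · intro α β γ
    apply h
    simp [f1, f2, f3, hu]

end AG

section Coding

variable {V : Type} [AddCommGroup V] [Module (ZMod 2) V]

/-- The vector with a given code. -/
noncomputable def vec (b : ℕ → V) (x : ℕ) : V :=
  ∑ i ∈ Finset.range 7, if x.testBit i then b i else 0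

theorem vec_xor (b : ℕ → V) (x y : ℕ) : vec b (x ^^^ y) = vec b x + vec b y := by
  unfold vec
  rw [← Finset.sum_add_distrib]
  apply Finset.sum_congr rfl
  intro i _
  rw [Nat.testBit_xor]
  cases x.testBit i <;> cases y.testBit i <;> simp [add_self]

theorem vec_zero (b : ℕ → V) : vec b 0 = 0 := by simp [vec]

theorem vec_pow (b : ℕ → V) {i : ℕ} (hi : i < 7) : vec b (2 ^ i) = b i := by
  unfold vec
  rw [Finset.sum_eq_single i]
  · simp
  · intro j _ hj
    rw [Nat.testBit_two_pow_of_ne (Ne.symm hj)]; simp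
  · intro h; simp at h; omega

theorem vec_congr {b b' : ℕ → V} {x n : ℕ} (hx : x < 2 ^ n) (h : ∀ i < n, b i = b' i) :
    vec b x = vec b' x := by
  unfold vec
  apply Finset.sum_congr rfl
  intro i _
  by_cases hi : i < n
  · rw [h i hi]
  · rw [Nat.testBit_lt_two_pow (hx.trans_le (Nat.pow_le_pow_right (by norm_num) (by omega)))]
    simp

theorem vec_mem {b : ℕ → V} {x n : ℕ} (hx : x < 2 ^ n) : vec b x ∈ SP b n := by
  unfold vec
  apply sum_mem
  intro i _
  by_cases hi : i < n
  · split_ifs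
    · exact mem_SP hi
    · exact zero_mem _
  · rw [Nat.testBit_lt_two_pow (hx.trans_le (Nat.pow_le_pow_right (by norm_num) (by omega)))]
    simp

theorem exists_vec {b : ℕ → V} {n : ℕ} (hn : n ≤ 7) {v : V} (hv : v ∈ SP b n) :
    ∃ x < 2 ^ n, vec b x = v := by
  induction n generalizing v with
  | zero =>
    rw [SP_zero, mem_bot] at hv
    exact ⟨0, by norm_num, by rw [hv, vec_zero]⟩
  | succ n ih =>
    rcases mem_SP_succ.1 hv with h | h
    · obtain ⟨x, hx, rfl⟩ := ih (by omega) h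
      exact ⟨x, hx.trans (Nat.pow_lt_pow_right (by norm_num) (by omega)), rfl⟩
    · obtain ⟨x, hx, h2⟩ := ih (by omega) h
      refine ⟨x ^^^ 2 ^ n, ?_, ?_⟩
      · exact Nat.xor_lt_two_pow (hx.trans (Nat.pow_lt_pow_right (by norm_num) (by omega)))
          (Nat.pow_lt_pow_right (by norm_num) (by omega))
      · rw [vec_xor, h2, vec_pow _ (by omega), add_cancel]

theorem vec_eq_zero {b : ℕ → V} {n : ℕ} (hn : n ≤ 7) (h : LI b n) {x : ℕ} (hx : x < 2 ^ n)
    (h0 : vec b x = 0) : x = 0 := by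
  induction n generalizing x with
  | zero => simpa using hx
  | succ n ih =>
    obtain ⟨h1, h2⟩ := LI_succ.1 h
    by_cases hlt : x < 2 ^ n
    · exact ih (by omega) h1 hlt h0
    · exfalso
      apply h2
      have hbit : x.testBit n = true := by
        rw [Nat.testBit_eq_decide_div_mod_eq]
        have : x / 2 ^ n = 1 := by
          apply Nat.div_eq_of_lt_le <;> rw [pow_succ] at * <;> omega
        simp [this]
      have hy : x ^^^ 2 ^ n < 2 ^ n := by
        apply Nat.lt_pow_two_of_testBit
        intro i hi
        rw [Nat.testBit_xor]
        rcases Nat.lt_or_eq_of_le hi with h' | h'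
        · rw [Nat.testBit_lt_two_pow (hx.trans_le (Nat.pow_le_pow_right (by norm_num) h')),
            Nat.testBit_two_pow_of_ne (by omega)]; rfl
        · subst h'; rw [hbit, Nat.testBit_two_pow_self]; rfl
      have hm := vec_mem (b := b) hy
      rw [vec_xor, h0, zero_add, vec_pow _ (by omega)] at hm
      exact hm

theorem vec_inj {b : ℕ → V} {n : ℕ} (hn : n ≤ 7) (h : LI b n) {x y : ℕ} (hx : x < 2 ^ n)
    (hy : y < 2 ^ n) (he : vec b x = vec b y) : x = y := by
  have : x ^^^ y = 0 := by
    apply vec_eq_zero hn h (Nat.xor_lt_two_pow hx hy)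
    rw [vec_xor, he, add_self]
  exact Nat.xor_eq_zero_iff.1 this

/-- The codes of the elements of `S`. -/
noncomputable def cod [DecidableEq V] (b : ℕ → V) (r : ℕ) (S : Finset V) : Finset ℕ :=
  (Finset.range (2 ^ r)).filter fun x => vec b x ∈ S

theorem mem_cod [DecidableEq V] {b : ℕ → V} {r : ℕ} {S : Finset V} {x : ℕ} :
    x ∈ cod b r S ↔ x < 2 ^ r ∧ vec b x ∈ S := by
  unfold cod; rw [Finset.mem_filter, Finset.mem_range]

variable [DecidableEq V] {b : ℕ → V} {r : ℕ} {S : Finset V}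

theorem card_cod (hr : r ≤ 7) (hb : LI b r) (hs : SP b r = ⊤) (p : ℕ → Prop) [DecidablePred p]
    (q : V → Prop) [DecidablePred q] (hpq : ∀ x < 2 ^ r, p x ↔ q (vec b x)) :
    ((cod b r S).filter p).card = (S.filter q).card := by
  apply Finset.card_bij (fun x _ => vec b x)
  · intro x hx
    rw [Finset.mem_filter, mem_cod] at hx
    rw [Finset.mem_filter]
    exact ⟨hx.1.2, (hpq x hx.1.1).1 hx.2⟩
  · intro x hx y hy h
    rw [Finset.mem_filter, mem_cod] at hx hy
    exact vec_inj hr hb hx.1.1 hy.1.1 h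
  · intro v hv
    rw [Finset.mem_filter] at hv
    obtain ⟨x, hx, rfl⟩ := exists_vec (b := b) hr (v := v) (by rw [hs]; trivial)
    refine ⟨x, ?_, rfl⟩
    rw [Finset.mem_filter, mem_cod]
    exact ⟨⟨hx, hv.1⟩, (hpq x hx).2 hv.2⟩

theorem exists_func (hr : r ≤ 7) (hb : LI b r) (hs : SP b r = ⊤) (l : ℕ) :
    ∃ f : V →ₗ[ZMod 2] ZMod 2, ∀ x < 2 ^ r, f (vec b x) = if Eng.kb l x then 1 else 0 := by
  have hex : ∀ v : V, ∃ x < 2 ^ r, vec b x = v := fun v => exists_vec hr (by rw [hs]; trivial)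
  choose c hc1 hc2 using hex
  have h7 : 2 ^ r ≤ 128 := Nat.pow_le_pow_right (j := 7) (n := 2) (by norm_num) hr
  let f : V →+ ZMod 2 := AddMonoidHom.mk' (fun v => if Eng.kb l (c v) then 1 else 0) (by
    intro v w
    have : c (v + w) = c v ^^^ c w := by
      apply vec_inj hr hb (hc1 _) (Nat.xor_lt_two_pow (hc1 _) (hc1 _))
      rw [vec_xor, hc2, hc2, hc2]
    show (if Eng.kb l (c (v + w)) then (1 : ZMod 2) else 0) = (if Eng.kb l (c v) then 1 else 0) + if Eng.kb l (c w) then 1 else 0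
    rw [this, Eng.kb_xor _ _ _ ((hc1 v).trans_le h7) ((hc1 w).trans_le h7)]
    cases Eng.kb l (c v) <;> cases Eng.kb l (c w) <;> decide)
  refine ⟨f.toZModLinearMap 2, fun x hx => ?_⟩
  have : c (vec b x) = x := vec_inj hr hb (hc1 _) hx (hc2 _)
  show (if Eng.kb l (c (vec b x)) then (1 : ZMod 2) else 0) = _
  rw [this]

/-- `S` contains a Fano plane. -/
def HasF7 (S : Finset V) : Prop :=
  ∃ Q : Submodule (ZMod 2) V, finrank (ZMod 2) Q = 3 ∧ ∀ x ∈ Q, x ≠ 0 → x ∈ S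

theorem kb_exists {l r : ℕ} (hr : r ≤ 7) (hl : l ≠ 0) (hlt : l < 2 ^ r) :
    ∃ x < 2 ^ r, Eng.kb l x = true := by
  have h : ∀ r ≤ 7, ∀ l < 128, l ≠ 0 → l < 2 ^ r → ∃ i < r, Eng.kb l (2 ^ i) = true := by decide +kernel
  obtain ⟨i, hi, h⟩ := h r hr l (hlt.trans_le (Nat.pow_le_pow_right (j := 7) (n := 2) (by norm_num) hr)) hl hlt
  exact ⟨2 ^ i, Nat.pow_lt_pow_right (by norm_num) hi, h⟩

theorem vec_spn {P : Submodule (ZMod 2) V} {x y z w : ℕ} (hx : vec b x ∈ P) (hy : vec b y ∈ P)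
    (hz : vec b z ∈ P) (h : Eng.Spn x y z w) : vec b w ∈ P := by
  obtain ⟨u, hu, v, hv, t, ht, rfl⟩ := h
  rw [vec_xor, vec_xor]
  refine add_mem (add_mem ?_ ?_) ?_
  · rcases hu with rfl | rfl
    · rw [vec_zero]; exact zero_mem _
    · exact hx
  · rcases hv with rfl | rfl
    · rw [vec_zero]; exact zero_mem _
    · exact hy
  · rcases ht with rfl | rfl
    · rw [vec_zero]; exact zero_mem _
    · exact hz

theorem card_aux (p q s : V) :
    (({p, q, s} : Finset V).erase 0).card ≤ 3 ∧ (s = 0 → (({p, q, s} : Finset V).erase 0).card ≤ 2) ∧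
    (q = 0 → s = 0 → (({p, q, s} : Finset V).erase 0).card ≤ 1) ∧
    (p = 0 → q = 0 → s = 0 → (({p, q, s} : Finset V).erase 0).card ≤ 0) := by
  refine ⟨?_, ?_, ?_, ?_⟩
  · exact (Finset.card_le_card (Finset.erase_subset _ _)).trans Finset.card_le_three
  · rintro rfl
    refine (Finset.card_le_card (t := {p, q}) ?_).trans Finset.card_le_two
    intro v; simp only [Finset.mem_erase, Finset.mem_insert, Finset.mem_singleton]
    rintro ⟨h, rfl | rfl | rfl⟩
    · exact .inl rfl
    · exact .inr rfl
    · exact absurd rfl h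
  · rintro rfl rfl
    refine (Finset.card_le_card (t := {p}) ?_).trans (Finset.card_singleton _).le
    intro v; simp only [Finset.mem_erase, Finset.mem_insert, Finset.mem_singleton]
    rintro ⟨h, rfl | rfl | rfl⟩
    · rfl
    · exact absurd rfl h
    · exact absurd rfl h
  · rintro rfl rfl rfl
    simp

theorem hyp_ag [Finite V] (hA : Adm r S) (hr4 : 4 ≤ r) (hr : r ≤ 7) (hb : LI b r) (hs : SP b r = ⊤) :
    ∀ a b' c l, (a = 0 ∨ a ∈ cod b r S) → (b' = 0 ∨ b' ∈ cod b r S) → (c = 0 ∨ c ∈ cod b r S) →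
    (r ≤ 6 → c = 0) → (r ≤ 5 → b' = 0) → (r ≤ 4 → a = 0) → l ≠ 0 → l < 2 ^ r →
    Eng.kb l a = false → Eng.kb l b' = false → Eng.kb l c = false →
    ¬ ∀ x < 2 ^ r, Eng.kb l x = true → ∃ w, Eng.Spn a b' c w ∧ x ^^^ w ∈ cod b r S := by
  intro x y z l hx hy hz hz6 hy5 hx4 hl hlt h1 h2 h3 hall
  obtain ⟨f, hf⟩ := exists_func hr hb hs l
  obtain ⟨u, hu, hku⟩ := kb_exists hr hl hlt
  have hlt0 : ∀ x, (x = 0 ∨ x ∈ cod b r S) → x < 2 ^ r := by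
    rintro x (rfl | h)
    · positivity
    · exact (mem_cod.1 h).1
  have hS0 : ∀ x, (x = 0 ∨ x ∈ cod b r S) → vec b x ≠ 0 → vec b x ∈ S := by
    rintro x (rfl | h) h0
    · exact absurd (vec_zero b) h0
    · exact (mem_cod.1 h).2
  let C : Finset V := ({vec b x, vec b y, vec b z} : Finset V).erase 0
  have hmem : ∀ v ∈ ({vec b x, vec b y, vec b z} : Finset V), v ∈ span (ZMod 2) (C : Set V) := by
    intro v hv
    by_cases h0 : v = 0
    · rw [h0]; exact zero_mem _
    · exact subset_span (by simp only [C, Finset.coe_erase]; exact ⟨hv, h0⟩)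
  have hcard : C.card + 4 ≤ r := by
    obtain ⟨c3, c2, c1, c0⟩ := card_aux (vec b x) (vec b y) (vec b z)
    have e0 := vec_zero b
    rcases Nat.lt_or_ge 6 r with h | h
    · exact (Nat.add_le_add_right c3 4).trans h
    · have hz0 := hz6 h
      rcases Nat.lt_or_ge 5 r with h' | h'
      · exact (Nat.add_le_add_right (c2 (by rw [hz0, e0])) 4).trans h'
      · have hy0 := hy5 h'
        rcases Nat.lt_or_ge 4 r with h'' | h''
        · exact (Nat.add_le_add_right (c1 (by rw [hy0, e0]) (by rw [hz0, e0])) 4).trans h''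
        · have hx0 := hx4 h''
          exact (Nat.add_le_add_right (c0 (by rw [hx0, e0]) (by rw [hy0, e0]) (by rw [hz0, e0])) 4).trans hr4
  refine hA.ag (hasAG_hyper (C := (C : Set V)) ?_ ?_ f (vec b u) ?_ ?_ ?_)
  · intro v hv
    simp only [C, Finset.coe_erase, Finset.coe_insert, Finset.coe_singleton] at hv
    obtain ⟨hv, h0⟩ := hv
    rcases hv with rfl | rfl | rfl
    · exact hS0 _ hx h0
    · exact hS0 _ hy h0
    · exact hS0 _ hz h0
  · have := finrank_span_finset_le_card (R := ZMod 2) C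
    rw [hA.fr]; exact le_trans (Nat.add_le_add_right this 4) hcard
  · rw [hf u hu, hku]; rfl
  · intro v hv
    simp only [C, Finset.coe_erase, Finset.coe_insert, Finset.coe_singleton] at hv
    rcases hv.1 with rfl | rfl | rfl
    · rw [hf _ (hlt0 _ hx), h1]; rfl
    · rw [hf _ (hlt0 _ hy), h2]; rfl
    · rw [hf _ (hlt0 _ hz), h3]; rfl
  · intro v hv
    obtain ⟨t, ht, rfl⟩ := exists_vec (b := b) hr (v := v) (by rw [hs]; trivial)
    have hkt : Eng.kb l t = true := by
      by_contra hk
      rw [hf t ht, if_neg hk] at hv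
      exact absurd hv (by decide)
    obtain ⟨w, hw, hws⟩ := hall t ht hkt
    refine ⟨vec b w, vec_spn (hmem _ (by simp)) (hmem _ (by simp)) (hmem _ (by simp)) hw, ?_⟩
    rw [← vec_xor]; exact (mem_cod.1 hws).2

theorem hyp_f7 [Finite V] (hr : r ≤ 7) (hb : LI b r)
    (hf7 : ¬ HasF7 S) : ∀ x y z, x ≠ 0 → y ≠ 0 → x ≠ y → ¬ Eng.Spn x y 0 z →
    ¬ ∀ w, Eng.Spn x y z w → w ≠ 0 → w ∈ cod b r S := by
  intro x y z hx hy hxy hz hall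
  have memS : ∀ w, Eng.Spn x y z w → w ≠ 0 → vec b w ∈ S ∧ w < 2 ^ r :=
    fun w h1 h2 => ⟨(mem_cod.1 (hall w h1 h2)).2, (mem_cod.1 (hall w h1 h2)).1⟩
  have s1 : Eng.Spn x y z x := ⟨x, .inr rfl, 0, .inl rfl, 0, .inl rfl, by simp⟩
  have s2 : Eng.Spn x y z y := ⟨0, .inl rfl, y, .inr rfl, 0, .inl rfl, by simp⟩
  have s3 : Eng.Spn x y z z := ⟨0, .inl rfl, 0, .inl rfl, z, .inr rfl, by simp⟩
  have hz0 : z ≠ 0 := by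
    rintro rfl; exact hz ⟨0, .inl rfl, 0, .inl rfl, 0, .inl rfl, by simp⟩
  have lx := (memS x s1 hx).2
  have ly := (memS y s2 hy).2
  have lz := (memS z s3 hz0).2
  let c : ℕ → V := fun i => if i = 0 then vec b x else if i = 1 then vec b y else vec b z
  have hc : LI c 3 := by
    rw [LI_succ, LI_succ, LI_succ]
    have key : ∀ t < 2 ^ r, t ≠ 0 → vec b t ≠ 0 := fun t ht h0 h => h0 (vec_eq_zero hr hb ht h)
    have k2 : ∀ t < 2 ^ r, ∀ u < 2 ^ r, vec b t + vec b u = 0 → t = u := by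
      intro t ht u hu h
      exact vec_inj hr hb ht hu (add_eq_zero_iff2.1 h)
    refine ⟨⟨⟨LI_zero _, ?_⟩, ?_⟩, ?_⟩
    · rw [SP_zero, mem_bot]; exact key x lx hx
    · rw [mem_SP_succ, SP_zero, mem_bot, mem_bot]
      rintro (h | h)
      · exact key y ly hy h
      · exact hxy (k2 y ly x lx h).symm
    · rw [mem_SP_succ, mem_SP_succ, mem_SP_succ, SP_zero, mem_bot, mem_bot, mem_bot, mem_bot]
      rintro ((h | h) | h | h)
      · exact key z lz hz0 h
      · refine hz ⟨x, .inr rfl, 0, .inl rfl, 0, .inl rfl, ?_⟩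
        rw [k2 z lz x lx h]; simp
      · refine hz ⟨0, .inl rfl, y, .inr rfl, 0, .inl rfl, ?_⟩
        rw [k2 z lz y ly h]; simp
      · refine hz ⟨x, .inr rfl, y, .inr rfl, 0, .inl rfl, ?_⟩
        change vec b z + vec b y + vec b x = 0 at h
        rw [add_assoc, ← vec_xor] at h
        rw [k2 z lz _ (Nat.xor_lt_two_pow ly lx) h, Nat.xor_comm y x]; simp
  refine hf7 ⟨SP c 3, hc.finrank_SP, fun v hv hv0 => ?_⟩
  obtain ⟨t, ht, rfl⟩ := exists_vec (by norm_num) hv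
  have : ∃ w, Eng.Spn x y z w ∧ vec c t = vec b w := by
    refine ⟨(if t.testBit 0 then x else 0) ^^^ (if t.testBit 1 then y else 0) ^^^ (if t.testBit 2 then z else 0), ?_, ?_⟩
    · refine ⟨_, ?_, _, ?_, _, ?_, rfl⟩ <;> split_ifs <;> simp
    · rw [vec_xor, vec_xor]
      have e : ∀ i, 3 ≤ i → t.testBit i = false := fun i hi =>
        Nat.testBit_lt_two_pow (ht.trans_le (Nat.pow_le_pow_right (by norm_num) hi))
      have e2 : ∀ (q : Bool) (s : ℕ), vec b (if q = true then s else 0) = if q = true then vec b s else 0 := by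
        intro q s; cases q <;> simp [vec_zero]
      rw [e2, e2, e2]
      conv_lhs => unfold vec
      rw [Finset.sum_range_succ, Finset.sum_range_succ, Finset.sum_range_succ, Finset.sum_range_succ,
        Finset.sum_range_succ, Finset.sum_range_succ, Finset.sum_range_succ, e 3 (by norm_num), e 4 (by norm_num),
        e 5 (by norm_num), e 6 (by norm_num)]
      simp [c]
  obtain ⟨w, hw, hvw⟩ := this
  rw [hvw]
  refine (memS w hw ?_).1
  rintro rfl
  exact hv0 (by rw [hvw, vec_zero])

theorem mkHyp [Finite V] (hA : Adm r S) (hr4 : 4 ≤ r) (hr : r ≤ 7) (hb : LI b r) (hs : SP b r = ⊤)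
    (n T cap : ℕ) (f7 lm : Bool)
    (count : n ≤ S.card) (tri : ∀ e ∈ S, 2 * T ≤ tt S e) (hf7 : f7 = true → ¬ HasF7 S)
    (hcap : ∀ k, k ≠ 0 → ((cod b r S).filter fun x => x / 8 = k).card ≤ cap)
    (fib : lm = true → ∀ y z, Eng.fmask.testBit y = true → Eng.fmask.testBit z = true →
      y / 2 ≠ z / 2 → y ∉ cod b r S → y ^^^ 1 ∉ cod b r S → z ∉ cod b r S → z ^^^ 1 ∈ cod b r S)
    (tree : lm = true → ∀ x, (18446744078004584724 : ℕ).testBit x = true → x ∉ cod b r S →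
      x ^^^ 1 ∉ cod b r S) :
    Eng.Hyp ⟨r, n, T, cap, f7, lm⟩ (cod b r S) where
  r7 := hr
  lt := fun x hx => (mem_cod.1 hx).1
  pos := fun h => hA.nz (by have := (mem_cod.1 h).2; rwa [vec_zero] at this)
  ag := hyp_ag hA hr4 hr hb hs
  count := by
    have := card_cod (S := S) hr hb hs (fun _ => True) (fun _ => True) (by simp)
    simp only [Finset.filter_true] at this
    rw [this]; exact count
  tri := by
    intro e he
    obtain ⟨he1, he2⟩ := mem_cod.1 he
    refine (tri _ he2).trans_eq (card_cod hr hb hs _ _ ?_).symm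
    intro x hx
    rw [mem_cod, vec_xor]
    exact ⟨fun h => h.2, fun h => ⟨Nat.xor_lt_two_pow hx he1, h⟩⟩
  f7 := fun h => hyp_f7 hr hb (hf7 h)
  cap := hcap
  fib := fib
  tree := tree

end Coding

end Bin

set_option linter.unusedSectionVars false

namespace Bin

open Module Submodule

section Goals

variable {V : Type} [AddCommGroup V] [Module (ZMod 2) V]

/-- `S` is contained in the set of `r` vectors and their pairwise sums. -/
def KV (r : ℕ) (S : Finset V) : Prop :=
  ∃ c : ℕ → V, ∀ x ∈ S, (∃ i < r, x = c i) ∨ ∃ i < r, ∃ j < r, x = c i + c j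

/-- `S` is contained in a generalized parallel connection. -/
def GV (S : Finset V) : Prop :=
  ∃ c : ℕ → V, ∀ x ∈ S, ((∃ i < 6, x = c i) ∨ ∃ i < 6, ∃ j < 6, x = c i + c j) ∨
    (x = c 6 ∨ x = c 6 + c 0 ∨ x = c 6 + c 1 ∨ x = c 6 + (c 0 + c 1))

variable [DecidableEq V] {b : ℕ → V} {r : ℕ} {S : Finset V}

theorem KV_of (hr : r ≤ 7) (hs : SP b r = ⊤) (h : Eng.KGoal r (cod b r S)) : KV r S := by
  obtain ⟨f, hf⟩ := h
  refine ⟨fun i => vec b (f i), fun x hx => ?_⟩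
  obtain ⟨t, ht, rfl⟩ := exists_vec (b := b) hr (v := x) (by rw [hs]; trivial)
  rcases hf t (mem_cod.2 ⟨ht, hx⟩) with ⟨i, hi, rfl⟩ | ⟨i, hi, j, hj, rfl⟩
  · exact .inl ⟨i, hi, rfl⟩
  · exact .inr ⟨i, hi, j, hj, vec_xor _ _ _⟩

theorem GV_of (hr : r ≤ 7) (hs : SP b r = ⊤) (h : Eng.GGoal (cod b r S)) : GV S := by
  obtain ⟨f, hf⟩ := h
  refine ⟨fun i => vec b (f i), fun x hx => ?_⟩
  obtain ⟨t, ht, rfl⟩ := exists_vec (b := b) hr (v := x) (by rw [hs]; trivial)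
  rcases hf t (mem_cod.2 ⟨ht, hx⟩) with (⟨i, hi, rfl⟩ | ⟨i, hi, j, hj, rfl⟩) | ⟨w, ⟨u, hu, v, hv, t, ht', rfl⟩, rfl⟩
  · exact .inl (.inl ⟨i, hi, rfl⟩)
  · exact .inl (.inr ⟨i, hi, j, hj, vec_xor _ _ _⟩)
  · right
    have ht0 : t = 0 := by rcases ht' with h | h <;> exact h
    rcases hu with rfl | rfl <;> rcases hv with rfl | rfl <;> simp [ht0, vec_xor, vec_zero]

theorem cap8 (b : ℕ → V) (r : ℕ) (S : Finset V) (k : ℕ) :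
    ((cod b r S).filter fun x => x / 8 = k).card ≤ 8 := by
  have : ((cod b r S).filter fun x => x / 8 = k) ⊆ Finset.Ico (8 * k) (8 * k + 8) := by
    intro x hx
    rw [Finset.mem_filter] at hx
    rw [Finset.mem_Ico]; omega
  have := Finset.card_le_card this
  rwa [Nat.card_Ico, Nat.add_sub_cancel_left] at this

theorem tt_zero_tri (S : Finset V) : ∀ e ∈ S, 2 * 0 ≤ tt S e := fun _ _ => by simp

theorem exists_basis [Finite V] (hA : Adm r S) :
    ∃ b : ℕ → V, (∀ i < r, b i ∈ S) ∧ LI b r ∧ SP b r = ⊤ := by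
  obtain ⟨b, -, h2, h3⟩ := ext_LI (fun _ => (0 : V)) 0 r (S : Set V) (LI_zero _) (Nat.zero_le _)
    (by rw [hA.sp, finrank_top, hA.fr])
  exact ⟨b, fun i hi => h2 i (Nat.zero_le _) hi, h3, h3.SP_eq (by rw [finrank_top, hA.fr]) (fun _ _ => trivial)⟩

theorem no_goal {cfg : Eng.Cfg} {S : Finset ℕ} (h1 : cfg.f7 = false) (h2 : cfg.lm = false) :
    ¬ Eng.Goal cfg S := by
  rintro (⟨h, -⟩ | ⟨h, -⟩)
  · rw [h1, h2] at h; exact absurd h (by decide)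
  · rw [h2] at h; exact absurd h (by decide)

/-- Rank four. -/
theorem R4 [Finite V] (hA : Adm 4 S) : S.card ≤ 11 := by
  by_contra hcon
  obtain ⟨b, h1, h2, h3⟩ := exists_basis hA
  have H := mkHyp hA le_rfl (by norm_num) h2 h3 12 0 8 false false (by omega) (tt_zero_tri S)
    (by simp) (fun k _ => cap8 b 4 S k) (by simp) (by simp)
  refine no_goal rfl rfl (Eng.c4 _ H ⟨?_, ?_⟩)
  · intro x hx hb
    have : x = 2 ^ 0 ∨ x = 2 ^ 1 ∨ x = 2 ^ 2 ∨ x = 2 ^ 3 := by revert x; decide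
    rw [mem_cod]
    rcases this with rfl | rfl | rfl | rfl <;> refine ⟨by norm_num, ?_⟩ <;>
      rw [vec_pow _ (by norm_num)] <;> exact h1 _ (by norm_num)
  · intro x hx hb
    simp at hb

theorem sum_tt_mod (h0 : (0 : V) ∉ S) : 3 ∣ ∑ e ∈ S, tt S e := by
  let P := {p : V × V // p.1 ∈ S ∧ p.2 ∈ S ∧ p.2 + p.1 ∈ S}
  have e1 : ∀ x y : V, x + y + x = y := fun x y => by rw [add_comm x y, add_cancel]
  have hfin : Fintype P := Fintype.subtype ((S ×ˢ S).filter fun p => p.2 + p.1 ∈ S) (by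
    intro p; rw [Finset.mem_filter, Finset.mem_product, and_assoc])
  have hcard : Fintype.card P = ∑ e ∈ S, tt S e := by
    rw [Fintype.card_of_subtype ((S ×ˢ S).filter fun p => p.2 + p.1 ∈ S) (by
      intro p; rw [Finset.mem_filter, Finset.mem_product, and_assoc])]
    rw [Finset.card_filter, Finset.sum_product]
    apply Finset.sum_congr rfl
    intro e _
    rw [tt, Finset.card_filter]
  let f : Function.End P := fun p => ⟨(p.1.2, p.1.2 + p.1.1), p.2.2.1, p.2.2.2, by
    show p.1.2 + p.1.1 + p.1.2 ∈ S
    rw [e1]; exact p.2.1⟩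
  have hf : f ^ (3 ^ 1) = 1 := by
    funext p
    apply Subtype.ext; apply Prod.ext
    · show p.1.2 + p.1.1 + p.1.2 = p.1.1
      rw [e1]
    · show p.1.2 + p.1.1 + p.1.2 + (p.1.2 + p.1.1) = p.1.2
      rw [e1]
  have : Fact (Nat.Prime 3) := ⟨by norm_num⟩
  have := Equiv.Perm.card_fixedPoints_modEq (p := 3) hf
  have hz : IsEmpty (Function.fixedPoints f) := by
    constructor
    rintro ⟨p, hp⟩
    have h1 := congrArg (fun q : P => q.1.1) hp
    have h2 : p.1.2 = p.1.1 := h1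
    apply h0
    have := p.2.2.2
    rwa [h2, add_self] at this
  rw [hcard] at this
  exact (Nat.modEq_zero_iff_dvd).1 (this.trans (by rw [Fintype.card_eq_zero_iff.2 hz]))

theorem hasF7_of (h0 : (0 : V) ∉ S) {p q s : V} (h1 : p ∈ S) (h2 : q ∈ S) (h3 : s ∈ S)
    (h4 : p + q ∈ S) (h5 : p + s ∈ S) (h6 : q + s ∈ S) (h7 : p + q + s ∈ S) : HasF7 S := by
  let c : ℕ → V := fun i => if i = 0 then p else if i = 1 then q else s
  have c0 : c 0 = p := rfl
  have c1 : c 1 = q := rfl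
  have c2 : c 2 = s := rfl
  have key : ∀ x ∈ S, x ≠ 0 := fun x hx h => h0 (h ▸ hx)
  have hc : LI c 3 := by
    rw [LI_succ, LI_succ, LI_succ]
    refine ⟨⟨⟨LI_zero _, ?_⟩, ?_⟩, ?_⟩
    · rw [SP_zero, mem_bot, c0]; exact key _ h1
    · rw [mem_SP_succ, SP_zero, mem_bot, mem_bot, c0, c1]
      rintro (h | h)
      · exact key _ h2 h
      · exact key _ h4 (by rw [add_comm]; exact h)
    · rw [mem_SP_succ, mem_SP_succ, mem_SP_succ, SP_zero, mem_bot, mem_bot, mem_bot, mem_bot, c0, c1, c2]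
      rintro ((h | h) | h | h)
      · exact key _ h3 h
      · exact key _ h5 (by rw [add_comm]; exact h)
      · exact key _ h6 (by rw [add_comm]; exact h)
      · exact key _ h7 (by rw [← h]; abel)
  refine ⟨SP c 3, hc.finrank_SP, fun x hx hx0 => ?_⟩
  simp only [mem_SP_succ, SP_zero, mem_bot, c0, c1, c2, add_eq_zero_iff2] at hx
  rcases hx with ((h | h) | h | h) | ((h | h) | h | h)
  · exact absurd h hx0
  · rwa [h]
  · rwa [h]
  · rw [← eq_add_iff] at h; rwa [h]
  · rwa [h]
  · rw [← eq_add_iff] at h; rwa [h]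
  · rw [← eq_add_iff] at h; rwa [h]
  · rw [← eq_add_iff, ← eq_add_iff] at h; rwa [h]

theorem exists_coord (hr : r ≤ 7) (hb : LI b r) (hs : SP b r = ⊤) {i : ℕ} (hi : i < r) :
    ∃ f : V →ₗ[ZMod 2] ZMod 2, ∀ j < r, f (b j) = if i = j then 1 else 0 := by
  obtain ⟨f, hf⟩ := exists_func hr hb hs (2 ^ i)
  refine ⟨f, fun j hj => ?_⟩
  have h : ∀ i < 7, ∀ j < 7, Eng.kb (2 ^ i) (2 ^ j) = decide (i = j) := by decide +kernel
  rw [← vec_pow b (hj.trans_le hr), hf _ (Nat.pow_lt_pow_right (by norm_num) hj),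
    h i (by omega) j (by omega)]
  simp

theorem D_key (h0 : (0 : V) ∉ S) (hF : ¬ HasF7 S) (hAG : ¬ HasAG S) (hr : r ≤ 7) (hb : LI b r)
    (hs : SP b r = ⊤) (he : b 0 ∈ S) (J : Finset ℕ) (hJ : ∀ j ∈ J, 1 ≤ j ∧ j < r)
    (hJS : ∀ j ∈ J, b j ∈ S ∧ b j + b 0 ∈ S)
    (hx : ∑ j ∈ J, b j ∈ S) (hxe : ∑ j ∈ J, b j + b 0 ∈ S) : J.card = 1 := by
  by_contra hJ1
  rcases Nat.lt_or_ge J.card 3 with h3 | h3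
  · have : J.card = 0 ∨ J.card = 2 := by omega
    rcases this with h | h
    · rw [Finset.card_eq_zero] at h
      rw [h, Finset.sum_empty] at hx
      exact h0 hx
    · obtain ⟨i, j, hij, rfl⟩ := Finset.card_eq_two.1 h
      rw [Finset.sum_pair hij] at hx hxe
      have hi := hJS i (by simp)
      have hj := hJS j (by simp)
      exact hF (hasF7_of h0 hi.1 hj.1 he hx hi.2 hj.2 hxe)
  · obtain ⟨J3, hsub, hc3⟩ := Finset.exists_subset_card_eq h3
    obtain ⟨i, j, k, hij, hik, hjk, rfl⟩ := Finset.card_eq_three.1 hc3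
    have hi : i ∈ J := hsub (by simp)
    have hj : j ∈ J := hsub (by simp)
    have hk : k ∈ J := hsub (by simp)
    have hr0 : 0 < r := by have := hJ i hi; omega
    have hi1 := hJ i hi
    have hj1 := hJ j hj
    have hk1 := hJ k hk
    set J' := J \ {i, j, k} with hJ'
    have hsum : ∑ l ∈ J, b l = ∑ l ∈ J', b l + (b i + b j + b k) := by
      rw [hJ', ← Finset.sum_sdiff hsub]
      congr 1
      rw [Finset.sum_insert (by simp [hij, hik]), Finset.sum_pair hjk, add_assoc]
    have hwC : ∑ l ∈ J', b l ∈ span (ZMod 2) (b '' (J' : Set ℕ)) :=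
      sum_mem fun l hl => subset_span ⟨l, hl, rfl⟩
    have hvan : ∀ m < r, m ∉ J' → ∀ f : V →ₗ[ZMod 2] ZMod 2, (∀ j < r, f (b j) = if m = j then 1 else 0) →
        ∀ x ∈ span (ZMod 2) (b '' (J' : Set ℕ)), f x = 0 := by
      intro m hm hmJ f hf x hxm
      have : span (ZMod 2) (b '' (J' : Set ℕ)) ≤ f.ker := by
        rw [span_le]
        rintro y ⟨l, hl, rfl⟩
        show f (b l) = 0
        have hlJ : l ∈ J := (Finset.mem_sdiff.1 hl).1
        rw [hf l (hJ l hlJ).2, if_neg]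
        rintro rfl; exact hmJ hl
      exact this hxm
    obtain ⟨f0, hf0⟩ := exists_coord hr hb hs hr0
    obtain ⟨fi, hfi⟩ := exists_coord hr hb hs hi1.2
    obtain ⟨fj, hfj⟩ := exists_coord hr hb hs hj1.2
    obtain ⟨fk, hfk⟩ := exists_coord hr hb hs hk1.2
    have v0 := hvan 0 hr0 (fun h => by have := hJ 0 (Finset.mem_sdiff.1 h).1; omega) f0 hf0
    have vi := hvan i hi1.2 (by simp [hJ']) fi hfi
    have vj := hvan j hj1.2 (by simp [hJ']) fj hfj
    have vk := hvan k hk1.2 (by simp [hJ']) fk hfk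
    have i0 : i ≠ 0 := by omega
    have j0 : j ≠ 0 := by omega
    have k0 : k ≠ 0 := by omega
    refine hAG (hasAG_of_four (C := b '' (J' : Set ℕ)) ?_ (b i) (b 0) (b i + b j) (b i + b k) ?_ ?_)
    · rintro x ⟨l, hl, rfl⟩
      exact (hJS l (Finset.mem_sdiff.1 hl).1).1
    · intro δ α β γ hm
      have w0 := v0 _ hm
      have wi := vi _ hm
      have wj := vj _ hm
      have wk := vk _ hm
      simp only [map_add, map_smul, hf0 _ hr0, hf0 _ hi1.2, hf0 _ hj1.2, hf0 _ hk1.2,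
        hfi _ hr0, hfi _ hi1.2, hfi _ hj1.2, hfi _ hk1.2, hfj _ hr0, hfj _ hi1.2, hfj _ hj1.2,
        hfj _ hk1.2, hfk _ hr0, hfk _ hi1.2, hfk _ hj1.2, hfk _ hk1.2, i0, j0, k0, i0.symm,
        j0.symm, k0.symm, hij, hik, hjk, hij.symm, hik.symm, hjk.symm, if_true, if_false,
        smul_eq_mul, mul_zero, mul_one, add_zero, zero_add] at w0 wi wj wk
      subst w0 wj wk
      simp at wi
      exact ⟨wi, rfl, rfl, rfl⟩
    · intro α β γ
      have hti := hJS i hi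
      have htj := hJS j hj
      have htk := hJS k hk
      rcases z2 α with rfl | rfl <;> rcases z2 β with rfl | rfl <;> rcases z2 γ with rfl | rfl <;>
        simp only [one_smul, zero_smul, add_zero]
      · exact ⟨0, zero_mem _, by rw [add_zero]; exact hti.1⟩
      · exact ⟨0, zero_mem _, by rw [add_zero, add_self_left]; exact htk.1⟩
      · exact ⟨0, zero_mem _, by rw [add_zero, add_self_left]; exact htj.1⟩
      · refine ⟨_, hwC, ?_⟩
        rw [hsum] at hx
        rw [add_self_left]
        convert hx using 1; abel
      · exact ⟨0, zero_mem _, by rw [add_zero]; exact hti.2⟩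
      · refine ⟨0, zero_mem _, ?_⟩
        rw [add_zero, add_comm (b i), add_assoc, add_self_left, add_comm]; exact htk.2
      · refine ⟨0, zero_mem _, ?_⟩
        rw [add_zero, add_comm (b i), add_assoc, add_self_left, add_comm]; exact htj.2
      · refine ⟨_, hwC, ?_⟩
        rw [hsum] at hxe
        rw [add_comm (b i) (b 0), add_assoc (b 0), add_self_left]
        convert hxe using 1; abel

end Goals

end Bin

set_option linter.unusedSectionVars false

namespace Bin

open Module Submodule

section DAB

variable {V : Type} [AddCommGroup V] [Module (ZMod 2) V] [DecidableEq V] {b : ℕ → V} {r : ℕ}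
  {S : Finset V}

theorem LI.inj {n i j : ℕ} (h : LI b n) (hi : i < n) (hj : j < n) (he : b i = b j) : i = j := by
  have := LinearIndependent.injective h (a₁ := ⟨i, hi⟩) (a₂ := ⟨j, hj⟩) he
  simpa using this

theorem LI_one {x : V} (hx : x ≠ 0) : LI (fun _ => x) 1 := by
  rw [LI_succ, SP_zero, mem_bot]; exact ⟨LI_zero _, hx⟩

theorem vec_eq_sum (b : ℕ → V) (t : ℕ) :
    vec b t = ∑ i ∈ (Finset.range 7).filter (fun i => t.testBit i = true), b i := by
  unfold vec; rw [Finset.sum_filter]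

theorem D_basis [Finite V] (hA : Adm r S) (hr : r ≤ 7) (hF : ¬ HasF7 S) {e : V} (he : e ∈ S) :
    ∃ (d : ℕ) (b : ℕ → V), 1 ≤ d ∧ d ≤ r ∧ b 0 = e ∧ LI b r ∧ SP b r = ⊤ ∧
      (∀ i, 1 ≤ i → i < d → b i ∈ S ∧ b i + e ∈ S) ∧
      ∀ x ∈ S, x + e ∈ S → ∃ i, (1 ≤ i ∧ i < d) ∧ (x = b i ∨ x = b i + e) := by
  have he0 : e ≠ 0 := fun h => hA.nz (h ▸ he)
  set T : Set V := {x | x ∈ S ∧ (x = e ∨ x + e ∈ S)} with hT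
  have heT : e ∈ T := ⟨he, .inl rfl⟩
  set d := finrank (ZMod 2) (span (ZMod 2) T) with hd
  have hdr : d ≤ r := by rw [← hA.fr]; exact Submodule.finrank_le _
  have hd1 : 1 ≤ d := by
    rw [← finrank_span_singleton (K := ZMod 2) he0]
    exact Submodule.finrank_mono (span_mono (by simpa using heT))
  obtain ⟨b0, h1, h2, h3⟩ := ext_LI (fun _ => e) 1 d T (LI_one he0) hd1 le_rfl
  have b00 : b0 0 = e := h1 0 (by norm_num)
  have hSPT : SP b0 d = span (ZMod 2) T := by
    refine h3.SP_eq hd.symm fun i hi => ?_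
    rcases Nat.eq_zero_or_pos i with rfl | h
    · rw [b00]; exact subset_span heT
    · exact subset_span (h2 i h hi)
  obtain ⟨b, h4, h5, h6⟩ := ext_LI b0 d r (S : Set V) h3 hdr (by rw [hA.sp, finrank_top, hA.fr])
  have be : b 0 = e := by rw [h4 0 (by omega), b00]
  have hs : SP b r = ⊤ := h6.SP_eq (by rw [finrank_top, hA.fr]) (fun _ _ => trivial)
  have hD : ∀ i, 1 ≤ i → i < d → b i ∈ S ∧ b i + e ∈ S := by
    intro i hi hid
    have hm := h2 i hi hid
    rw [← h4 i hid] at hm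
    refine ⟨hm.1, hm.2.resolve_left fun h => ?_⟩
    have := h6.inj (i := i) (j := 0) (by omega) (by omega) (h.trans be.symm)
    omega
  refine ⟨d, b, hd1, hdr, be, h6, hs, hD, fun x hx hxe => ?_⟩
  have hxs : x ∈ SP b d := by rw [SP_congr h4, hSPT]; exact subset_span ⟨hx, .inr hxe⟩
  obtain ⟨t, ht, rfl⟩ := exists_vec (by omega) hxs
  have main : ∀ t < 2 ^ d, t.testBit 0 = false → vec b t ∈ S → vec b t + e ∈ S →
      ∃ i, (1 ≤ i ∧ i < d) ∧ vec b t = b i := by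
    intro t ht h0 hx hxe
    rw [vec_eq_sum] at hx hxe ⊢
    set J := (Finset.range 7).filter (fun i => t.testBit i = true) with hJ
    have hJm : ∀ j ∈ J, 1 ≤ j ∧ j < d := by
      intro j hj
      have hj := (Finset.mem_filter.1 hj).2
      constructor
      · by_contra h
        have : j = 0 := by omega
        rw [this, h0] at hj
        exact absurd hj (by decide)
      · by_contra h
        rw [Nat.testBit_lt_two_pow (ht.trans_le (Nat.pow_le_pow_right (by norm_num) (by omega)))] at hj
        exact absurd hj (by decide)
    have hc := D_key hA.nz hF hA.ag hr h6 hs (be ▸ he) J (fun j hj => ⟨(hJm j hj).1, (hJm j hj).2.trans_le hdr⟩)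
      (fun j hj => by rw [be]; exact hD j (hJm j hj).1 (hJm j hj).2) hx (by rw [be]; exact hxe)
    obtain ⟨i, hi⟩ := Finset.card_eq_one.1 hc
    refine ⟨i, hJm i (by rw [hi]; simp), ?_⟩
    rw [hi, Finset.sum_singleton]
  rcases h : t.testBit 0
  · obtain ⟨i, hi, h'⟩ := main t ht h hx hxe
    exact ⟨i, hi, .inl h'⟩
  · have hv : vec b (t ^^^ 2 ^ 0) = vec b t + e := by rw [vec_xor, vec_pow _ (by norm_num), be]
    obtain ⟨i, hi, h'⟩ := main (t ^^^ 2 ^ 0) (Nat.xor_lt_two_pow ht (Nat.pow_lt_pow_right (by norm_num) (by omega)))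
      (by rw [Nat.testBit_xor, h]; rfl) (by rw [hv]; exact hxe) (by rw [hv, add_cancel]; exact hx)
    refine ⟨i, hi, .inr ?_⟩
    rw [← h', hv, add_cancel]

theorem tt_le [Finite V] (hA : Adm r S) (hr : r ≤ 7) (hF : ¬ HasF7 S) {e : V} (he : e ∈ S) :
    tt S e ≤ 2 * (r - 1) ∧ (tt S e = 2 * (r - 1) → ∃ b : ℕ → V, b 0 = e ∧ LI b r ∧ SP b r = ⊤ ∧
      ∀ i, 1 ≤ i → i < r → b i ∈ S ∧ b i + e ∈ S) := by
  obtain ⟨d, b, h1, h2, h3, h4, h5, h6, h7⟩ := D_basis hA hr hF he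
  have hle : tt S e ≤ 2 * (d - 1) := by
    have hsub : (S.filter fun x => x + e ∈ S) ⊆ (Finset.Ico 1 d).image b ∪ (Finset.Ico 1 d).image (fun i => b i + e) := by
      intro x hx
      rw [Finset.mem_filter] at hx
      obtain ⟨i, hi, h | h⟩ := h7 x hx.1 hx.2
      · exact Finset.mem_union_left _ (Finset.mem_image.2 ⟨i, Finset.mem_Ico.2 hi, h.symm⟩)
      · exact Finset.mem_union_right _ (Finset.mem_image.2 ⟨i, Finset.mem_Ico.2 hi, h.symm⟩)
    have e1 := Finset.card_le_card hsub
    have e2 := Finset.card_union_le ((Finset.Ico 1 d).image b) ((Finset.Ico 1 d).image (fun i => b i + e))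
    have e3 := Finset.card_image_le (s := Finset.Ico 1 d) (f := b)
    have e4 := Finset.card_image_le (s := Finset.Ico 1 d) (f := fun i => b i + e)
    rw [Nat.card_Ico] at e3 e4
    unfold tt
    omega
  refine ⟨by omega, fun heq => ?_⟩
  have : d = r := by omega
  subst this
  exact ⟨b, h3, h4, h5, h6⟩

theorem sign_change [Finite V] (hf : finrank (ZMod 2) V = r) (hs : SP b r = ⊤) {b' : ℕ → V}
    (h0 : b' 0 = b 0) (hr0 : 0 < r) (h : ∀ i < r, b' i = b i ∨ b' i = b i + b 0) : LI b' r ∧ SP b' r = ⊤ := by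
  have hs' : SP b' r = ⊤ := by
    rw [eq_top_iff, ← hs]
    apply SP_le
    intro i hi
    rcases h i hi with h | h
    · rw [← h]; exact mem_SP hi
    · have : b i = b' i + b' 0 := by rw [h, h0, add_cancel]
      rw [this]; exact add_mem (mem_SP hi) (mem_SP hr0)
  exact ⟨LI_of_span hf hs', hs'⟩

theorem caseA [Finite V] {n T iA : ℕ} (hA : Adm r S) (hr4 : 4 ≤ r) (hr : r ≤ 7) (hF : ¬ HasF7 S)
    (certA : Eng.Prv ⟨r, n, T, 8, true, false⟩ iA 0)
    (hiA : ∀ x < 128, iA.testBit x = true → x = 14 ∨ x = 1 ∨ ∃ i < r, 1 ≤ i ∧ (x = 2 ^ i ∨ x = 2 ^ i ^^^ 1))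
    (count : n ≤ S.card) (tri : ∀ e ∈ S, 2 * T ≤ tt S e)
    (hb : LI b r) (hs : SP b r = ⊤) (he : b 0 ∈ S)
    (hD : ∀ i, 1 ≤ i → i < r → b i ∈ S ∧ b i + b 0 ∈ S)
    (h14 : b 1 + b 2 + b 3 ∈ S) : KV r S := by
  have H := mkHyp hA hr4 hr hb hs n T 8 true false count tri (fun _ => hF) (fun k _ => cap8 b r S k) (by simp) (by simp)
  have hval : Eng.Val (cod b r S) iA 0 := by
    refine ⟨fun x hx hbit => ?_, fun x hx hbit => by simp at hbit⟩
    rw [mem_cod]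
    have v1 : vec b 1 = b 0 := vec_pow b (i := 0) (by norm_num)
    have p4 : 2 ^ 4 ≤ 2 ^ r := Nat.pow_le_pow_right (by norm_num) hr4
    rcases hiA x hx hbit with rfl | rfl | ⟨i, hi, hi1, rfl | rfl⟩
    · refine ⟨by omega, ?_⟩
      have : 14 = 2 ^ 1 ^^^ 2 ^ 2 ^^^ 2 ^ 3 := by decide
      rw [this, vec_xor, vec_xor, vec_pow _ (by norm_num), vec_pow _ (by norm_num), vec_pow _ (by norm_num)]
      exact h14
    · refine ⟨by omega, ?_⟩
      rw [v1]; exact he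
    · refine ⟨Nat.pow_lt_pow_right (by norm_num) hi, ?_⟩
      rw [vec_pow _ (by omega)]; exact (hD i hi1 hi).1
    · refine ⟨Nat.xor_lt_two_pow (Nat.pow_lt_pow_right (by norm_num) hi) (by omega), ?_⟩
      rw [vec_xor, v1, vec_pow _ (by omega)]; exact (hD i hi1 hi).2
  rcases certA _ H hval with h | h
  · exact KV_of hr hs h.2
  · exact absurd h.1 (by simp)

/-- The three indices are distinct and in range. -/
def P3 (r i j k : ℕ) : Prop := (1 ≤ i ∧ i < r) ∧ (1 ≤ j ∧ j < r) ∧ (1 ≤ k ∧ k < r) ∧ i ≠ j ∧ i ≠ k ∧ j ≠ k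

instance (r i j k : ℕ) : Decidable (P3 r i j k) := by unfold P3; infer_instance

theorem caseA' [Finite V] {n T iA : ℕ} (hA : Adm r S) (hr4 : 4 ≤ r) (hr : r ≤ 7) (hF : ¬ HasF7 S)
    (certA : Eng.Prv ⟨r, n, T, 8, true, false⟩ iA 0)
    (hiA : ∀ x < 128, iA.testBit x = true → x = 14 ∨ x = 1 ∨ ∃ i < r, 1 ≤ i ∧ (x = 2 ^ i ∨ x = 2 ^ i ^^^ 1))
    (count : n ≤ S.card) (tri : ∀ e ∈ S, 2 * T ≤ tt S e)
    (hb : LI b r) (hs : SP b r = ⊤) (he : b 0 ∈ S)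
    (hD : ∀ i, 1 ≤ i → i < r → b i ∈ S ∧ b i + b 0 ∈ S) {i j k : ℕ} (h3 : P3 r i j k)
    (h14 : b i + b j + b k ∈ S) : KV r S := by
  obtain ⟨hi, hj, hk, hij, hik, hjk⟩ := h3
  let c : ℕ → V := fun n => if n = 0 then b 0 else if n = 1 then b i else if n = 2 then b j else b k
  have hc : LI c 4 := by
    have := LinearIndependent.comp hb (![⟨0, by omega⟩, ⟨i, hi.2⟩, ⟨j, hj.2⟩, ⟨k, hk.2⟩] : Fin 4 → Fin r) (by
      intro x y hxy
      fin_cases x <;> fin_cases y <;> simp at hxy ⊢ <;> omega)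
    unfold LI
    convert this using 1
    funext x
    fin_cases x <;> rfl
  obtain ⟨c', h1, h2, h3⟩ := ext_LI c 4 r (b '' Set.Iio r) hc hr4 (by
    show r ≤ finrank (ZMod 2) (SP b r)
    rw [hb.finrank_SP])
  have c0 : c' 0 = b 0 := h1 0 (by norm_num)
  have c1 : c' 1 = b i := h1 1 (by norm_num)
  have c2 : c' 2 = b j := h1 2 (by norm_num)
  have c3 : c' 3 = b k := h1 3 (by norm_num)
  refine caseA hA hr4 hr hF certA hiA count tri h3 (h3.SP_eq (by rw [finrank_top, hA.fr]) (fun _ _ => trivial))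
    (c0 ▸ he) ?_ (by rw [c1, c2, c3]; exact h14)
  intro m hm hmr
  have : ∃ l, 1 ≤ l ∧ l < r ∧ c' m = b l := by
    rcases Nat.lt_or_ge m 4 with h | h
    · interval_cases m
      · exact ⟨i, hi.1, hi.2, c1⟩
      · exact ⟨j, hj.1, hj.2, c2⟩
      · exact ⟨k, hk.1, hk.2, c3⟩
    · obtain ⟨l, hl, hl2⟩ := h2 m h hmr
      refine ⟨l, ?_, hl, hl2.symm⟩
      by_contra hl0
      have : l = 0 := by omega
      rw [this, ← c0] at hl2
      have := h3.inj (i := 0) (j := m) (by omega) hmr hl2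
      omega
  obtain ⟨l, hl1, hl2, h⟩ := this
  rw [h, c0]; exact hD l hl1 hl2

theorem caseAB [Finite V] {n T iA iB oB : ℕ} (hA : Adm r S) (hr4 : 4 ≤ r) (hr : r ≤ 7) (hF : ¬ HasF7 S)
    (certA : Eng.Prv ⟨r, n, T, 8, true, false⟩ iA 0) (certB : Eng.Prv ⟨r, n, T, 8, true, false⟩ iB oB)
    (hiA : ∀ x < 128, iA.testBit x = true → x = 14 ∨ x = 1 ∨ ∃ i < r, 1 ≤ i ∧ (x = 2 ^ i ∨ x = 2 ^ i ^^^ 1))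
    (hiB : ∀ x < 128, iB.testBit x = true → x = 1 ∨ ∃ i < r, 1 ≤ i ∧ (x = 2 ^ i ∨ x = 2 ^ i ^^^ 1))
    (hoB : ∀ x < 128, oB.testBit x = true → (∃ i < r, ∃ j < r, ∃ k < r, P3 r i j k ∧
      (x = 2 ^ i ^^^ 2 ^ j ^^^ 2 ^ k ∨ x = 2 ^ i ^^^ 2 ^ j ^^^ 2 ^ k ^^^ 1)) ∨ ∃ i < r, 2 ≤ i ∧ x = 2 ^ 1 ^^^ 2 ^ i ^^^ 1)
    (count : n ≤ S.card) (tri : ∀ e ∈ S, 2 * T ≤ tt S e) {e : V} (he : e ∈ S)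
    (htt : tt S e = 2 * (r - 1)) : KV r S := by
  obtain ⟨b, be, hb, hs, hD⟩ := (tt_le hA hr hF he).2 htt
  subst be
  by_cases h3 : ∃ i j k, P3 r i j k ∧ (b i + b j + b k ∈ S ∨ b i + b j + b k + b 0 ∈ S)
  · obtain ⟨i, j, k, hP, h | h⟩ := h3
    · exact caseA' hA hr4 hr hF certA hiA count tri hb hs he hD hP h
    · have hk0 : k ≠ 0 := by have := hP.2.2.1.1; omega
      have hki : i ≠ k := hP.2.2.2.2.1
      have hkj : j ≠ k := hP.2.2.2.2.2
      let b' : ℕ → V := fun n => if n = k then b k + b 0 else b n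
      have b'0 : b' 0 = b 0 := if_neg hk0.symm
      have hb' : ∀ i < r, b' i = b i ∨ b' i = b i + b 0 := by
        intro i _
        by_cases hik : i = k
        · right; simp only [b', hik, if_true]
        · left; simp only [b', hik, if_false]
      obtain ⟨q1, q2⟩ := sign_change hA.fr hs b'0 (by omega) hb'
      refine caseA' hA hr4 hr hF certA hiA count tri q1 q2 (b'0 ▸ he) ?_ hP ?_
      · intro m h1 h2
        rw [b'0]
        rcases hb' m h2 with h | h <;> rw [h]
        · exact hD m h1 h2
        · rw [add_cancel]; exact (hD m h1 h2).symm
      · simp only [b', hki, hkj, if_true, if_false]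
        rw [← add_assoc]; exact h
  · push Not at h3
    let b' : ℕ → V := fun n => if 2 ≤ n ∧ b 1 + b n + b 0 ∈ S then b n + b 0 else b n
    have b'0 : b' 0 = b 0 := if_neg (by omega)
    have b'1 : b' 1 = b 1 := if_neg (by omega)
    have hb' : ∀ i < r, b' i = b i ∨ b' i = b i + b 0 := by
      intro i _
      by_cases hik : 2 ≤ i ∧ b 1 + b i + b 0 ∈ S
      · right; exact if_pos hik
      · left; exact if_neg hik
    obtain ⟨q1, q2⟩ := sign_change hA.fr hs b'0 (by omega) hb'
    have hD' : ∀ i, 1 ≤ i → i < r → b' i ∈ S ∧ b' i + b' 0 ∈ S := by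
      intro m h1 h2
      rw [b'0]
      rcases hb' m h2 with h | h <;> rw [h]
      · exact hD m h1 h2
      · rw [add_cancel]; exact (hD m h1 h2).symm
    have h3' : ∀ i j k, P3 r i j k → b' i + b' j + b' k ∉ S ∧ b' i + b' j + b' k + b' 0 ∉ S := by
      intro i j k hP
      have h := h3 i j k hP
      have : b' i + b' j + b' k = b i + b j + b k ∨ b' i + b' j + b' k = b i + b j + b k + b 0 := by
        have z := add_self (b 0)
        rcases hb' i hP.1.2 with h1 | h1 <;> rcases hb' j hP.2.1.2 with h2 | h2 <;>
          rcases hb' k hP.2.2.1.2 with h4 | h4 <;> rw [h1, h2, h4]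
        · left; rfl
        · right; abel
        · right; abel
        · left; rw [show b i + (b j + b 0) + (b k + b 0) = b i + b j + b k + (b 0 + b 0) by abel, z, add_zero]
        · right; abel
        · left; rw [show b i + b 0 + b j + (b k + b 0) = b i + b j + b k + (b 0 + b 0) by abel, z, add_zero]
        · left; rw [show b i + b 0 + (b j + b 0) + b k = b i + b j + b k + (b 0 + b 0) by abel, z, add_zero]
        · right; rw [show b i + b 0 + (b j + b 0) + (b k + b 0) = b i + b j + b k + b 0 + (b 0 + b 0) by abel, z, add_zero]
      rw [b'0]
      rcases this with h' | h' <;> rw [h']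
      · exact h
      · rw [add_cancel]; exact h.symm
    have h2' : ∀ i < r, 2 ≤ i → b' 1 + b' i + b' 0 ∉ S := by
      intro i hi hi2 hmem
      rw [b'0, b'1] at hmem
      by_cases hik : 2 ≤ i ∧ b 1 + b i + b 0 ∈ S
      · have e : b' i = b i + b 0 := if_pos hik
        rw [e, ← add_assoc, add_cancel] at hmem
        have d1 := hD 1 (by norm_num) (by omega)
        have d2 := hD i (by omega) hi
        exact hF (hasF7_of hA.nz d1.1 d2.1 he hmem d1.2 d2.2 hik.2)
      · have e : b' i = b i := if_neg hik
        rw [e] at hmem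
        exact hik ⟨hi2, hmem⟩
    have H := mkHyp hA hr4 hr q1 q2 n T 8 true false count tri (fun _ => hF) (fun k _ => cap8 b' r S k) (by simp) (by simp)
    have v1 : vec b' 1 = b' 0 := vec_pow b' (i := 0) (by norm_num)
    have hin : ∀ x < 128, iB.testBit x = true → x ∈ cod b' r S := by
      intro x hx hbit
      rw [mem_cod]
      have p4 : 2 ^ 4 ≤ 2 ^ r := Nat.pow_le_pow_right (by norm_num) hr4
      rcases hiB x hx hbit with rfl | ⟨i, hi, hi1, rfl | rfl⟩
      · refine ⟨by omega, ?_⟩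
        rw [v1, b'0]; exact he
      · refine ⟨Nat.pow_lt_pow_right (by norm_num) hi, ?_⟩
        rw [vec_pow _ (by omega)]; exact (hD' i hi1 hi).1
      · refine ⟨Nat.xor_lt_two_pow (Nat.pow_lt_pow_right (by norm_num) hi) (by omega), ?_⟩
        rw [vec_xor, v1, vec_pow _ (by omega)]; exact (hD' i hi1 hi).2
    have hout : ∀ x < 128, oB.testBit x = true → x ∉ cod b' r S := by
      intro x hx hbit hmem
      rw [mem_cod] at hmem
      have hm := hmem.2
      rcases hoB x hx hbit with ⟨i, hi, j, hj, k, hk, hP, rfl | rfl⟩ | ⟨i, hi, hi2, rfl⟩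
      · rw [vec_xor, vec_xor, vec_pow _ (by omega), vec_pow _ (by omega), vec_pow _ (by omega)] at hm
        exact (h3' i j k hP).1 hm
      · rw [vec_xor, vec_xor, vec_xor, vec_pow _ (by omega), vec_pow _ (by omega), vec_pow _ (by omega), v1] at hm
        exact (h3' i j k hP).2 hm
      · rw [vec_xor, vec_xor, vec_pow _ (by omega), vec_pow _ (by omega), v1] at hm
        exact h2' i hi hi2 hm
    rcases certB _ H ⟨hin, hout⟩ with h | h
    · exact KV_of hr q2 h.2
    · exact absurd h.1 (by simp)

theorem caseAB6 [Finite V] (hA : Adm 6 S) (hF : ¬ HasF7 S)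
    (count : 20 ≤ S.card) (tri : ∀ e ∈ S, 2 * 4 ≤ tt S e) {e : V} (he : e ∈ S)
    (htt : tt S e = 10) : KV 6 S :=
  caseAB hA (by norm_num) (by norm_num) hF Eng.cA6 Eng.cB6 (by decide +kernel) (by decide +kernel)
    (by decide +kernel) count tri he htt

theorem caseAB7 [Finite V] (hA : Adm 7 S) (hF : ¬ HasF7 S)
    (count : 25 ≤ S.card) (tri : ∀ e ∈ S, 2 * 5 ≤ tt S e) {e : V} (he : e ∈ S)
    (htt : tt S e = 12) : KV 7 S :=
  caseAB hA (by norm_num) (by norm_num) hF Eng.cA7 Eng.cB7 (by decide +kernel) (by decide +kernel)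
    (by decide +kernel) count tri he htt

end DAB

end Bin

set_option linter.unusedSectionVars false

namespace Bin

open Module Submodule

section FM

variable {V : Type} [AddCommGroup V] [Module (ZMod 2) V] [DecidableEq V] {b : ℕ → V} {r : ℕ}
  {S : Finset V} {Q : Submodule (ZMod 2) V}

theorem no4 [Finite V] (hA : Adm r S) (hQ : finrank (ZMod 2) Q = 3) (hQS : ∀ x ∈ Q, x ≠ 0 → x ∈ S)
    {u p q : V} (hu : u ∉ Q) (hp : p ∈ Q) (hq : q ∈ Q) (hp0 : p ≠ 0) (hq0 : q ≠ 0) (hpq : p ≠ q)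
    (h1 : u ∈ S) (h2 : u + p ∈ S) (h3 : u + q ∈ S) (h4 : u + p + q ∈ S) : False := by
  obtain ⟨s, hs, hsp⟩ : ∃ s ∈ Q, s ∉ span (ZMod 2) ({p, q} : Set V) := by
    by_contra! hcon
    have hle : Q ≤ span (ZMod 2) ({p, q} : Set V) := hcon
    have e1 := Submodule.finrank_mono hle
    have e2 : finrank (ZMod 2) (span (ZMod 2) ({p, q} : Set V)) ≤ 2 := by
      have := finrank_span_finset_le_card (R := ZMod 2) ({p, q} : Finset V)
      rw [Finset.coe_pair] at this
      exact this.trans Finset.card_le_two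
    omega
  have hpm : p ∈ span (ZMod 2) ({p, q} : Set V) := subset_span (by simp)
  have hqm : q ∈ span (ZMod 2) ({p, q} : Set V) := subset_span (by simp)
  apply hA.ag
  have hmem : ∀ α β : ZMod 2, α • p + β • q ∈ span (ZMod 2) ({p, q} : Set V) := fun α β =>
    add_mem (smul_mem _ _ hpm) (smul_mem _ _ hqm)
  have hmQ : ∀ α β : ZMod 2, α • p + β • q ∈ Q := fun α β =>
    add_mem (smul_mem _ _ hp) (smul_mem _ _ hq)
  have hpq0 : p + q ≠ 0 := fun h => hpq ((add_eq_zero_iff2).1 h)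
  refine hasAG_of_four (C := ∅) (by simp) u p q (u + s) ?_ ?_
  · intro δ α β γ h
    rw [span_empty, mem_bot] at h
    have hm := hmem α β
    have hmq := hmQ α β
    rcases z2 δ with rfl | rfl <;> rcases z2 γ with rfl | rfl <;> simp only [zero_smul, one_smul, zero_add, add_zero] at h
    · rcases z2 α with rfl | rfl <;> rcases z2 β with rfl | rfl <;> simp_all
    · exact absurd (show u ∈ Q by
        have : u = α • p + β • q + s := by
          rw [← add_assoc] at h
          have := (add_eq_zero_iff2).1 h
          rw [← this, add_self_left]
        rw [this]; exact add_mem hmq hs) hu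
    · exact absurd (show u ∈ Q by
        rw [add_assoc] at h
        rw [(add_eq_zero_iff2).1 h]; exact hmq) hu
    · exact absurd (show s ∈ span (ZMod 2) ({p, q} : Set V) by
        rw [show u + α • p + β • q + (u + s) = (u + u) + ((α • p + β • q) + s) by abel, add_self, zero_add] at h
        rw [← (add_eq_zero_iff2).1 h]; exact hm) hsp
  · intro α β γ
    refine ⟨0, zero_mem _, ?_⟩
    rw [add_zero]
    rcases z2 γ with rfl | rfl
    · rcases z2 α with rfl | rfl <;> rcases z2 β with rfl | rfl <;> simpa
    · rw [one_smul, show u + α • p + β • q + (u + s) = (u + u) + ((α • p + β • q) + s) by abel, add_self, zero_add]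
      apply hQS _ (add_mem (hmQ α β) hs)
      intro h
      exact hsp (by rw [← (add_eq_zero_iff2).1 h]; exact hmem α β)

open Classical in
/-- The part of `S` in the coset of `y`. -/
noncomputable def fb (S : Finset V) (Q : Submodule (ZMod 2) V) (y : V) : Finset V :=
  S.filter fun x => x + y ∈ Q

theorem mem_fb {x y : V} : x ∈ fb S Q y ↔ x ∈ S ∧ x + y ∈ Q := by
  unfold fb; simp only [Finset.mem_filter]

theorem xor_lt8 {t u : ℕ} (h : t / 8 = u / 8) : t ^^^ u < 8 := by
  have h1 : (t ^^^ u) >>> 3 = 0 := by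
    rw [Nat.shiftRight_xor_distrib, Nat.shiftRight_eq_div_pow, Nat.shiftRight_eq_div_pow]
    norm_num [h]
  rw [Nat.shiftRight_eq_div_pow] at h1
  omega

theorem cap_of [Finite V] {m : ℕ} (hr3 : 3 ≤ r) (hr : r ≤ 7) (hb : LI b r) (hbQ : SP b 3 = Q)
    (hm : ∀ y, y ∉ Q → (fb S Q y).card ≤ m) (k : ℕ) (hk : k ≠ 0) :
    ((cod b r S).filter fun x => x / 8 = k).card ≤ m := by
  rcases ((cod b r S).filter fun x => x / 8 = k).eq_empty_or_nonempty with h | ⟨t, ht⟩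
  · rw [h]; simp
  rw [Finset.mem_filter, mem_cod] at ht
  have hy : vec b t ∉ Q := by
    rw [← hbQ]
    intro h
    obtain ⟨t', ht', h'⟩ := exists_vec (by norm_num) h
    have := vec_inj hr hb (ht'.trans_le (Nat.pow_le_pow_right (by norm_num) hr3)) ht.1.1 h'
    omega
  refine le_trans ?_ (hm _ hy)
  apply Finset.card_le_card_of_injOn (vec b)
  · intro u hu
    rw [Finset.mem_coe, Finset.mem_filter, mem_cod] at hu
    rw [Finset.mem_coe, mem_fb]
    refine ⟨hu.1.2, ?_⟩
    rw [← vec_xor, ← hbQ]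
    exact vec_mem (n := 3) (xor_lt8 (by omega))
  · intro u hu v hv he
    rw [Finset.mem_coe, Finset.mem_filter, mem_cod] at hu hv
    exact vec_inj hr hb hu.1.1 hv.1.1 he

/-- The list of codes known to be inside. -/
def FIn (r : ℕ) (J : Finset ℕ) (E : ℕ → Prop) (x : ℕ) : Prop :=
  (0 < x ∧ x < 8) ∨ (∃ j ∈ J, x = 8 ^^^ j) ∨ E x ∨ ∃ i < r, 4 ≤ i ∧ x = 2 ^ i

instance (r : ℕ) (J : Finset ℕ) (E : ℕ → Prop) [DecidablePred E] (x : ℕ) : Decidable (FIn r J E x) := by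
  unfold FIn; infer_instance

/-- Common data of the Fano mode. -/
structure FD (r m p : ℕ) (S : Finset V) (Q : Submodule (ZMod 2) V) (J : Finset ℕ) (b : ℕ → V) : Prop where
  hA : Adm r S
  hQ : finrank (ZMod 2) Q = 3
  hQS : ∀ x ∈ Q, x ≠ 0 → x ∈ S
  hm : ∀ y, y ∉ Q → (fb S Q y).card ≤ m
  li : LI b 4
  bq : SP b 3 = Q
  jin : ∀ j ∈ J, j < 8 ∧ vec b (8 ^^^ j) ∈ S
  jout : ∀ j < 8, vec b (8 ^^^ j) ∈ S → j ∈ J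
  hp : p < 8
  hp0 : p ≠ 0
  hpJ : ∀ j ∈ J, j ^^^ p ∉ J

variable {m p n T : ℕ} {J : Finset ℕ}

theorem FD.congr {b' : ℕ → V} (h : FD r m p S Q J b) (hb : ∀ i < 4, b' i = b i) (hp : p < 8) : FD r m p S Q J b' := by
  have hv : ∀ x < 16, vec b' x = vec b x := fun x hx => vec_congr (n := 4) hx hb
  exact { h with
    li := (LI_congr hb).2 h.li
    bq := by rw [SP_congr (fun i hi => hb i (by omega)), h.bq]
    jin := fun j hj => by
      have := h.jin j hj
      rw [hv _ (Nat.xor_lt_two_pow (n := 4) (by norm_num) (by omega))]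
      exact this
    jout := fun j hj hjS => by
      rw [hv _ (Nat.xor_lt_two_pow (n := 4) (by norm_num) (by omega))] at hjS
      exact h.jout j hj hjS }

theorem FD.mem16 (h : FD r m p S Q J b) {t : ℕ} (ht : t < 16) (h1 : vec b t ∈ S) (h2 : vec b (t ^^^ p) ∈ S) :
    t < 8 ∧ t ≠ 0 ∧ t ≠ p := by
  have h0 := h.hA.nz
  refine ⟨?_, ?_, ?_⟩
  · by_contra hc
    have e : ∀ t < 16, ¬ t < 8 → ∀ p < 8, (t ^^^ 8) < 8 ∧ t ^^^ 8 ^^^ p < 8 ∧ 8 ^^^ (t ^^^ 8) = t ∧ 8 ^^^ (t ^^^ 8 ^^^ p) = t ^^^ p := by decide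
    obtain ⟨e1, e2, e3, e4⟩ := e t ht hc p h.hp
    have j1 := h.jout _ e1 (by rw [e3]; exact h1)
    have j2 := h.jout _ e2 (by rw [e4]; exact h2)
    exact h.hpJ _ j1 j2
  · rintro rfl; rw [vec_zero] at h1; exact h0 h1
  · rintro rfl; rw [Nat.xor_self, vec_zero] at h2; exact h0 h2

theorem FD.inQ (h : FD r m p S Q J b) {t : ℕ} (ht : t < 8) (h0 : t ≠ 0) : vec b t ∈ S := by
  apply h.hQS
  · rw [← h.bq]; exact vec_mem (n := 3) ht
  · intro hc
    exact h0 (vec_eq_zero (by norm_num) h.li (n := 4) (by omega) hc)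

theorem FD.pair1 (h : FD r m p S Q J b) (tri : ∀ e ∈ S, 2 * T ≤ tt S e) (hT : 4 ≤ T) :
    ∃ x ∈ S, x + vec b p ∈ S ∧ x ∉ SP b 4 := by
  by_contra! hc
  have h1 := tri _ (h.inQ h.hp h.hp0)
  have hsub : (S.filter fun x => x + vec b p ∈ S) ⊆ (((Finset.range 8).erase 0).erase p).image (vec b) := by
    intro x hx
    rw [Finset.mem_filter] at hx
    obtain ⟨t, ht, rfl⟩ := exists_vec (by norm_num) (hc x hx.1 hx.2)
    have := h.mem16 ht hx.1 (by rw [vec_xor]; exact hx.2)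
    exact Finset.mem_image_of_mem _ (by simp; omega)
  have h2 := (Finset.card_le_card hsub).trans Finset.card_image_le
  have hp := h.hp
  have hp0 := h.hp0
  rw [Finset.card_erase_of_mem (by simp; omega), Finset.card_erase_of_mem (by simp), Finset.card_range] at h2
  unfold tt at h1
  omega

theorem FD.pair2 [Finite V] (h : FD r m p S Q J b) (hb : LI b 5) (tri : ∀ e ∈ S, 2 * T ≤ tt S e) (hT : 5 ≤ T)
    (h4 : b 4 ∈ S) (h4p : b 4 + vec b p ∈ S) :
    ∃ x ∈ S, x + vec b p ∈ S ∧ x ∉ SP b 4 ∧ x + b 4 ∉ SP b 3 := by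
  by_contra! hc
  have h1 := tri _ (h.inQ h.hp h.hp0)
  have hp := h.hp
  have hp0 := h.hp0
  have hv4 : vec b 16 = b 4 := vec_pow b (i := 4) (by norm_num)
  have hsub : (S.filter fun x => x + vec b p ∈ S) ⊆ ((((Finset.range 8).erase 0).erase p) ∪ {16, 16 ^^^ p}).image (vec b) := by
    intro x hx
    rw [Finset.mem_filter] at hx
    by_cases hx4 : x ∈ SP b 4
    · obtain ⟨t, ht, rfl⟩ := exists_vec (by norm_num) hx4
      have := h.mem16 ht hx.1 (by rw [vec_xor]; exact hx.2)
      exact Finset.mem_image_of_mem _ (by simp; omega)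
    · obtain ⟨s, hs, hs2⟩ := exists_vec (by norm_num) (hc x hx.1 hx.2 hx4)
      have hxe : x = vec b (16 ^^^ s) := by rw [vec_xor, hv4, hs2, add_comm, add_cancel]
      rw [hxe]
      apply Finset.mem_image_of_mem
      by_cases hs0 : s = 0
      · rw [hs0]; simp
      by_cases hsp : s = p
      · rw [hsp]; simp
      exfalso
      have hne : ∀ s < 8, s ≠ 0 → vec b s ≠ 0 := fun s hs h0 hcon => h0 (vec_eq_zero (n := 5) (by norm_num) hb (by omega) hcon)
      have hm : ∀ s < 8, vec b s ∈ Q := fun s hs => by rw [← h.bq]; exact vec_mem (n := 3) hs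
      refine no4 h.hA h.hQ h.hQS (u := b 4) (p := vec b p) (q := vec b s) ?_ (hm _ hp) (hm _ hs) (hne _ hp hp0) (hne _ hs hs0) ?_ h4 h4p ?_ ?_
      · rw [← h.bq]
        intro hcon
        obtain ⟨t, ht, h'⟩ := exists_vec (by norm_num) hcon
        rw [← hv4] at h'
        have := vec_inj (n := 5) (by norm_num) hb (by omega) (by norm_num) h'
        omega
      · intro hcon
        exact hsp (vec_inj (n := 5) (by norm_num) hb (by omega) (by omega) hcon).symm
      · rw [← hv4, ← vec_xor, ← hxe]; exact hx.1
      · have := hx.2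
        rw [hxe, vec_xor, hv4] at this
        rwa [add_right_comm]
  have h2 := (Finset.card_le_card hsub).trans Finset.card_image_le
  have h3 := Finset.card_union_le (((Finset.range 8).erase 0).erase p) {16, 16 ^^^ p}
  rw [Finset.card_erase_of_mem (by simp; omega), Finset.card_erase_of_mem (by simp), Finset.card_range] at h3
  have h4 : ({16, 16 ^^^ p} : Finset ℕ).card ≤ 2 := Finset.card_le_two
  unfold tt at h1
  omega

theorem FD.run [Finite V] {iA : ℕ} {E : ℕ → Prop} (h : FD r m p S Q J b) (hb : LI b r) (hr4 : 5 ≤ r) (hr : r ≤ 7)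
    (cert : Eng.Prv ⟨r, n, T, m, false, false⟩ iA 0)
    (hiA : ∀ x < 128, iA.testBit x = true → FIn r J E x)
    (count : n ≤ S.card) (tri : ∀ e ∈ S, 2 * T ≤ tt S e)
    (hE : ∀ x < 128, E x → x < 32 ∨ x < 2 ^ r) (hE2 : ∀ x < 128, E x → vec b x ∈ S)
    (hbS : ∀ i < r, 4 ≤ i → b i ∈ S) : False := by
  have hs : SP b r = ⊤ := hb.SP_eq (by rw [finrank_top, h.hA.fr]) (fun _ _ => trivial)
  have H := mkHyp h.hA (by omega) hr hb hs n T m false false count tri (by simp)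
    (cap_of (by omega) hr hb h.bq h.hm) (by simp) (by simp)
  have p5 : 2 ^ 5 ≤ 2 ^ r := Nat.pow_le_pow_right (by norm_num) hr4
  refine no_goal rfl rfl (cert _ H ⟨fun x hx hbit => ?_, fun x hx hbit => by simp at hbit⟩)
  rw [mem_cod]
  rcases hiA x hx hbit with h1 | ⟨j, hj, rfl⟩ | h1 | ⟨i, hi, hi4, rfl⟩
  · exact ⟨by omega, h.inQ h1.2 (by omega)⟩
  · have := h.jin j hj
    refine ⟨?_, this.2⟩
    have : 8 ^^^ j < 2 ^ 5 := Nat.xor_lt_two_pow (by norm_num) (by omega)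
    omega
  · refine ⟨?_, hE2 x hx h1⟩
    rcases hE x hx h1 with h | h <;> omega
  · refine ⟨Nat.pow_lt_pow_right (by norm_num) hi, ?_⟩
    rw [vec_pow _ (by omega)]; exact hbS i hi hi4

theorem FD.step [Finite V] (h : FD r m p S Q J b) (hr5 : 5 ≤ r) (tri : ∀ e ∈ S, 2 * T ≤ tt S e) (hT : 4 ≤ T) :
    ∃ b', FD r m p S Q J b' ∧ LI b' 5 ∧ b' 4 ∈ S ∧ vec b' (16 ^^^ p) ∈ S := by
  obtain ⟨x, hx, hxp, hx4⟩ := h.pair1 tri hT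
  let b' : ℕ → V := fun i => if i = 4 then x else b i
  have hb' : ∀ i < 4, b' i = b i := fun i hi => if_neg (by omega)
  have b4 : b' 4 = x := if_pos rfl
  have h' := h.congr hb' h.hp
  refine ⟨b', h', ?_, b4 ▸ hx, ?_⟩
  · rw [LI_succ]; exact ⟨h'.li, by rw [b4, SP_congr hb']; exact hx4⟩
  · have hp := h.hp
    rw [vec_xor, show vec b' 16 = b' 4 from vec_pow b' (i := 4) (by norm_num), b4, vec_congr (n := 3) h.hp (fun i hi => hb' i (by omega))]
    exact hxp

theorem ext_S [Finite V] {k : ℕ} (hA : Adm r S) (hb : LI b k) (hk : k ≤ r) :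
    ∃ b', (∀ i < k, b' i = b i) ∧ (∀ i, k ≤ i → i < r → b' i ∈ S) ∧ LI b' r :=
  ext_LI b k r (S : Set V) hb hk (by rw [hA.sp, finrank_top, hA.fr])

theorem FD.done6 [Finite V] {iA : ℕ} (h : FD r m p S Q J b) (hr4 : 5 ≤ r) (hr : r ≤ 7)
    (cert : Eng.Prv ⟨r, n, T, m, false, false⟩ iA 0)
    (hiA : ∀ x < 128, iA.testBit x = true → FIn r J (fun x => x = 16 ^^^ p) x)
    (count : n ≤ S.card) (tri : ∀ e ∈ S, 2 * T ≤ tt S e) (hT : 4 ≤ T) : False := by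
  obtain ⟨b1, h1, l1, m1, m2⟩ := h.step hr4 tri hT
  obtain ⟨b2, e2, s2, l2⟩ := ext_S h.hA l1 hr4
  have hp := h.hp
  have hlt : 16 ^^^ p < 2 ^ 5 := Nat.xor_lt_two_pow (by norm_num) (by omega)
  refine (h1.congr (fun i hi => e2 i (by omega)) hp).run l2 hr4 hr cert hiA count tri ?_ ?_ ?_
  · rintro x _ rfl; exact .inl hlt
  · rintro x _ rfl
    rw [vec_congr hlt e2]; exact m2
  · intro i hi hi4
    rcases eq_or_lt_of_le hi4 with rfl | h
    · rw [e2 4 (by norm_num)]; exact m1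
    · exact s2 i h hi

theorem FD.done7 [Finite V] {iA : ℕ} (h : FD 7 m p S Q J b)
    (cert : Eng.Prv ⟨7, n, T, m, false, false⟩ iA 0)
    (hiA : ∀ x < 128, iA.testBit x = true → FIn 7 J (fun x => x = 16 ^^^ p ∨ x = 32 ^^^ p) x)
    (certD : ∀ s < 8, ∃ i, Eng.Prv ⟨7, n, T, m, false, false⟩ i 0 ∧ ∀ x < 128, i.testBit x = true →
      FIn 7 J (fun x => x = 16 ^^^ p ∨ x = 24 ^^^ s ∨ x = 24 ^^^ s ^^^ p) x)
    (count : n ≤ S.card) (tri : ∀ e ∈ S, 2 * T ≤ tt S e) (hT : 5 ≤ T) : False := by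
  obtain ⟨b1, h1, l1, m1, m2⟩ := h.step (by norm_num) tri (by omega)
  have hp := h.hp
  have hlt : 16 ^^^ p < 2 ^ 5 := Nat.xor_lt_two_pow (by norm_num) (by omega)
  have hv4 : ∀ b : ℕ → V, vec b 16 = b 4 := fun b => vec_pow b (i := 4) (by norm_num)
  have hv5 : ∀ b : ℕ → V, vec b 32 = b 5 := fun b => vec_pow b (i := 5) (by norm_num)
  obtain ⟨z, hz, hzp, hz4, hz3⟩ := h1.pair2 l1 tri hT m1 (by rw [← hv4 b1, ← vec_xor]; exact m2)
  by_cases hz5 : z ∈ SP b1 5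
  · obtain ⟨t, ht, rfl⟩ := exists_vec (by norm_num) hz5
    have t24 : 24 ≤ t := by
      by_contra hc
      rcases Nat.lt_or_ge t 16 with h16 | h16
      · exact hz4 (vec_mem (n := 4) h16)
      · apply hz3
        rw [← hv4 b1, ← vec_xor]
        exact vec_mem (n := 3) (xor_lt8 (by omega))
    obtain ⟨b2, e2, s2, l2⟩ := ext_S h.hA l1 (by norm_num)
    have e : ∀ t < 32, 24 ≤ t → (t ^^^ 24) < 8 ∧ 24 ^^^ (t ^^^ 24) = t := by decide
    obtain ⟨e3, e4⟩ := e t ht t24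
    obtain ⟨iD, cD, hiD⟩ := certD _ e3
    have htp : t ^^^ p < 2 ^ 5 := Nat.xor_lt_two_pow ht (by omega)
    refine (h1.congr (fun i hi => e2 i (by omega)) hp).run l2 (by norm_num) (by norm_num) cD hiD count tri ?_ ?_ ?_
    · intro x hx _; exact .inr hx
    · rintro x _ (rfl | rfl | rfl)
      · rw [vec_congr hlt e2]; exact m2
      · rw [e4, vec_congr ht e2]; exact hz
      · rw [e4, vec_congr htp e2, vec_xor]; exact hzp
    · intro i hi hi4
      rcases eq_or_lt_of_le hi4 with rfl | h
      · rw [e2 4 (by norm_num)]; exact m1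
      · exact s2 i h hi
  · let b' : ℕ → V := fun i => if i = 5 then z else b1 i
    have hb' : ∀ i < 5, b' i = b1 i := fun i hi => if_neg (by omega)
    have b5 : b' 5 = z := if_pos rfl
    have l6 : LI b' 6 := by
      rw [LI_succ]; exact ⟨(LI_congr hb').2 l1, by rw [b5, SP_congr hb']; exact hz5⟩
    obtain ⟨b2, e2, s2, l2⟩ := ext_S h.hA l6 (by norm_num)
    have e5 : ∀ i < 5, b2 i = b1 i := fun i hi => by rw [e2 i (by omega), hb' i hi]
    refine (h1.congr (fun i hi => e5 i (by omega)) hp).run l2 (by norm_num) (by norm_num) cert hiA count tri ?_ ?_ ?_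
    · intro x hx _; exact .inr hx
    · rintro x _ (rfl | rfl)
      · rw [vec_congr hlt e5]; exact m2
      · rw [vec_xor, hv5, e2 5 (by norm_num), b5, vec_congr (n := 3) hp (fun i hi => e5 i (by omega))]; exact hzp
    · intro i hi hi4
      rcases eq_or_lt_of_le hi4 with rfl | h
      · rw [e5 4 (by norm_num)]; exact m1
      · rcases eq_or_lt_of_le (show 5 ≤ i from h) with rfl | h
        · rw [e2 5 (by norm_num), b5]; exact hz
        · exact s2 i h hi

end FM

end Bin

set_option linter.unusedSectionVars false

namespace Bin

open Module Submodule

section FM2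

variable {V : Type} [AddCommGroup V] [Module (ZMod 2) V] [DecidableEq V] {b : ℕ → V} {r : ℕ}
  {S : Finset V} {Q : Submodule (ZMod 2) V}

theorem base0 [Finite V] (hQ : finrank (ZMod 2) Q = 3) {k : ℕ} (hk : k ≤ 3) {d : ℕ → V} (hd : LI d k)
    (hdQ : ∀ i < k, d i ∈ Q) : ∃ b : ℕ → V, LI b 3 ∧ SP b 3 = Q ∧ ∀ i < k, b i = d i := by
  obtain ⟨b, h1, h2, h3⟩ := ext_LI d k 3 (Q : Set V) hd hk (by rw [span_eq, hQ])
  refine ⟨b, h3, h3.SP_eq hQ fun i hi => ?_, h1⟩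
  rcases Nat.lt_or_ge i k with h | h
  · rw [h1 i h]; exact hdQ i h
  · exact h2 i h hi

theorem base1 [Finite V] (hQ : finrank (ZMod 2) Q = 3) {k : ℕ} (hk : k ≤ 3) {d : ℕ → V} (hd : LI d k)
    (hdQ : ∀ i < k, d i ∈ Q) {x : V} (hx : x ∉ Q) :
    ∃ b : ℕ → V, LI b 4 ∧ SP b 3 = Q ∧ (∀ i < k, b i = d i) ∧ b 3 = x := by
  obtain ⟨b, h1, h2, h3⟩ := base0 hQ hk hd hdQ
  have e : ∀ i < 3, (if i = 3 then x else b i) = b i := fun i hi => if_neg (by omega)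
  have e2 : SP (fun i => if i = 3 then x else b i) 3 = Q := by rw [← h2]; exact SP_congr e
  refine ⟨fun i => if i = 3 then x else b i, ?_, e2, fun i hi => by rw [← h3 i hi]; exact e i (by omega), if_pos rfl⟩
  rw [LI_succ, e2]
  exact ⟨(LI_congr e).2 h1, by simpa using hx⟩

theorem LI_two {d : ℕ → V} (h0 : d 0 ≠ 0) (h1 : d 1 ≠ 0) (h01 : d 1 ≠ d 0) : LI d 2 := by
  rw [LI_succ, LI_succ]
  refine ⟨⟨LI_zero _, by rw [SP_zero, mem_bot]; exact h0⟩, ?_⟩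
  rw [mem_SP_succ, SP_zero, mem_bot, mem_bot, add_eq_zero_iff2]
  exact not_or.2 ⟨h1, h01⟩

theorem LI_three {d : ℕ → V} (h0 : d 0 ≠ 0) (h1 : d 1 ≠ 0) (h01 : d 1 ≠ d 0) (h2 : d 2 ≠ 0) (h02 : d 2 ≠ d 0)
    (h12 : d 2 ≠ d 1) (h012 : d 2 + d 1 ≠ d 0) : LI d 3 := by
  rw [LI_succ]
  refine ⟨LI_two h0 h1 h01, ?_⟩
  rw [mem_SP_succ, mem_SP_succ, mem_SP_succ, SP_zero, mem_bot, mem_bot, mem_bot, mem_bot, add_eq_zero_iff2, add_eq_zero_iff2, add_eq_zero_iff2]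
  simp only [not_or]
  exact ⟨⟨h2, h02⟩, h12, h012⟩

theorem v1 (b : ℕ → V) : vec b 1 = b 0 := vec_pow b (i := 0) (by norm_num)
theorem v2 (b : ℕ → V) : vec b 2 = b 1 := vec_pow b (i := 1) (by norm_num)
theorem v4 (b : ℕ → V) : vec b 4 = b 2 := vec_pow b (i := 2) (by norm_num)
theorem v8 (b : ℕ → V) : vec b 8 = b 3 := vec_pow b (i := 3) (by norm_num)

theorem v_add {x y : V} : x + (y + x) = y := by rw [add_comm, add_cancel]

theorem no4c [Finite V] (hA : Adm r S) (hQ : finrank (ZMod 2) Q = 3) (hQS : ∀ x ∈ Q, x ≠ 0 → x ∈ S)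
    (hb : LI b 4) (hbQ : SP b 3 = Q) {u p q : ℕ} (hu : u < 16 ∧ 8 ≤ u) (hp : p < 8) (hq : q < 8) (hp0 : p ≠ 0) (hq0 : q ≠ 0)
    (hpq : p ≠ q) (h1 : vec b u ∈ S) (h2 : vec b (u ^^^ p) ∈ S) (h3 : vec b (u ^^^ q) ∈ S)
    (h4 : vec b (u ^^^ p ^^^ q) ∈ S) : False := by
  have hne : ∀ s < 8, s ≠ 0 → vec b s ≠ 0 := fun s hs h0 hcon => h0 (vec_eq_zero (n := 4) (by norm_num) hb (by omega) hcon)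
  have hm : ∀ s < 8, vec b s ∈ Q := fun s hs => by rw [← hbQ]; exact vec_mem (n := 3) hs
  refine no4 hA hQ hQS (u := vec b u) (p := vec b p) (q := vec b q) ?_ (hm _ hp) (hm _ hq) (hne _ hp hp0) (hne _ hq hq0) ?_ h1
    (by rwa [← vec_xor]) (by rwa [← vec_xor]) (by rwa [← vec_xor, ← vec_xor])
  · rw [← hbQ]
    intro hcon
    obtain ⟨t, ht, h'⟩ := exists_vec (by norm_num) hcon
    have := vec_inj (n := 4) (by norm_num) hb (by omega) (by omega) h'
    omega
  · intro hcon
    exact hpq (vec_inj (n := 4) (by norm_num) hb (by omega) (by omega) hcon)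

/-- Coordinates adapted to a fibre. -/
structure FB (S : Finset V) (Q : Submodule (ZMod 2) V) (J : Finset ℕ) (y : V) (b : ℕ → V) : Prop where
  li : LI b 4
  bq : SP b 3 = Q
  by3 : b 3 + y ∈ Q
  jin : ∀ j ∈ J, j < 8 ∧ vec b (8 ^^^ j) ∈ S

theorem fb4 [Finite V] (hA : Adm r S) (hQ : finrank (ZMod 2) Q = 3) (hQS : ∀ x ∈ Q, x ≠ 0 → x ∈ S)
    {y : V} (hy : y ∉ Q) (h : 4 ≤ (fb S Q y).card) : ∃ b, FB S Q {0, 1, 2, 4} y b := by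
  obtain ⟨x0, hx0⟩ := Finset.card_pos.1 (show 0 < (fb S Q y).card by omega)
  have hc := Finset.card_erase_of_mem hx0
  obtain ⟨x1, h1, x2, h2, x3, h3, h12, h13, h23⟩ := Finset.two_lt_card.1 (show 2 < ((fb S Q y).erase x0).card by omega)
  rw [Finset.mem_erase, mem_fb] at h1 h2 h3
  rw [mem_fb] at hx0
  have hq : ∀ x, x + y ∈ Q → x + x0 ∈ Q := fun x hx => by
    have := add_mem hx hx0.2
    rwa [show x + y + (x0 + y) = x + x0 + (y + y) by abel, add_self, add_zero] at this
  have hx0Q : x0 ∉ Q := fun hc => hy (by have := add_mem hc hx0.2; rwa [add_self_left] at this)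
  have hne : ∀ x, x ≠ x0 → x + x0 ≠ 0 := fun x h h' => h (add_eq_zero_iff2.1 h')
  have hne2 : ∀ x x', x ≠ x' → x + x0 ≠ x' + x0 := fun x x' h h' => h (add_right_cancel h')
  let d : ℕ → V := fun i => if i = 0 then x1 + x0 else if i = 1 then x2 + x0 else x3 + x0
  have hd : LI d 3 := by
    refine LI_three (hne _ h1.1) (hne _ h2.1) (hne2 _ _ h12.symm) (hne _ h3.1) (hne2 _ _ h13.symm) (hne2 _ _ h23.symm) ?_
    intro hcon
    have hcon : x3 + x0 + (x2 + x0) = x1 + x0 := hcon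
    have e1 : x0 + (x1 + x0) + (x2 + x0) = x3 := by
      rw [← hcon, show x0 + (x3 + x0 + (x2 + x0)) + (x2 + x0) = x3 + (x0 + x0) + ((x2 + x0) + (x2 + x0)) by abel, add_self, add_self, add_zero, add_zero]
    refine no4 hA hQ hQS hx0Q (hq _ h1.2.2) (hq _ h2.2.2) (hne _ h1.1) (hne _ h2.1) (hne2 _ _ h12) hx0.1 ?_ ?_ ?_
    · rw [v_add]; exact h1.2.1
    · rw [v_add]; exact h2.2.1
    · rw [e1]; exact h3.2.1
  obtain ⟨b, g1, g2, g3, g4⟩ := base1 hQ le_rfl hd (by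
    intro i hi
    interval_cases i
    · exact hq _ h1.2.2
    · exact hq _ h2.2.2
    · exact hq _ h3.2.2) hx0Q
  have b0 : b 0 = x1 + x0 := g3 0 (by norm_num)
  have b1 : b 1 = x2 + x0 := g3 1 (by norm_num)
  have b2 : b 2 = x3 + x0 := g3 2 (by norm_num)
  refine ⟨b, g1, g2, by rw [g4]; exact hx0.2, ?_⟩
  intro j hj
  simp only [Finset.mem_insert, Finset.mem_singleton] at hj
  rcases hj with rfl | rfl | rfl | rfl <;> refine ⟨by norm_num, ?_⟩ <;> rw [vec_xor, v8, g4]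
  · rw [vec_zero, add_zero]; exact hx0.1
  · rw [v1, b0, v_add]; exact h1.2.1
  · rw [v2, b1, v_add]; exact h2.2.1
  · rw [v4, b2, v_add]; exact h3.2.1

theorem fb3 [Finite V] (hQ : finrank (ZMod 2) Q = 3)
    {y : V} (hy : y ∉ Q) (h : 3 ≤ (fb S Q y).card) : ∃ b, FB S Q {0, 1, 2} y b := by
  obtain ⟨x0, hx0⟩ := Finset.card_pos.1 (show 0 < (fb S Q y).card by omega)
  have hc := Finset.card_erase_of_mem hx0
  obtain ⟨x1, h1, x2, h2, h12⟩ := Finset.one_lt_card.1 (show 1 < ((fb S Q y).erase x0).card by omega)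
  rw [Finset.mem_erase, mem_fb] at h1 h2
  rw [mem_fb] at hx0
  have hq : ∀ x, x + y ∈ Q → x + x0 ∈ Q := fun x hx => by
    have := add_mem hx hx0.2
    rwa [show x + y + (x0 + y) = x + x0 + (y + y) by abel, add_self, add_zero] at this
  have hx0Q : x0 ∉ Q := fun hc => hy (by have := add_mem hc hx0.2; rwa [add_self_left] at this)
  have hne : ∀ x, x ≠ x0 → x + x0 ≠ 0 := fun x h h' => h (add_eq_zero_iff2.1 h')
  have hne2 : ∀ x x', x ≠ x' → x + x0 ≠ x' + x0 := fun x x' h h' => h (add_right_cancel h')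
  let d : ℕ → V := fun i => if i = 0 then x1 + x0 else x2 + x0
  have hd : LI d 2 := LI_two (hne _ h1.1) (hne _ h2.1) (hne2 _ _ h12.symm)
  obtain ⟨b, g1, g2, g3, g4⟩ := base1 hQ (by norm_num) hd (by
    intro i hi
    interval_cases i
    · exact hq _ h1.2.2
    · exact hq _ h2.2.2) hx0Q
  have b0 : b 0 = x1 + x0 := g3 0 (by norm_num)
  have b1 : b 1 = x2 + x0 := g3 1 (by norm_num)
  refine ⟨b, g1, g2, by rw [g4]; exact hx0.2, ?_⟩
  intro j hj
  simp only [Finset.mem_insert, Finset.mem_singleton] at hj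
  rcases hj with rfl | rfl | rfl <;> refine ⟨by norm_num, ?_⟩ <;> rw [vec_xor, v8, g4]
  · rw [vec_zero, add_zero]; exact hx0.1
  · rw [v1, b0, v_add]; exact h1.2.1
  · rw [v2, b1, v_add]; exact h2.2.1

theorem fb2 [Finite V] (hQ : finrank (ZMod 2) Q = 3)
    {y : V} (hy : y ∉ Q) (h : 2 ≤ (fb S Q y).card) : ∃ b, FB S Q {0, 1} y b := by
  obtain ⟨x0, hx0⟩ := Finset.card_pos.1 (show 0 < (fb S Q y).card by omega)
  have hc := Finset.card_erase_of_mem hx0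
  obtain ⟨x1, h1⟩ := Finset.card_pos.1 (show 0 < ((fb S Q y).erase x0).card by omega)
  rw [Finset.mem_erase, mem_fb] at h1
  rw [mem_fb] at hx0
  have hq : ∀ x, x + y ∈ Q → x + x0 ∈ Q := fun x hx => by
    have := add_mem hx hx0.2
    rwa [show x + y + (x0 + y) = x + x0 + (y + y) by abel, add_self, add_zero] at this
  have hx0Q : x0 ∉ Q := fun hc => hy (by have := add_mem hc hx0.2; rwa [add_self_left] at this)
  have hne : ∀ x, x ≠ x0 → x + x0 ≠ 0 := fun x h h' => h (add_eq_zero_iff2.1 h')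
  let d : ℕ → V := fun i => x1 + x0
  have hd : LI d 1 := LI_one (hne _ h1.1)
  obtain ⟨b, g1, g2, g3, g4⟩ := base1 hQ (by norm_num) hd (fun i hi => hq _ h1.2.2) hx0Q
  have b0 : b 0 = x1 + x0 := g3 0 (by norm_num)
  refine ⟨b, g1, g2, by rw [g4]; exact hx0.2, ?_⟩
  intro j hj
  simp only [Finset.mem_insert, Finset.mem_singleton] at hj
  rcases hj with rfl | rfl <;> refine ⟨by norm_num, ?_⟩ <;> rw [vec_xor, v8, g4]
  · rw [vec_zero, add_zero]; exact hx0.1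
  · rw [v1, b0, v_add]; exact h1.2.1

theorem xor8_inj {i j : ℕ} (h : 8 ^^^ i = 8 ^^^ j) : i = j := Nat.xor_right_injective h

theorem FB.out {J : Finset ℕ} {y : V} (h : FB S Q J y b) (hc : (fb S Q y).card ≤ J.card) :
    ∀ j < 8, vec b (8 ^^^ j) ∈ S → j ∈ J := by
  have hlt : ∀ j < 8, 8 ^^^ j < 2 ^ 4 := fun j hj => Nat.xor_lt_two_pow (by norm_num) (by omega)
  have hmem : ∀ j < 8, vec b (8 ^^^ j) ∈ S → vec b (8 ^^^ j) ∈ fb S Q y := by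
    intro j hj hS
    rw [mem_fb]
    refine ⟨hS, ?_⟩
    rw [vec_xor, v8, add_right_comm]
    exact add_mem h.by3 (by rw [← h.bq]; exact vec_mem (n := 3) hj)
  have hinj : ∀ i < 8, ∀ j < 8, vec b (8 ^^^ i) = vec b (8 ^^^ j) → i = j := fun i hi j hj he =>
    xor8_inj (vec_inj (by norm_num) h.li (hlt i hi) (hlt j hj) he)
  have hsub : J.image (fun j => vec b (8 ^^^ j)) ⊆ fb S Q y := by
    intro x hx
    obtain ⟨j, hj, rfl⟩ := Finset.mem_image.1 hx
    exact hmem j (h.jin j hj).1 (h.jin j hj).2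
  have heq := Finset.eq_of_subset_of_card_le hsub (by
    rw [Finset.card_image_of_injOn]
    · exact hc
    · intro i hi j hj he
      exact hinj i (h.jin i hi).1 j (h.jin j hj).1 he)
  intro j hj hS
  have := hmem j hj hS
  rw [← heq, Finset.mem_image] at this
  obtain ⟨i, hi, he⟩ := this
  rwa [← hinj i (h.jin i hi).1 j hj he]

theorem fb_le [Finite V] (hA : Adm r S) (hQ : finrank (ZMod 2) Q = 3) (hQS : ∀ x ∈ Q, x ≠ 0 → x ∈ S)
    {y : V} (hy : y ∉ Q) : (fb S Q y).card ≤ 4 := by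
  by_contra hc
  obtain ⟨b, hb⟩ := fb4 hA hQ hQS hy (by omega)
  have m0 : vec b 8 ∈ S := (hb.jin 0 (by simp)).2
  have m1 : vec b 9 ∈ S := (hb.jin 1 (by simp)).2
  have m2 : vec b 10 ∈ S := (hb.jin 2 (by simp)).2
  have m4 : vec b 12 ∈ S := (hb.jin 4 (by simp)).2
  have hsub : fb S Q y ⊆ ({8, 9, 10, 12} : Finset ℕ).image (vec b) := by
    intro x hx
    rw [mem_fb] at hx
    have hx3 : b 3 + x ∈ Q := by
      have := add_mem hb.by3 hx.2
      rwa [show b 3 + y + (x + y) = b 3 + x + (y + y) by abel, add_self, add_zero] at this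
    rw [← hb.bq] at hx3
    obtain ⟨t, ht, hte⟩ := exists_vec (by norm_num) hx3
    have hxe : x = vec b (8 ^^^ t) := by rw [vec_xor, v8, hte, add_self_left]
    rw [hxe] at hx ⊢
    have key : ∀ u p q, (8 ^^^ t = u ^^^ p ^^^ q) → vec b u ∈ S → vec b (u ^^^ p) ∈ S → vec b (u ^^^ q) ∈ S →
      (u < 16 ∧ 8 ≤ u) → p < 8 → q < 8 → p ≠ 0 → q ≠ 0 → p ≠ q → False := by
      intro u p q h1 h2 h3 h4 a1 a2 a3 a4 a5 a6
      exact no4c hA hQ hQS hb.li hb.bq a1 a2 a3 a4 a5 a6 h2 h3 h4 (h1 ▸ hx.1)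
    apply Finset.mem_image_of_mem
    have ht : t < 8 := ht
    interval_cases t
    · simp
    · simp
    · simp
    · exact (key 8 1 2 rfl m0 m1 m2 (by norm_num) (by norm_num) (by norm_num) (by norm_num) (by norm_num) (by norm_num)).elim
    · simp
    · exact (key 8 1 4 rfl m0 m1 m4 (by norm_num) (by norm_num) (by norm_num) (by norm_num) (by norm_num) (by norm_num)).elim
    · exact (key 8 2 4 rfl m0 m2 m4 (by norm_num) (by norm_num) (by norm_num) (by norm_num) (by norm_num) (by norm_num)).elim
    · exact (key 9 3 5 rfl m1 m2 m4 (by norm_num) (by norm_num) (by norm_num) (by norm_num) (by norm_num) (by norm_num)).elim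
  have := (Finset.card_le_card hsub).trans Finset.card_image_le
  have h5 : ({8, 9, 10, 12} : Finset ℕ).card = 4 := rfl
  omega

theorem count_cap [Finite V] {m : ℕ} (hA : Adm r S) (hQ : finrank (ZMod 2) Q = 3) (hr3 : 3 ≤ r) (hr : r ≤ 7)
    (hm : ∀ y, y ∉ Q → (fb S Q y).card ≤ m) : S.card ≤ 7 + (2 ^ (r - 3) - 1) * m := by
  obtain ⟨b0, h1, h2, -⟩ := base0 hQ (k := 0) (d := fun _ => 0) (by norm_num) (LI_zero _) (by simp)
  obtain ⟨b, e2, -, l2⟩ := ext_S hA h1 hr3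
  have hs : SP b r = ⊤ := l2.SP_eq (by rw [finrank_top, hA.fr]) (fun _ _ => trivial)
  have hbq : SP b 3 = Q := by rw [SP_congr e2, h2]
  have hc := card_cod (S := S) hr l2 hs (fun _ => True) (fun _ => True) (by simp)
  rw [Finset.filter_true, Finset.filter_true] at hc
  rw [← hc]
  have hsub : cod b r S ⊆ (Finset.range 8).erase 0 ∪
      (Finset.Ico 1 (2 ^ (r - 3))).biUnion (fun k => (cod b r S).filter fun x => x / 8 = k) := by
    intro x hx
    rw [Finset.mem_union]
    have hx' := mem_cod.1 hx
    rcases Nat.lt_or_ge x 8 with h | h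
    · left
      rw [Finset.mem_erase, Finset.mem_range]
      refine ⟨?_, h⟩
      rintro rfl
      exact hA.nz (by have := hx'.2; rwa [vec_zero] at this)
    · right
      rw [Finset.mem_biUnion]
      refine ⟨x / 8, ?_, Finset.mem_filter.2 ⟨hx, rfl⟩⟩
      rw [Finset.mem_Ico]
      have : 2 ^ r = 2 ^ (r - 3) * 8 := by
        rw [show (8 : ℕ) = 2 ^ 3 by norm_num, ← pow_add, Nat.sub_add_cancel hr3]
      omega
  refine (Finset.card_le_card hsub).trans ((Finset.card_union_le _ _).trans ?_)
  have e1 : ((Finset.range 8).erase 0).card = 7 := rfl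
  have e2 := Finset.card_biUnion_le_card_mul (Finset.Ico 1 (2 ^ (r - 3))) (fun k => (cod b r S).filter fun x => x / 8 = k) m
    (fun k hk => cap_of hr3 hr l2 hbq hm k (by rw [Finset.mem_Ico] at hk; omega))
  rw [Nat.card_Ico] at e2
  omega

/-- Case distinction in the Fano mode. -/
theorem F_cases [Finite V] (hA : Adm r S) (hF : HasF7 S) (hr3 : 3 ≤ r) (hr : r ≤ 7) (hcount : 7 + (2 ^ (r - 3) - 1) * 1 < S.card) :
    ∃ Q, ((∃ b, FD r 4 7 S Q {0, 1, 2, 4} b) ∨ (∃ b, FD r 3 4 S Q {0, 1, 2} b) ∨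
      ((S.card ≤ 7 + (2 ^ (r - 3) - 1) * 2) ∧ ∃ b, FD r 2 2 S Q {0, 1} b)) := by
  obtain ⟨Q, hQ, hQS⟩ := hF
  refine ⟨Q, ?_⟩
  have h4 : ∀ y, y ∉ Q → (fb S Q y).card ≤ 4 := fun y hy => fb_le hA hQ hQS hy
  by_cases h3 : ∀ y, y ∉ Q → (fb S Q y).card ≤ 3
  · right
    by_cases h2 : ∀ y, y ∉ Q → (fb S Q y).card ≤ 2
    · right
      refine ⟨count_cap hA hQ hr3 hr h2, ?_⟩
      by_cases h1 : ∀ y, y ∉ Q → (fb S Q y).card ≤ 1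
      · have := count_cap hA hQ hr3 hr h1
        omega
      · push Not at h1
        obtain ⟨y, hy, hc⟩ := h1
        obtain ⟨b, hb⟩ := fb2 hQ hy hc
        exact ⟨b, hA, hQ, hQS, h2, hb.li, hb.bq, hb.jin, hb.out (h2 y hy), by norm_num, by norm_num, by decide⟩
    · push Not at h2
      obtain ⟨y, hy, hc⟩ := h2
      obtain ⟨b, hb⟩ := fb3 hQ hy hc
      exact .inl ⟨b, hA, hQ, hQS, h3, hb.li, hb.bq, hb.jin, hb.out (h3 y hy), by norm_num, by norm_num, by decide⟩
  · push Not at h3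
    obtain ⟨y, hy, hc⟩ := h3
    obtain ⟨b, hb⟩ := fb4 hA hQ hQS hy hc
    exact .inl ⟨b, hA, hQ, hQS, h4, hb.li, hb.bq, hb.jin, hb.out (h4 y hy), by norm_num, by norm_num, by decide⟩

theorem F5 [Finite V] (hA : Adm 5 S) (hF : HasF7 S) (count : 16 ≤ S.card) (tri : ∀ e ∈ S, 2 * 4 ≤ tt S e) : False := by
  obtain ⟨Q, ⟨b, h⟩ | ⟨b, h⟩ | ⟨h2, -⟩⟩ := F_cases hA hF (by norm_num) (by norm_num) (by norm_num; omega)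
  · exact h.done6 (by norm_num) (by norm_num) Eng.cF5m4 (by decide +kernel) count tri (by norm_num)
  · exact h.done6 (by norm_num) (by norm_num) Eng.cF5m3 (by decide +kernel) count tri (by norm_num)
  · norm_num at h2; omega

theorem F6 [Finite V] (hA : Adm 6 S) (hF : HasF7 S) (count : 20 ≤ S.card) (tri : ∀ e ∈ S, 2 * 4 ≤ tt S e) : False := by
  obtain ⟨Q, ⟨b, h⟩ | ⟨b, h⟩ | ⟨-, b, h⟩⟩ := F_cases hA hF (by norm_num) (by norm_num) (by norm_num; omega)
  · exact h.done6 (by norm_num) (by norm_num) Eng.cF6m4 (by decide +kernel) count tri (by norm_num)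
  · exact h.done6 (by norm_num) (by norm_num) Eng.cF6m3 (by decide +kernel) count tri (by norm_num)
  · exact h.done6 (by norm_num) (by norm_num) Eng.cF6m2 (by decide +kernel) count tri (by norm_num)

theorem F7 [Finite V] (hA : Adm 7 S) (hF : HasF7 S) (count : 25 ≤ S.card) (tri : ∀ e ∈ S, 2 * 5 ≤ tt S e) : False := by
  obtain ⟨Q, ⟨b, h⟩ | ⟨b, h⟩ | ⟨-, b, h⟩⟩ := F_cases hA hF (by norm_num) (by norm_num) (by norm_num; omega)
  · refine h.done7 Eng.cF7m4 (by decide +kernel) ?_ count tri (by norm_num)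
    intro s hs
    interval_cases s
    · exact ⟨_, Eng.cF7m4d0, by decide +kernel⟩
    · exact ⟨_, Eng.cF7m4d1, by decide +kernel⟩
    · exact ⟨_, Eng.cF7m4d2, by decide +kernel⟩
    · exact ⟨_, Eng.cF7m4d3, by decide +kernel⟩
    · exact ⟨_, Eng.cF7m4d3, by decide +kernel⟩
    · exact ⟨_, Eng.cF7m4d2, by decide +kernel⟩
    · exact ⟨_, Eng.cF7m4d1, by decide +kernel⟩
    · exact ⟨_, Eng.cF7m4d0, by decide +kernel⟩
  · refine h.done7 Eng.cF7m3 (by decide +kernel) ?_ count tri (by norm_num)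
    intro s hs
    interval_cases s
    · exact ⟨_, Eng.cF7m3d0, by decide +kernel⟩
    · exact ⟨_, Eng.cF7m3d1, by decide +kernel⟩
    · exact ⟨_, Eng.cF7m3d2, by decide +kernel⟩
    · exact ⟨_, Eng.cF7m3d3, by decide +kernel⟩
    · exact ⟨_, Eng.cF7m3d0, by decide +kernel⟩
    · exact ⟨_, Eng.cF7m3d1, by decide +kernel⟩
    · exact ⟨_, Eng.cF7m3d2, by decide +kernel⟩
    · exact ⟨_, Eng.cF7m3d3, by decide +kernel⟩
  · refine h.done7 Eng.cF7m2 (by decide +kernel) ?_ count tri (by norm_num)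
    intro s hs
    interval_cases s
    · exact ⟨_, Eng.cF7m2d0, by decide +kernel⟩
    · exact ⟨_, Eng.cF7m2d1, by decide +kernel⟩
    · exact ⟨_, Eng.cF7m2d0, by decide +kernel⟩
    · exact ⟨_, Eng.cF7m2d1, by decide +kernel⟩
    · exact ⟨_, Eng.cF7m2d4, by decide +kernel⟩
    · exact ⟨_, Eng.cF7m2d5, by decide +kernel⟩
    · exact ⟨_, Eng.cF7m2d4, by decide +kernel⟩
    · exact ⟨_, Eng.cF7m2d5, by decide +kernel⟩

end FM2

end Bin

set_option linter.unusedSectionVars false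

namespace Bin

open Module Submodule

section R56

variable {V : Type} [AddCommGroup V] [Module (ZMod 2) V] [DecidableEq V] {r : ℕ}
  {S : Finset V}

theorem tt_even {e : V} (he : e ≠ 0) : Even (tt S e) := by
  have h : ∑ x ∈ S.filter (fun x => x + e ∈ S), (1 : ZMod 2) = 0 := by
    apply Finset.sum_involution (fun x _ => x + e)
    · intro x hx; decide
    · intro x hx _ h
      exact he (by simpa using h)
    · intro x hx
      rw [Finset.mem_filter] at hx ⊢
      rw [add_cancel]; exact ⟨hx.2, hx.1⟩
    · intro x hx; exact add_cancel _ _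
  rw [Finset.sum_const, nsmul_eq_mul, mul_one] at h
  exact (ZMod.natCast_eq_zero_iff_even).1 h

theorem finite_quo [Finite V] (e : V) : Finite (V ⧸ span (ZMod 2) {e}) :=
  Finite.of_surjective _ (span (ZMod 2) {e}).mkQ_surjective

theorem R5 [Finite V] (hA : Adm 5 S) : S.card ≤ 15 := by
  by_contra hc
  have hb : ∀ e ∈ S, 2 * S.card ≤ 24 + tt S e := by
    intro e he
    have := card_quo hA.nz he
    haveI := finite_quo e
    have : (quo S e).card ≤ 11 := by classical exact R4 (hA.quo he)
    omega
  have tri : ∀ e ∈ S, 2 * 4 ≤ tt S e := fun e he => by have := hb e he; omega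
  by_cases hF : HasF7 S
  · exact F5 hA hF (by omega) tri
  · have hle : ∀ e ∈ S, tt S e ≤ 8 := fun e he => (tt_le hA (by norm_num) hF he).1
    have hs := sum_tt_mod hA.nz
    obtain ⟨e, he⟩ := Finset.card_pos.1 (show 0 < S.card by omega)
    have h1 := hb e he
    have h2 := hle e he
    have h16 : S.card = 16 := by omega
    rw [Finset.sum_congr rfl (fun e he => show tt S e = 8 by have := tri e he; have := hle e he; omega),
      Finset.sum_const, h16] at hs
    norm_num at hs

theorem R6 [Finite V] (hA : Adm 6 S) (hc : 20 ≤ S.card) : KV 6 S := by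
  have hb : ∀ e ∈ S, 2 * S.card ≤ 32 + tt S e := by
    intro e he
    have := card_quo hA.nz he
    haveI := finite_quo e
    have : (quo S e).card ≤ 15 := by classical exact R5 (hA.quo he)
    omega
  have tri : ∀ e ∈ S, 2 * 4 ≤ tt S e := fun e he => by have := hb e he; omega
  have hF : ¬ HasF7 S := fun hF => F6 hA hF hc tri
  by_cases h10 : ∃ e ∈ S, tt S e = 10
  · obtain ⟨e, he, h⟩ := h10
    exact caseAB6 hA hF hc tri he h
  · exfalso
    have hle : ∀ e ∈ S, tt S e = 8 := fun e he => by
      have h1 := (tt_le hA (by norm_num) hF he).1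
      have h2 : tt S e ≠ 10 := fun h => h10 ⟨e, he, h⟩
      obtain ⟨k, hk⟩ := tt_even (S := S) (fun h => hA.nz (h ▸ he))
      have := tri e he
      omega
    have hs := sum_tt_mod hA.nz
    obtain ⟨e, he⟩ := Finset.card_pos.1 (show 0 < S.card by omega)
    have h1 := hb e he
    have h2 := hle e he
    have h16 : S.card = 20 := by omega
    rw [Finset.sum_congr rfl hle, Finset.sum_const, h16] at hs
    norm_num at hs

theorem R7a [Finite V] (hA : Adm 7 S) (hc : 25 ≤ S.card) (hq : ∀ e ∈ S, (quo S e).card ≤ 19) : KV 7 S := by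
  have hb : ∀ e ∈ S, 2 * S.card ≤ 40 + tt S e := by
    intro e he
    have := card_quo hA.nz he
    have := hq e he
    omega
  have tri : ∀ e ∈ S, 2 * 5 ≤ tt S e := fun e he => by have := hb e he; omega
  have hF : ¬ HasF7 S := fun hF => F7 hA hF hc tri
  by_cases h10 : ∃ e ∈ S, tt S e = 12
  · obtain ⟨e, he, h⟩ := h10
    exact caseAB7 hA hF hc tri he h
  · exfalso
    have hle : ∀ e ∈ S, tt S e = 10 := fun e he => by
      have h1 := (tt_le hA (by norm_num) hF he).1
      have h2 : tt S e ≠ 12 := fun h => h10 ⟨e, he, h⟩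
      obtain ⟨k, hk⟩ := tt_even (S := S) (fun h => hA.nz (h ▸ he))
      have := tri e he
      omega
    have hs := sum_tt_mod hA.nz
    obtain ⟨e, he⟩ := Finset.card_pos.1 (show 0 < S.card by omega)
    have h1 := hb e he
    have h2 := hle e he
    have h16 : S.card = 25 := by omega
    rw [Finset.sum_congr rfl hle, Finset.sum_const, h16] at hs
    norm_num at hs

end R56

end Bin

set_option linter.unusedSectionVars false

namespace Bin

open Module Submodule

section LM

variable {V : Type} [AddCommGroup V] [Module (ZMod 2) V] [DecidableEq V] {S : Finset V} {e : V}

/-- Code of a vertex. -/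
def gc (k : ℕ) : ℕ := if k = 0 then 0 else 2 ^ k

theorem gc_mask : ∀ i < 7, ∀ j < 7, i ≠ j → Eng.fmask.testBit (gc i ^^^ gc j) = true ∧
    Eng.fmask.testBit (gc i ^^^ gc j ^^^ 1) = true ∧ gc i ^^^ gc j < 2 ^ 7 ∧ gc i ^^^ gc j ^^^ 1 < 2 ^ 7 := by decide +kernel

theorem fmask_lt : ∀ y, Eng.fmask.testBit y = true → y < 128 := by
  intro y hy
  by_contra h
  have h2 : Eng.fmask < 2 ^ y := lt_of_lt_of_le (show Eng.fmask < 2 ^ 128 by decide +kernel)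
    (Nat.pow_le_pow_right (by norm_num) (by omega))
  rw [Nat.testBit_lt_two_pow h2] at hy
  exact absurd hy (by decide)

theorem tmask : ∀ y, (18446744078004584724 : ℕ).testBit y = true → ∃ k < 7, 1 ≤ k ∧ y = 2 ^ k := by
  intro y hy
  have hlt : y < 128 := by
    by_contra h
    have h2 : (18446744078004584724 : ℕ) < 2 ^ y := lt_of_lt_of_le (show 18446744078004584724 < 2 ^ 128 by norm_num)
      (Nat.pow_le_pow_right (by norm_num) (by omega))
    rw [Nat.testBit_lt_two_pow h2] at hy
    exact absurd hy (by decide)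
  revert y
  have : ∀ y < 128, (18446744078004584724 : ℕ).testBit y = true → ∃ k < 7, 1 ≤ k ∧ y = 2 ^ k := by decide +kernel
  exact fun y h1 h2 => this y h2 h1

theorem half_aux : ∀ t < 128, (2 * (t / 2) = t ∨ 2 * (t / 2) = t ^^^ 1) ∧ 2 * (t / 2) < 128 ∧
    (Eng.fmask.testBit t = true → Eng.fmask.testBit (2 * (t / 2)) = true) := by decide +kernel

theorem half_eq : ∀ t < 128, ∀ y < 128, t / 2 = y / 2 → t = y ∨ t = y ^^^ 1 := by
  intro t _ y _ h
  have h1 := half_aux t ‹_›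
  have h2 := half_aux y ‹_›
  rcases h1.1 with a | a <;> rcases h2.1 with c | c
  · left; omega
  · right; omega
  · right
    have : t ^^^ 1 = y := by omega
    rw [← this, Nat.xor_assoc, Nat.xor_self, Nat.xor_zero]
  · left
    have : t ^^^ 1 = y ^^^ 1 := by omega
    exact Nat.xor_left_injective this

/-- The fibre codes. -/
def FF : Finset ℕ := (Finset.range 64).filter fun t => Eng.fmask.testBit (2 * t) = true

theorem card_FF : FF.card = 21 := by decide +kernel

theorem L_core [Finite V] (hA : Adm 7 S) (he : e ∈ S) (hq : 20 ≤ (quo S e).card)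
    (count : 25 ≤ S.card) (tri : ∀ e ∈ S, 2 * 3 ≤ tt S e) (w : ℕ → V ⧸ span (ZMod 2) {e})
    (hw : ∀ x ∈ S, x ≠ e → ∃ i < 7, ∃ j < 7, i ≠ j ∧ (span (ZMod 2) {e}).mkQ x = w i + w j) :
    ∃ b : ℕ → V, SP b 7 = ⊤ ∧ Eng.Hyp ⟨7, 25, 3, 8, false, true⟩ (cod b 7 S) ∧
      (∀ x ∈ cod b 7 S, x = 1 ∨ Eng.fmask.testBit x = true) ∧ 1 ∈ cod b 7 S ∧
      ∀ i < 7, ∀ j < 7, i ≠ j → (∃ x ∈ S, x + e ∈ S ∧ (span (ZMod 2) {e}).mkQ x = w i + w j) →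
        gc i ^^^ gc j ∈ cod b 7 S ∧ gc i ^^^ gc j ^^^ 1 ∈ cod b 7 S := by
  set q := (span (ZMod 2) {e}).mkQ with hqdef
  have hlift : ∀ k, ∃ v, q v = w k + w 0 ∧ (v ∉ S → v + e ∉ S) := by
    intro k
    obtain ⟨v, hv⟩ := (span (ZMod 2) {e}).mkQ_surjective (w k + w 0)
    by_cases h : v + e ∈ S
    · exact ⟨v + e, by rw [← hv, hqdef, mk_eq]; exact .inr rfl, fun h' => absurd h h'⟩
    · exact ⟨v, hv, fun _ => h⟩
  choose l hl1 hl2 using hlift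
  let b : ℕ → V := fun k => if k = 0 then e else l k
  have b0 : b 0 = e := rfl
  have hb : ∀ k, k ≠ 0 → b k = l k := fun k hk => if_neg hk
  have hg : ∀ k < 7, q (vec b (gc k)) = w k + w 0 := by
    intro k hk
    by_cases h0 : k = 0
    · subst h0
      rw [show gc 0 = 0 from rfl, vec_zero, map_zero, add_self]
    · rw [show gc k = 2 ^ k from if_neg h0, vec_pow _ hk, hb k h0, hl1]
  have hgg : ∀ i < 7, ∀ j < 7, q (vec b (gc i ^^^ gc j)) = w i + w j := by
    intro i hi j hj
    rw [vec_xor, map_add, hg i hi, hg j hj,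
      show w i + w 0 + (w j + w 0) = w i + w j + (w 0 + w 0) by abel, add_self, add_zero]
  have hv1 : ∀ t, vec b (t ^^^ 1) = vec b t + e := by
    intro t; rw [vec_xor, v1, b0]
  have hv1' : vec b 1 = e := v1 b
  have hcode : ∀ x ∈ S, x ≠ e → ∃ t, t < 2 ^ 7 ∧ Eng.fmask.testBit t = true ∧ vec b t = x := by
    intro x hx hxe
    obtain ⟨i, hi, j, hj, hij, h⟩ := hw x hx hxe
    rw [← hgg i hi j hj, hqdef, mk_eq] at h
    obtain ⟨m1, m2, m3, m4⟩ := gc_mask i hi j hj hij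
    rcases h with h | h
    · exact ⟨_, m3, m1, h.symm⟩
    · exact ⟨_, m4, m2, by rw [hv1, h]⟩
  have hs : SP b 7 = ⊤ := by
    rw [eq_top_iff, ← hA.sp, span_le]
    intro x hx
    by_cases hxe : x = e
    · rw [hxe, ← b0]; exact mem_SP (by norm_num)
    · obtain ⟨t, ht, -, rfl⟩ := hcode x hx hxe
      exact vec_mem ht
  have hli : LI b 7 := LI_of_span hA.fr hs
  have hout : ∀ x ∈ cod b 7 S, x = 1 ∨ Eng.fmask.testBit x = true := by
    intro x hx
    rw [mem_cod] at hx
    by_cases hxe : vec b x = e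
    · left
      rw [← hv1'] at hxe
      exact vec_inj (by norm_num) hli hx.1 (by norm_num) hxe
    · right
      obtain ⟨t, ht, hm, h⟩ := hcode _ hx.2 hxe
      rwa [← vec_inj (by norm_num) hli ht hx.1 h]
  have h128 : ∀ t, t < 128 → t ^^^ 1 < 2 ^ 7 := fun t ht => Nat.xor_lt_two_pow (n := 7) (by omega) (by norm_num)
  have hpair : ∀ i < 7, ∀ j < 7, i ≠ j → (∃ x ∈ S, x + e ∈ S ∧ q x = w i + w j) →
        gc i ^^^ gc j ∈ cod b 7 S ∧ gc i ^^^ gc j ^^^ 1 ∈ cod b 7 S := by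
    intro i hi j hj hij ⟨x, hx, hxe, h⟩
    obtain ⟨m1, m2, m3, m4⟩ := gc_mask i hi j hj hij
    rw [mem_cod, mem_cod, hv1]
    rw [← hgg i hi j hj, hqdef, mk_eq] at h
    rcases h with h | h
    · rw [← h]; exact ⟨⟨m3, hx⟩, m4, hxe⟩
    · rw [h, add_cancel] at hxe
      rw [← h]; exact ⟨⟨m3, hxe⟩, m4, hx⟩
  refine ⟨b, hs, ?_, hout, ?_, hpair⟩
  · refine mkHyp hA (by norm_num) le_rfl hli hs 25 3 8 false true count tri (by simp) (fun k _ => cap8 b 7 S k) ?_ ?_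
    · intro _ y z hy hz hyz hy0 hy1 hz0
      by_contra hz1
      have ylt := fmask_lt y hy
      have zlt := fmask_lt z hz
      have hFy : y / 2 ∈ FF := Finset.mem_filter.2 ⟨Finset.mem_range.2 (by omega), (half_aux y ylt).2.2 hy⟩
      have hFz : z / 2 ∈ FF := Finset.mem_filter.2 ⟨Finset.mem_range.2 (by omega), (half_aux z zlt).2.2 hz⟩
      classical
      have hsub : quo S e ⊆ ((FF.erase (y / 2)).erase (z / 2)).image (fun t => q (vec b (2 * t))) := by
        intro X hX
        obtain ⟨x, hx, hxe, rfl⟩ := mem_quo.1 hX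
        obtain ⟨t, ht, hm, rfl⟩ := hcode x hx hxe
        have htc : t ∈ cod b 7 S := mem_cod.2 ⟨ht, hx⟩
        rw [Finset.mem_image]
        refine ⟨t / 2, ?_, ?_⟩
        · rw [Finset.mem_erase, Finset.mem_erase]
          refine ⟨fun h => ?_, fun h => ?_, Finset.mem_filter.2 ⟨Finset.mem_range.2 (by omega), (half_aux t ht).2.2 hm⟩⟩
          · rcases half_eq t ht z zlt h with rfl | rfl
            · exact hz0 htc
            · exact hz1 htc
          · rcases half_eq t ht y ylt h with rfl | rfl
            · exact hy0 htc
            · exact hy1 htc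
        · rw [hqdef, mk_eq]
          rcases (half_aux t ht).1 with h | h
          · left; rw [h]
          · right; rw [h, hv1]
      have h1 := (Finset.card_le_card hsub).trans Finset.card_image_le
      rw [Finset.card_erase_of_mem (Finset.mem_erase.2 ⟨hyz.symm, hFz⟩), Finset.card_erase_of_mem hFy, card_FF] at h1
      omega
    · intro _ x hx hxS hx1
      obtain ⟨k, hk, hk1, rfl⟩ := tmask x hx
      rw [mem_cod] at hxS hx1
      rw [hv1] at hx1
      have hlt : 2 ^ k < 2 ^ 7 := Nat.pow_lt_pow_right (by norm_num) hk
      have hn : vec b (2 ^ k) ∉ S := fun h => hxS ⟨hlt, h⟩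
      rw [vec_pow _ hk, hb k (by omega)] at hn hx1
      exact hl2 k hn hx1.2
  · rw [mem_cod, hv1']; exact ⟨by norm_num, he⟩

theorem L_end {b : ℕ → V} {iA : ℕ} (hs : SP b 7 = ⊤) (H : Eng.Hyp ⟨7, 25, 3, 8, false, true⟩ (cod b 7 S))
    (hout : ∀ x ∈ cod b 7 S, x = 1 ∨ Eng.fmask.testBit x = true)
    (cert : Eng.Prv ⟨7, 25, 3, 8, false, true⟩ iA 340282366683250333813877577516872417280)
    (hin : ∀ x < 128, iA.testBit x = true → x ∈ cod b 7 S) : KV 7 S ∨ GV S := by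
  have ho : ∀ x < 128, (340282366683250333813877577516872417280 : ℕ).testBit x = true → x ≠ 1 ∧ Eng.fmask.testBit x = false := by
    decide +kernel
  have hval : Eng.Val (cod b 7 S) iA 340282366683250333813877577516872417280 := by
    refine ⟨hin, fun x hx hbit hmem => ?_⟩
    obtain ⟨h1, h2⟩ := ho x hx hbit
    rcases hout x hmem with h | h
    · exact h1 h
    · rw [h2] at h; exact absurd h (by decide)
  rcases cert _ H hval with h | h
  · exact .inl (KV_of le_rfl hs h.2)
  · exact .inr (GV_of le_rfl hs h.2)

/-- `w i + w j` is a doubled edge. -/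
def Dbl (S : Finset V) (e : V) (w : ℕ → V ⧸ span (ZMod 2) {e}) (i j : ℕ) : Prop :=
  ∃ x ∈ S, x + e ∈ S ∧ (span (ZMod 2) {e}).mkQ x = w i + w j

theorem Dbl.symm {w : ℕ → V ⧸ span (ZMod 2) {e}} {i j : ℕ} (h : Dbl S e w i j) : Dbl S e w j i := by
  obtain ⟨x, h1, h2, h3⟩ := h
  exact ⟨x, h1, h2, by rw [h3, add_comm]⟩

theorem L1 [Finite V] (hA : Adm 7 S) (he : e ∈ S) (hq : 20 ≤ (quo S e).card)
    (count : 25 ≤ S.card) (tri : ∀ e ∈ S, 2 * 3 ≤ tt S e) (w : ℕ → V ⧸ span (ZMod 2) {e})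
    (hw : ∀ x ∈ S, x ≠ e → ∃ i < 7, ∃ j < 7, i ≠ j ∧ (span (ZMod 2) {e}).mkQ x = w i + w j)
    (h1 : Dbl S e w 1 2) (h2 : Dbl S e w 1 3) : KV 7 S ∨ GV S := by
  obtain ⟨b, hs, H, ho, h1', hp⟩ := L_core hA he hq count tri w hw
  have c1 := hp 1 (by norm_num) 2 (by norm_num) (by norm_num) h1
  have c2 := hp 1 (by norm_num) 3 (by norm_num) (by norm_num) h2
  refine L_end hs H ho Eng.cL1 ?_
  have : ∀ x < 128, (3266 : ℕ).testBit x = true → x = 1 ∨ x = gc 1 ^^^ gc 2 ∨ x = gc 1 ^^^ gc 2 ^^^ 1 ∨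
    x = gc 1 ^^^ gc 3 ∨ x = gc 1 ^^^ gc 3 ^^^ 1 := by decide +kernel
  intro x hx hbit
  rcases this x hx hbit with rfl | rfl | rfl | rfl | rfl
  exacts [h1', c1.1, c1.2, c2.1, c2.2]

theorem L2 [Finite V] (hA : Adm 7 S) (he : e ∈ S) (hq : 20 ≤ (quo S e).card)
    (count : 25 ≤ S.card) (tri : ∀ e ∈ S, 2 * 3 ≤ tt S e) (w : ℕ → V ⧸ span (ZMod 2) {e})
    (hw : ∀ x ∈ S, x ≠ e → ∃ i < 7, ∃ j < 7, i ≠ j ∧ (span (ZMod 2) {e}).mkQ x = w i + w j)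
    (h1 : Dbl S e w 1 2) (h2 : Dbl S e w 3 4) : KV 7 S ∨ GV S := by
  obtain ⟨b, hs, H, ho, h1', hp⟩ := L_core hA he hq count tri w hw
  have c1 := hp 1 (by norm_num) 2 (by norm_num) (by norm_num) h1
  have c2 := hp 3 (by norm_num) 4 (by norm_num) (by norm_num) h2
  refine L_end hs H ho Eng.cL2 ?_
  have : ∀ x < 128, (50331842 : ℕ).testBit x = true → x = 1 ∨ x = gc 1 ^^^ gc 2 ∨ x = gc 1 ^^^ gc 2 ^^^ 1 ∨
    x = gc 3 ^^^ gc 4 ∨ x = gc 3 ^^^ gc 4 ^^^ 1 := by decide +kernel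
  intro x hx hbit
  rcases this x hx hbit with rfl | rfl | rfl | rfl | rfl
  exacts [h1', c1.1, c1.2, c2.1, c2.2]

/-- Relabelling of the vertices. -/
theorem relabel {f : ℕ → ℕ} (s : Finset ℕ) (hs : s ⊆ Finset.range 7)
    (hf : Set.InjOn f s) (hf7 : ∀ i ∈ s, f i < 7) :
    ∃ σ : ℕ → ℕ, (∀ i ∈ s, σ i = f i) ∧ (∀ i < 7, σ i < 7) ∧ ∀ j < 7, ∃ i < 7, σ i = j := by
  have hs7 : ∀ i ∈ s, i < 7 := fun i hi => Finset.mem_range.1 (hs hi)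
  obtain ⟨g, hg⟩ := Finset.exists_equiv_extend_of_card_eq (α := Fin 7) (β := ℕ) (t := Finset.range 7) (by simp)
    (s := Finset.univ.filter fun i : Fin 7 => (i : ℕ) ∈ s) (f := fun i => f i) (by
      intro x hx
      obtain ⟨i, hi, rfl⟩ := Finset.mem_image.1 hx
      exact Finset.mem_range.2 (hf7 _ (Finset.mem_filter.1 hi).2)) (by
      intro i hi j hj h
      exact Fin.ext (hf (by simpa using hi) (by simpa using hj) h))
  refine ⟨fun i => if h : i < 7 then g ⟨i, h⟩ else 0, ?_, ?_, ?_⟩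
  · intro i hi
    have h7 := hs7 i hi
    simp only [h7, dif_pos]
    exact hg ⟨i, h7⟩ (by simpa using hi)
  · intro i hi
    simp only [hi, dif_pos]
    exact Finset.mem_range.1 (g ⟨i, hi⟩).2
  · intro j hj
    refine ⟨(g.symm ⟨j, Finset.mem_range.2 hj⟩ : Fin 7), Fin.is_lt _, ?_⟩
    simp

theorem hw_perm {W : Type} [Add W] {w : ℕ → W} {σ : ℕ → ℕ} (h3 : ∀ j < 7, ∃ i < 7, σ i = j) {X : W}
    (h : ∃ i < 7, ∃ j < 7, i ≠ j ∧ X = w i + w j) : ∃ i < 7, ∃ j < 7, i ≠ j ∧ X = w (σ i) + w (σ j) := by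
  obtain ⟨i, hi, j, hj, hij, h⟩ := h
  obtain ⟨i', hi', rfl⟩ := h3 i hi
  obtain ⟨j', hj', rfl⟩ := h3 j hj
  exact ⟨i', hi', j', hj', fun h => hij (by rw [h]), h⟩

theorem KV6_card {V : Type} [AddCommGroup V] [Module (ZMod 2) V] [DecidableEq V] {S : Finset V} (h0 : (0 : V) ∉ S) (h : KV 6 S) : S.card ≤ 21 := by
  obtain ⟨c, hc⟩ := h
  let P : Finset (ℕ × ℕ) := (Finset.range 7 ×ˢ Finset.range 7).filter fun p => p.1 < p.2
  let w : ℕ → V := fun i => if i = 0 then 0 else c (i - 1)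
  have hsub : S ⊆ P.image fun p => w p.1 + w p.2 := by
    intro x hx
    rw [Finset.mem_image]
    rcases hc x hx with ⟨i, hi, rfl⟩ | ⟨i, hi, j, hj, rfl⟩
    · refine ⟨(0, i + 1), ?_, ?_⟩
      · simp [P]; omega
      · simp [w]
    · rcases lt_trichotomy i j with h | h | h
      · refine ⟨(i + 1, j + 1), ?_, ?_⟩
        · simp [P]; omega
        · simp [w]
      · exact absurd hx (by rw [h, add_self]; exact h0)
      · refine ⟨(j + 1, i + 1), ?_, ?_⟩
        · simp [P]; omega
        · simp [w, add_comm]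
  have h1 := (Finset.card_le_card hsub).trans Finset.card_image_le
  have h2 : P.card = 21 := by decide +kernel
  omega

theorem quo_card [Finite V] (hA : Adm 7 S) {f : V} (hf : f ∈ S) : (quo S f).card ≤ 21 := by
  classical
  by_contra hc
  haveI := finite_quo f
  have := KV6_card (hA.quo hf).nz (R6 (hA.quo hf) (by omega))
  omega

theorem R7 [Finite V] (hA : Adm 7 S) (hc : 25 ≤ S.card) : KV 7 S ∨ GV S := by
  by_cases hq : ∀ e ∈ S, (quo S e).card ≤ 19
  · exact .inl (R7a hA hc hq)
  push Not at hq
  obtain ⟨e, he, hq⟩ := hq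
  have tri : ∀ e ∈ S, 2 * 3 ≤ tt S e := fun f hf => by
    have h1 := card_quo hA.nz hf
    have h2 := quo_card hA hf
    omega
  have hKV : KV 6 (quo S e) := by
    classical
    haveI := finite_quo e
    exact R6 (hA.quo he) (by omega)
  obtain ⟨c, hc6⟩ := hKV
  set q := (span (ZMod 2) {e}).mkQ with hqdef
  let w : ℕ → V ⧸ span (ZMod 2) {e} := fun i => if i = 0 then 0 else c (i - 1)
  have hw : ∀ x ∈ S, x ≠ e → ∃ i < 7, ∃ j < 7, i ≠ j ∧ q x = w i + w j := by
    intro x hx hxe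
    have hm : q x ∈ quo S e := mem_quo.2 ⟨x, hx, hxe, rfl⟩
    rcases hc6 _ hm with ⟨i, hi, h⟩ | ⟨i, hi, j, hj, h⟩
    · exact ⟨0, by norm_num, i + 1, by omega, by omega, by rw [h]; simp [w]⟩
    · refine ⟨i + 1, by omega, j + 1, by omega, ?_, by rw [h]; simp [w]⟩
      intro hij
      have : i = j := by omega
      rw [this, add_self] at h
      exact (hA.quo he).nz (h ▸ hm)
  have h6 := tri e he
  have he0 : ∀ x, x + e ∈ S → x ≠ e := fun x hx h => hA.nz (by rw [h, add_self] at hx; exact hx)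
  set D := S.filter fun x => x + e ∈ S with hD
  have hDc : 6 ≤ D.card := h6
  obtain ⟨x1, hx1⟩ := Finset.card_pos.1 (show 0 < D.card by omega)
  have hE1 := Finset.pred_card_le_card_erase (s := D) (a := x1)
  have hE2 := Finset.pred_card_le_card_erase (s := D.erase x1) (a := x1 + e)
  obtain ⟨x2, hx2⟩ := Finset.card_pos.1 (show 0 < ((D.erase x1).erase (x1 + e)).card by omega)
  rw [Finset.mem_erase, Finset.mem_erase, hD, Finset.mem_filter] at hx2
  rw [hD, Finset.mem_filter] at hx1
  have hne : q x2 ≠ q x1 := by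
    rw [hqdef, Ne, mk_eq]
    exact not_or.2 ⟨hx2.2.1, hx2.1⟩
  obtain ⟨i, hi, j, hj, hij, h1⟩ := hw x1 hx1.1 (he0 _ hx1.2)
  obtain ⟨k, hk, l, hl, hkl, h2⟩ := hw x2 hx2.2.2.1 (he0 _ hx2.2.2.2)
  have d1 : Dbl S e w i j := ⟨x1, hx1.1, hx1.2, h1⟩
  have d2 : Dbl S e w k l := ⟨x2, hx2.2.2.1, hx2.2.2.2, h2⟩
  have adj : ∀ i j l, i < 7 → j < 7 → l < 7 → i ≠ j → i ≠ l → j ≠ l → Dbl S e w i j → Dbl S e w i l → KV 7 S ∨ GV S := by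
    intro i j l hi hj hl hij hil hjl d1 d2
    obtain ⟨σ, s1, s2, s3⟩ := relabel
      (f := fun n => if n = 1 then i else if n = 2 then j else l) {1, 2, 3} (by decide) (by
        intro a ha b hb h
        simp only [Finset.coe_insert, Finset.coe_singleton, Set.mem_insert_iff, Set.mem_singleton_iff] at ha hb
        rcases ha with rfl | rfl | rfl <;> rcases hb with rfl | rfl | rfl <;> simp at h ⊢ <;> omega) (by
        intro a ha
        split_ifs <;> assumption)
    have e1 : σ 1 = i := s1 1 (by simp)
    have e2 : σ 2 = j := s1 2 (by simp)
    have e3 : σ 3 = l := s1 3 (by simp)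
    refine L1 hA he (by omega) hc tri (fun n => w (σ n)) (fun x hx hxe => hw_perm s3 (hw x hx hxe)) ?_ ?_
    · unfold Dbl; dsimp only; rw [e1, e2]; exact d1
    · unfold Dbl; dsimp only; rw [e1, e3]; exact d2
  by_cases hik : i = k
  · subst hik
    exact adj i j l hi hj hl hij hkl (by rintro rfl; exact hne (by rw [h1, h2])) d1 d2
  by_cases hil : i = l
  · subst hil
    exact adj i j k hi hj hk hij (Ne.symm hkl) (by rintro rfl; exact hne (by rw [h1, h2, add_comm])) d1 d2.symm
  by_cases hjk : j = k
  · subst hjk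
    exact adj j i l hj hi hl hij.symm hkl hil d1.symm d2
  by_cases hjl : j = l
  · subst hjl
    exact adj j i k hj hi hk hij.symm (Ne.symm hkl) hik d1.symm d2.symm
  obtain ⟨σ, s1, s2, s3⟩ := relabel
    (f := fun n => if n = 1 then i else if n = 2 then j else if n = 3 then k else l) {1, 2, 3, 4} (by decide) (by
      intro a ha b hb h
      simp only [Finset.coe_insert, Finset.coe_singleton, Set.mem_insert_iff, Set.mem_singleton_iff] at ha hb
      rcases ha with rfl | rfl | rfl | rfl <;> rcases hb with rfl | rfl | rfl | rfl <;> simp at h ⊢ <;> omega) (by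
      intro a ha
      split_ifs <;> assumption)
  have e1 : σ 1 = i := s1 1 (by simp)
  have e2 : σ 2 = j := s1 2 (by simp)
  have e3 : σ 3 = k := s1 3 (by simp)
  have e4 : σ 4 = l := s1 4 (by simp)
  refine L2 hA he (by omega) hc tri (fun n => w (σ n)) (fun x hx hxe => hw_perm s3 (hw x hx hxe)) ?_ ?_
  · unfold Dbl; dsimp only; rw [e1, e2]; exact d1
  · unfold Dbl; dsimp only; rw [e3, e4]; exact d2

end LM

end Bin

set_option linter.unusedSectionVars false
namespace Bin
open Module Submodule

theorem rep_iff {M : Matroid α} {F W W' : Type*} [Field F] [AddCommGroup W] [Module F W]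
    [AddCommGroup W'] [Module F W'] {φ : α → W} {ψ : α → W'} (f : W →ₗ[F] W')
    (hf : Function.Injective f) (h : ∀ e ∈ M.E, ψ e = f (φ e)) :
    M.IsRepBy F φ ↔ M.IsRepBy F ψ := by
  refine forall₂_congr fun I hI => ?_
  have : I.restrict ψ = f ∘ I.restrict φ := by
    funext x; exact h x (hI x.2)
  rw [this, f.linearIndependent_iff (LinearMap.ker_eq_bot.2 hf)]

section graph
variable {U : Type*} [Fintype U] [DecidableEq U] {ι : Type*}

/-- Independence of a set of oriented edges of a complete graph does not depend on the field. -/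
theorem edge_indep (F : Type*) [Field F] (s t : ι → U) :
    LinearIndependent F (fun i => (Pi.single (s i) 1 - Pi.single (t i) 1 : U → F)) ↔
      ∀ i, ∃ A : Set U, s i ∈ A ∧ t i ∉ A ∧ ∀ j, j ≠ i → (s j ∈ A ↔ t j ∈ A) := by
  classical
  rw [linearIndependent_iff_notMem_span]
  refine forall_congr' fun i => ⟨fun h => ?_, ?_⟩
  · obtain ⟨f, hf, hk⟩ := exists_le_ker_of_notMem h
    refine ⟨{u | f (Pi.single u 1) = f (Pi.single (s i) 1)}, rfl, ?_, fun j hj => ?_⟩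
    · intro ht
      rw [Set.mem_setOf_eq] at ht
      rw [map_sub, ht, sub_self] at hf
      exact hf rfl
    · have := hk (subset_span ⟨j, ⟨mem_univ j, hj⟩, rfl⟩)
      rw [LinearMap.mem_ker, map_sub, sub_eq_zero] at this
      rw [Set.mem_setOf_eq, Set.mem_setOf_eq, this]
  · rintro ⟨A, hs, ht, hA⟩ hm
    let f : (U → F) →ₗ[F] F := ∑ u, if u ∈ A then LinearMap.proj u else 0
    have hf : ∀ u, f (Pi.single u 1) = if u ∈ A then 1 else 0 := by
      intro u
      simp only [f, LinearMap.sum_apply]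
      rw [Finset.sum_eq_single u]
      · split_ifs <;> simp
      · intro v _ hv
        split_ifs
        · simp [hv]
        · rfl
      · simp
    have hle : span F ((fun i => (Pi.single (s i) 1 - Pi.single (t i) 1 : U → F)) '' (univ \ {i})) ≤
        LinearMap.ker f := by
      rw [span_le]
      rintro _ ⟨j, ⟨-, hj⟩, rfl⟩
      show f _ = 0
      rw [map_sub, hf, hf, sub_eq_zero]
      simp only [hA j hj]
    have := hle hm
    rw [LinearMap.mem_ker, map_sub, hf, hf, if_pos hs, if_neg ht, sub_zero] at this
    exact one_ne_zero this

theorem rep_edge {M : Matroid α} {m : ℕ} (s t : α → Fin m)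
    (h : M.IsRepBy (ZMod 2) (fun e => (Pi.single (s e) 1 + Pi.single (t e) 1 : Fin m → ZMod 2))) :
    M.IsRegularM := by
  intro F _
  refine ⟨m, fun e => Pi.single (s e) 1 - Pi.single (t e) 1, fun I hI => ?_⟩
  rw [h I hI]
  have h2 : (I.restrict fun e => (Pi.single (s e) 1 + Pi.single (t e) 1 : Fin m → ZMod 2)) =
      fun i : I => Pi.single (s i) 1 - Pi.single (t i) 1 := by
    funext i
    rw [ZModModule.sub_eq_add]; rfl
  rw [h2]
  exact (edge_indep (ZMod 2) _ _).trans (edge_indep F (fun i : I => s i) (fun i : I => t i)).symm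
end graph

variable {V : Type} [AddCommGroup V] [Module (ZMod 2) V]

/-- The vertex labels `c 6, 0, c 0, …, c 5`. -/
def dv (c : ℕ → V) (u : Fin 8) : V := if u = 0 then c 6 else if u = 1 then 0 else c (u - 2)

theorem dv_one (c : ℕ → V) : dv c 1 = 0 := rfl

theorem dv_six (c : ℕ → V) : dv c 0 = c 6 := rfl

theorem dv_lt (c : ℕ → V) {i : ℕ} (h : i < 6) : dv c ⟨i + 2, by omega⟩ = c i := by
  have h1 : (⟨i + 2, by omega⟩ : Fin 8) ≠ 0 := by simp [Fin.ext_iff]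
  have h2 : (⟨i + 2, by omega⟩ : Fin 8) ≠ 1 := by simp [Fin.ext_iff]
  rw [dv, if_neg h1, if_neg h2]; rfl

theorem dv_lt7 (c : ℕ → V) {i : ℕ} (h : i < 7) : ∃ u, dv c u = c i := by
  rcases Nat.lt_or_ge i 6 with h6 | h6
  · exact ⟨_, dv_lt c h6⟩
  · obtain rfl : i = 6 := by omega
    exact ⟨0, rfl⟩

theorem exists_coord8 {c : ℕ → V} (hli : LI c 7) (hs : SP c 7 = ⊤) :
    ∃ f : V →ₗ[ZMod 2] (Fin 8 → ZMod 2), Function.Injective f ∧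
      ∀ u, f (dv c u) = Pi.single u 1 + Pi.single 1 1 := by
  let b : Basis (Fin 7) (ZMod 2) V := Basis.mk hli (by rw [← SP_range, hs])
  let w : Fin 7 → Fin 8 := fun i => if h : (i : ℕ) < 6 then ⟨i + 2, by omega⟩ else 0
  let f : V →ₗ[ZMod 2] (Fin 8 → ZMod 2) :=
    b.constr (ZMod 2) fun i => Pi.single (w i) 1 + Pi.single 1 1
  let g : (Fin 8 → ZMod 2) →ₗ[ZMod 2] V := (Pi.basisFun (ZMod 2) (Fin 8)).constr (ZMod 2) (dv c)
  have hb : ∀ i, b i = c i := fun i => Basis.mk_apply hli _ i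
  have hf : ∀ i : Fin 7, f (c i) = Pi.single (w i) 1 + Pi.single 1 1 := by
    intro i; rw [← hb]; exact b.constr_basis ..
  have hg : ∀ u, g (Pi.single u 1) = dv c u := by
    intro u
    rw [← Pi.basisFun_apply]; exact Basis.constr_basis ..
  have hw : ∀ i : Fin 7, dv c (w i) = c i := by
    intro i
    by_cases h : (i : ℕ) < 6
    · simp only [w, dif_pos h]; exact dv_lt c h
    · simp only [w, dif_neg h]
      rw [show (i : ℕ) = 6 by omega]; rfl
  have hgf : g ∘ₗ f = LinearMap.id := by
    apply b.ext
    intro i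
    rw [LinearMap.comp_apply, hb, hf, map_add, hg, hg, hw, dv_one, add_zero]; rfl
  refine ⟨f, ?_, ?_⟩
  · exact Function.LeftInverse.injective (g := g) fun x => LinearMap.congr_fun hgf x
  · intro u
    have hu : u = 1 ∨ ∃ i : Fin 7, u = w i := by
      revert u; decide
    rcases hu with rfl | ⟨i, rfl⟩
    · rw [dv_one, map_zero, add_self]
    · rw [hw, hf]

theorem span_dv {c : ℕ → V} {S : Finset V} (hs : span (ZMod 2) (S : Set V) = ⊤)
    (h : ∀ x ∈ S, x ∈ SP c 7) : SP c 7 = ⊤ := by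
  rw [eq_top_iff, ← hs, span_le]; exact h

theorem dv_mem (c : ℕ → V) (u : Fin 8) : dv c u ∈ SP c 7 := by
  unfold dv
  split_ifs
  · exact mem_SP (by norm_num)
  · exact zero_mem _
  · exact mem_SP (by omega)

theorem KV_dv {S : Finset V} (h : KV 7 S) :
    ∃ c : ℕ → V, ∀ x ∈ S, ∃ u v, x = dv c u + dv c v := by
  obtain ⟨c, hc⟩ := h
  refine ⟨c, fun x hx => ?_⟩
  rcases hc x hx with ⟨i, hi, rfl⟩ | ⟨i, hi, j, hj, rfl⟩
  · obtain ⟨u, hu⟩ := dv_lt7 c hi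
    exact ⟨u, 1, by rw [dv_one, hu, add_zero]⟩
  · obtain ⟨u, hu⟩ := dv_lt7 c hi
    obtain ⟨v, hv⟩ := dv_lt7 c hj
    exact ⟨u, v, by rw [hu, hv]⟩

theorem KV_regular [Finite V] {M : Matroid α} {ψ : α → V} {S : Finset V} (hA : Adm 7 S)
    (hrep : M.IsRepBy (ZMod 2) ψ) (hS : ∀ e ∈ M.E, ψ e ∈ S) (hK : KV 7 S) : M.IsRegularM := by
  classical
  obtain ⟨c, hc⟩ := KV_dv hK
  have hs := span_dv (c := c) hA.sp (fun x hx => by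
    obtain ⟨u, v, rfl⟩ := hc x hx; exact add_mem (dv_mem c u) (dv_mem c v))
  obtain ⟨f, hf, hfd⟩ := exists_coord8 (LI_of_span hA.fr hs) hs
  have : ∀ e, ∃ u v : Fin 8, e ∈ M.E → ψ e = dv c u + dv c v := by
    intro e
    by_cases he : e ∈ M.E
    · obtain ⟨u, v, h⟩ := hc _ (hS e he)
      exact ⟨u, v, fun _ => h⟩
    · exact ⟨0, 0, fun h => absurd h he⟩
  choose s t hst using this
  refine rep_edge s t ((rep_iff f hf fun e he => ?_).1 hrep)
  rw [hst e he, map_add, hfd, hfd, add_add_add_comm, add_self, add_zero]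

theorem gpc_card : (gpcVecs 7).Finite ∧ (gpcVecs 7).ncard ≤ 25 := by
  classical
  let P : Finset (Fin 8 × Fin 8) := Finset.univ.filter fun p => p.1 ≠ 0 ∧ p.1 < p.2
  let T : Finset (Fin 8 → ZMod 2) := P.image (fun p => Pi.single p.1 1 + Pi.single p.2 1) ∪
    {Pi.single 0 1 + Pi.single 1 1, Pi.single 0 1 + Pi.single 2 1, Pi.single 0 1 + Pi.single 3 1,
      Pi.single 0 1 + Pi.single 1 1 + Pi.single 2 1 + Pi.single 3 1}
  have hT : gpcVecs 7 ⊆ (T : Set (Fin 8 → ZMod 2)) := by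
    rintro x (⟨i, j, hi, hj, hij, rfl⟩ | hx)
    · apply Finset.mem_union_left
      rw [Finset.mem_image]
      rcases lt_or_gt_of_ne hij with h | h
      · exact ⟨(i, j), by simp [P, hi, h], rfl⟩
      · exact ⟨(j, i), by simp [P, hj, h], add_comm _ _⟩
    · apply Finset.mem_union_right
      simpa using hx
  have hc : T.card ≤ 25 := by
    refine (Finset.card_union_le _ _).trans ?_
    have h1 := Finset.card_image_le (s := P)
      (f := fun p => (Pi.single p.1 1 + Pi.single p.2 1 : Fin 8 → ZMod 2))
    have h2 : P.card = 21 := by decide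
    have h3 := Finset.card_le_four (a := (Pi.single 0 1 + Pi.single 1 1 : Fin 8 → ZMod 2))
      (b := Pi.single 0 1 + Pi.single 2 1) (c := Pi.single 0 1 + Pi.single 3 1)
      (d := Pi.single 0 1 + Pi.single 1 1 + Pi.single 2 1 + Pi.single 3 1)
    omega
  refine ⟨T.finite_toSet.subset hT, ?_⟩
  have := Set.ncard_le_ncard hT T.finite_toSet
  rw [Set.ncard_coe_finset] at this
  exact this.trans hc

theorem GV_gpc [Finite V] {M : Matroid α} {ψ : α → V} {S : Finset V} (hA : Adm 7 S)
    (hrep : M.IsRepBy (ZMod 2) ψ) (hS : ∀ e ∈ M.E, ψ e ∈ S) (hinj : InjOn ψ M.E) (hG : GV S) :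
    M.E.ncard ≤ 25 ∧ (M.E.ncard = 25 → M.IsBinaryIsoTo (gpcVecs 7)) := by
  obtain ⟨c, hc⟩ := hG
  have hm : ∀ {i}, i < 7 → c i ∈ SP c 7 := fun h => mem_SP h
  have hs := span_dv (c := c) hA.sp (fun x hx => by
    rcases hc x hx with (⟨i, hi, rfl⟩ | ⟨i, hi, j, hj, rfl⟩) | rfl | rfl | rfl | rfl
    · exact hm (by omega)
    · exact add_mem (hm (by omega)) (hm (by omega))
    · exact hm (by norm_num)
    · exact add_mem (hm (by norm_num)) (hm (by norm_num))
    · exact add_mem (hm (by norm_num)) (hm (by norm_num))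
    · exact add_mem (hm (by norm_num)) (add_mem (hm (by norm_num)) (hm (by norm_num))))
  obtain ⟨f, hf, hfd⟩ := exists_coord8 (LI_of_span hA.fr hs) hs
  have f6 : f (c 6) = Pi.single 0 1 + Pi.single 1 1 := hfd 0
  have f0 : f (c 0) = Pi.single 2 1 + Pi.single 1 1 := hfd 2
  have f1 : f (c 1) = Pi.single 3 1 + Pi.single 1 1 := hfd 3
  have fc : ∀ i (h : i < 6), f (c i) = Pi.single ⟨i + 2, by omega⟩ 1 + Pi.single 1 1 := by
    intro i hi
    rw [← hfd, dv_lt c hi]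
  have hmap : MapsTo (fun e => f (ψ e)) M.E (gpcVecs 7) := by
    intro e he
    have hx := hS e he
    have hn : ψ e ≠ 0 := fun h => hA.nz (h ▸ hx)
    show f (ψ e) ∈ gpcVecs 7
    generalize ψ e = x at hx hn
    rcases hc x hx with (⟨i, hi, rfl⟩ | ⟨i, hi, j, hj, rfl⟩) | rfl | rfl | rfl | rfl
    · left
      exact ⟨⟨i + 2, by omega⟩, 1, by simp [Fin.ext_iff], by decide, by simp [Fin.ext_iff], fc i hi⟩
    · left
      refine ⟨⟨i + 2, by omega⟩, ⟨j + 2, by omega⟩, by simp [Fin.ext_iff], by simp [Fin.ext_iff], ?_, ?_⟩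
      · intro h
        rw [Fin.mk.injEq] at h
        obtain rfl : i = j := by omega
        exact hn (add_self _)
      · rw [map_add, fc i hi, fc j hj, add_add_add_comm, add_self, add_zero]
    · right; left; exact f6
    · right; right; left
      rw [map_add, f6, f0, add_add_add_comm, add_self, add_zero]
    · right; right; right; left
      rw [map_add, f6, f1, add_add_add_comm, add_self, add_zero]
    · right; right; right; right
      rw [Set.mem_singleton_iff, map_add, map_add, f6, f0, f1, add_add_add_comm (Pi.single 2 1),
        add_self, add_zero, add_assoc (Pi.single 0 1 + Pi.single 1 1)]
  have hinj' : InjOn (fun e => f (ψ e)) M.E := fun a ha b hb h => hinj ha hb (hf h)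
  have hle := Set.ncard_le_ncard hmap.image_subset gpc_card.1
  rw [hinj'.ncard_image] at hle
  refine ⟨hle.trans gpc_card.2, fun h25 => ⟨fun e => f (ψ e), (rep_iff f hf fun _ _ => rfl).1 hrep,
    hmap, hinj', ?_⟩⟩
  refine (Set.eq_of_subset_of_ncard_le hmap.image_subset ?_ gpc_card.1).ge
  rw [hinj'.ncard_image, h25]; exact gpc_card.2

theorem ag_minor {M : Matroid α} {ψ : α → V} {S : Finset V} (hrep : M.IsRepBy (ZMod 2) ψ)
    (hS : ∀ x, x ∈ S ↔ ∃ e ∈ M.E, ψ e = x) (h : HasAG S) : M.HasAGMinor := by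
  obtain ⟨C, hCS, g, hg, hw⟩ := h
  obtain ⟨J, hJt, -, hJs, hJ⟩ := exists_linearIndepOn_extension (linearIndepOn_empty (ZMod 2) ψ)
    (Set.empty_subset {e | e ∈ M.E ∧ ψ e ∈ C})
  have hJE : J ⊆ M.E := fun e he => (hJt he).1
  have hQ : span (ZMod 2) (ψ '' J) = span (ZMod 2) C := by
    apply le_antisymm
    · apply span_mono
      rintro _ ⟨e, he, rfl⟩
      exact (hJt he).2
    · rw [span_le]
      intro x hx
      obtain ⟨e, he, rfl⟩ := (hS x).1 (hCS hx)
      exact hJs ⟨e, ⟨he, hx⟩, rfl⟩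
  have hJi : M.Indep J := (hrep J hJE).2 hJ
  have hex : ∀ x : Fin 4 → ZMod 2, ∃ a, x 0 = 1 → a ∈ M.E ∧ mkQ (span (ZMod 2) C) (ψ a) = mkQ _ (g x) := by
    intro x
    by_cases hx : x 0 = 1
    · obtain ⟨w, hwC, hwS⟩ := hw x hx
      obtain ⟨e, he, hwe⟩ := (hS _).1 hwS
      refine ⟨e, fun _ => ⟨he, ?_⟩⟩
      rw [hwe, map_add, mkQ_apply _ w, (Submodule.Quotient.mk_eq_zero _).2 hwC, add_zero]
    · obtain ⟨e, -⟩ := hw (fun _ => 1) rfl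
      obtain ⟨e', he', -⟩ := (hS _).1 (hw (fun _ => 1) rfl).choose_spec.2
      exact ⟨e', fun h => absurd h hx⟩
  choose a ha using hex
  have hginj : Function.Injective (mkQ (span (ZMod 2) C) ∘ₗ g) := by
    rw [injective_iff_map_eq_zero]
    intro x hx
    exact hg x ((Submodule.Quotient.mk_eq_zero _).1 hx)
  have hainj : InjOn a agVecs := by
    intro x hx y hy hxy
    apply hginj
    rw [LinearMap.comp_apply, LinearMap.comp_apply, ← (ha x hx).2, ← (ha y hy).2, hxy]
  have haJ : ∀ x ∈ agVecs, a x ∉ J := by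
    intro x hx h
    have h1 : mkQ (span (ZMod 2) C) (ψ (a x)) = 0 :=
      (Submodule.Quotient.mk_eq_zero _).2 (subset_span (hJt h).2)
    rw [(ha x hx).2] at h1
    have h2 : x = 0 := hg x ((Submodule.Quotient.mk_eq_zero _).1 h1)
    have h3 : x 0 = 1 := hx
    rw [h2] at h3
    exact zero_ne_one h3
  have hR : a '' agVecs ⊆ M.E \ J := by
    rintro _ ⟨x, hx, rfl⟩
    exact ⟨(ha x hx).1, haJ x hx⟩
  have hE : ((M.con J).del (M.E \ a '' agVecs)).E = a '' agVecs := by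
    show (M.E \ J) \ (M.E \ a '' agVecs) = a '' agVecs
    ext e
    constructor
    · rintro ⟨h1, h2⟩
      by_contra h
      exact h2 ⟨h1.1, h⟩
    · intro h
      exact ⟨hR h, fun h2 => h2.2 h⟩
  have hχ : ∀ x ∈ agVecs, Function.invFunOn a agVecs (a x) = x :=
    fun x hx => hainj.leftInvOn_invFunOn hx
  refine ⟨(M.con J).del (M.E \ a '' agVecs), ⟨J, _, rfl⟩, Function.invFunOn a agVecs, ?_, ?_⟩
  · intro I hI
    have hI' : I ⊆ a '' agVecs := hE ▸ hI
    have hdisj : Disjoint J I := by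
      rw [Set.disjoint_right]
      intro e he
      exact (hR (hI' he)).2
    have h1 : ((M.con J).del (M.E \ a '' agVecs)).Indep I ↔ (M ／ J).Indep I := by
      show ((M ／ J) ↾ _).Indep I ↔ _
      rw [Matroid.restrict_indep_iff]
      exact and_iff_left hI
    rw [h1, hJi.contract_indep_iff, and_iff_right hdisj.symm, Set.union_comm,
      hrep _ (Set.union_subset hJE fun e he => (hR (hI' he)).1)]
    change LinearIndepOn (ZMod 2) ψ (J ∪ I) ↔ _
    rw [← hJ.quotient_iff_union hdisj, hQ]
    have h2 : (fun e : I => (mkQ (span (ZMod 2) C) ∘ ψ) e) =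
        (mkQ (span (ZMod 2) C) ∘ₗ g) ∘ I.restrict (Function.invFunOn a agVecs) := by
      funext ⟨e, he⟩
      obtain ⟨x, hx, rfl⟩ := hI' he
      show mkQ _ (ψ (a x)) = mkQ _ (g (Function.invFunOn a agVecs (a x)))
      rw [hχ x hx, (ha x hx).2]
    unfold LinearIndepOn
    rw [h2]
    exact (mkQ (span (ZMod 2) C) ∘ₗ g).linearIndependent_iff (LinearMap.ker_eq_bot.2 hginj)
  · rw [hE]
    refine ⟨?_, ?_, ?_⟩
    · rintro _ ⟨x, hx, rfl⟩
      rw [hχ x hx]; exact hx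
    · rintro _ ⟨x, hx, rfl⟩ _ ⟨y, hy, rfl⟩ h
      rw [hχ x hx, hχ y hy] at h
      rw [h]
    · intro x hx
      exact ⟨a x, ⟨x, hx, rfl⟩, hχ x hx⟩

theorem rank_eq [Finite V] {M : Matroid α} {ψ : α → V} (hrep : M.IsRepBy (ZMod 2) ψ)
    (hfin : M.E.Finite) (hsp : span (ZMod 2) (ψ '' M.E) = ⊤) : M.rkM = finrank (ZMod 2) V := by
  obtain ⟨J, hJE, -, hJs, hJ⟩ := exists_linearIndepOn_extension (linearIndepOn_empty (ZMod 2) ψ)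
    (Set.empty_subset M.E)
  refine IsGreatest.csSup_eq ⟨⟨J, hJE, (hrep J hJE).2 hJ, ?_⟩, ?_⟩
  · have : Fintype J := (hfin.subset hJE).fintype
    have h1 : span (ZMod 2) (Set.range fun e : J => ψ e) = ⊤ := by
      rw [show (Set.range fun e : J => ψ e) = ψ '' J from Set.image_eq_range ψ J ▸ rfl, eq_top_iff, ← hsp, span_le]
      exact hJs
    rw [← Nat.card_coe_set_eq, Nat.card_eq_fintype_card]
    exact (finrank_eq_card_basis (Basis.mk hJ h1.ge)).symm
  · rintro _ ⟨I, hI, hi, rfl⟩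
    have : Fintype I := (hfin.subset hI).fintype
    rw [← Nat.card_coe_set_eq, Nat.card_eq_fintype_card]
    exact ((hrep I hI).1 hi).fintype_card_le_finrank

theorem main_bound (M : Matroid α)
    (hbin : M.IsBinaryM) (hsimple : M.IsSimpleM) (hnonreg : ¬ M.IsRegularM)
    (hrank : M.rkM = 7) (hAG : ¬ M.HasAGMinor) :
    M.E.ncard ≤ 25 ∧ (M.E.ncard = 25 → M.IsBinaryIsoTo (gpcVecs 7)) := by
  classical
  obtain ⟨n, φ, hφ⟩ := hbin
  let P : Submodule (ZMod 2) (Fin n → ZMod 2) := span (ZMod 2) (φ '' M.E)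
  let ψ : α → P := fun e => if h : e ∈ M.E then ⟨φ e, subset_span ⟨e, h, rfl⟩⟩ else 0
  have hψ : ∀ e ∈ M.E, φ e = P.subtype (ψ e) := by
    intro e he
    simp only [ψ, dif_pos he]; rfl
  have hrep : M.IsRepBy (ZMod 2) ψ := (rep_iff P.subtype P.injective_subtype hψ).2 hφ
  have hinj : InjOn ψ M.E := by
    intro x hx y hy hxy
    have h := (hrep _ (Set.insert_subset hx (Set.singleton_subset_iff.2 hy))).1 (hsimple x hx y hy)
    exact congrArg Subtype.val
      (h.injective (a₁ := ⟨x, Set.mem_insert _ _⟩) (a₂ := ⟨y, Set.mem_insert_of_mem _ rfl⟩) hxy)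
  have hne : ∀ e ∈ M.E, ψ e ≠ 0 := by
    intro e he
    have h := (hrep _ (Set.insert_subset he (Set.singleton_subset_iff.2 he))).1 (hsimple e he e he)
    exact h.ne_zero ⟨e, Set.mem_insert _ _⟩
  have hfin : M.E.Finite := Set.Finite.of_finite_image (Set.toFinite _) hinj
  have hsp : span (ZMod 2) (ψ '' M.E) = ⊤ := by
    apply Submodule.map_injective_of_injective P.injective_subtype
    rw [map_span, ← Set.image_comp, Submodule.map_top, P.range_subtype]
    congr 1
    exact Set.image_congr fun e he => (hψ e he).symm
  let S : Finset P := (Set.toFinite (ψ '' M.E)).toFinset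
  have hS : ∀ x, x ∈ S ↔ ∃ e ∈ M.E, ψ e = x := by
    intro x
    rw [Set.Finite.mem_toFinset]; rfl
  have hA : Adm 7 S := by
    refine ⟨by rw [← rank_eq hrep hfin hsp, hrank], ?_, ?_, fun h => hAG (ag_minor hrep hS h)⟩
    · rw [Set.Finite.coe_toFinset]; exact hsp
    · rw [hS]
      rintro ⟨e, he, h0⟩
      exact hne e he h0
  have hcard : M.E.ncard = S.card := by
    rw [← hinj.ncard_image, Set.ncard_eq_toFinset_card _ (Set.toFinite _)]
  by_cases hc : 25 ≤ S.card
  · have hS' : ∀ e ∈ M.E, ψ e ∈ S := fun e he => (hS _).2 ⟨e, he, rfl⟩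
    rcases R7 hA hc with hK | hG
    · exact absurd (KV_regular hA hrep hS' hK) hnonreg
    · exact GV_gpc hA hrep hS' hinj hG
  · exact ⟨by omega, fun h => by omega⟩

end Bin

theorem rank_seven_nonregular {α : Type*} (M : Matroid α)
    (hbin : M.IsBinaryM) (hsimple : M.IsSimpleM) (hnonreg : ¬ M.IsRegularM)
    (hrank : M.rkM = 7) (hAG : ¬ M.HasAGMinor) :
    M.E.ncard ≤ 25 ∧ (M.E.ncard = 25 → M.IsBinaryIsoTo (gpcVecs 7)) := by
  exact Bin.main_bound M hbin hsimple hnonreg hrank hAG
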